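/- arXiv:0709.2463 — 8 statements merged into one kernel-verified Lean document; each statement's English description precedes it below -/
import Mathlib

section
/- Let F be an algebraically closed field of characteristic not 2, equipped with an involution a↦ā (possibly the identity). Let ε₁, ε₂ be nonzero elements of F and ε₃ ∈ F arbitrary. Then for all pairs (A,B) and (C,D) of n×n matrices over F: (A,B) is similar to (C,D) if and only if the triples T_ε(A,B) and T_ε(C,D) are *congruent. -/
open Matrix

variable {F : Type} [Field F]

/-- Conjugate transpose of a matrix with respect to an involution `σ` on `F`:
`A* = [σ(a_{ji})]`. -/
def starMat (σ : F →+* F) {m n : Type} (M : Matrix m n F) : Matrix n m F :=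
  (M.map σ)ᵀ

/-- The 4n×4n block matrix `J₄(0ₙ)` with `Iₙ` on the first block superdiagonal. -/
def J4 (F : Type) [Field F] (n : ℕ) : Matrix (Fin 4 × Fin n) (Fin 4 × Fin n) F :=
  fun p q => if (p.1 : ℕ) + 1 = (q.1 : ℕ) ∧ p.2 = q.2 then 1 else 0

/-- The 4n×4n block-diagonal matrix with given n×n diagonal blocks. -/
def blkDiag4 {n : ℕ} (M : Fin 4 → Matrix (Fin n) (Fin n) F) :
    Matrix (Fin 4 × Fin n) (Fin 4 × Fin n) F :=
  fun p q => if p.1 = q.1 then M p.1 p.2 q.2 else 0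

/-- `D(A,B) = diag(Iₙ, A, B, 0ₙ)`. -/
def Dmat {n : ℕ} (A B : Matrix (Fin n) (Fin n) F) :
    Matrix (Fin 4 × Fin n) (Fin 4 × Fin n) F :=
  blkDiag4 ![1, A, B, 0]

/-- The triple `T_ε(A,B)` of 8n×8n matrices. -/
def Ttriple (σ : F →+* F) (ε₁ ε₂ ε₃ : F) {n : ℕ} (A B : Matrix (Fin n) (Fin n) F) :
    Fin 3 → Matrix ((Fin 4 × Fin n) ⊕ (Fin 4 × Fin n)) ((Fin 4 × Fin n) ⊕ (Fin 4 × Fin n)) F :=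
  ![ Matrix.fromBlocks 0 1 (ε₁ • 1) 0,
     Matrix.fromBlocks 0 (J4 F n) (ε₂ • (J4 F n)ᵀ) 0,
     Matrix.fromBlocks 0 (Dmat A B) (ε₃ • Dmat (starMat σ A) (starMat σ B)) 0 ]

theorem starMat_mul (σ : F →+* F) {l m n : Type} [Fintype m] (M : Matrix l m F)
    (N : Matrix m n F) : starMat σ (M * N) = starMat σ N * starMat σ M := by
  simp [starMat, Matrix.map_mul, Matrix.transpose_mul]

theorem starMat_one (σ : F →+* F) {n : Type} [DecidableEq n] :
    starMat σ (1 : Matrix n n F) = 1 := by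
  simp [starMat, Matrix.map_one]

theorem starMat_starMat {σ : F →+* F} (hσ : Function.Involutive σ) {m n : Type}
    (M : Matrix m n F) : starMat σ (starMat σ M) = M := by
  ext i j
  exact hσ (M i j)

theorem starMat_fromBlocks_diag (σ : F →+* F) {m n : Type} (M : Matrix m m F)
    (N : Matrix n n F) :
    starMat σ (fromBlocks M 0 0 N) = fromBlocks (starMat σ M) 0 0 (starMat σ N) := by
  ext (i | i) (j | j) <;> simp [starMat]

theorem starMat_blkDiag4 (σ : F →+* F) {n : ℕ} (M : Fin 4 → Matrix (Fin n) (Fin n) F) :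
    starMat σ (blkDiag4 M) = blkDiag4 fun k => starMat σ (M k) := by
  ext ⟨i, a⟩ ⟨j, b⟩
  by_cases h : i = j
  · subst h; simp [starMat, blkDiag4]
  · simp [starMat, blkDiag4, h, Ne.symm h]

theorem blkDiag4_mul {n : ℕ} (M N : Fin 4 → Matrix (Fin n) (Fin n) F) :
    blkDiag4 M * blkDiag4 N = blkDiag4 fun k => M k * N k := by
  ext ⟨i, a⟩ ⟨j, b⟩
  by_cases h : i = j
  · subst h
    simp [blkDiag4, Matrix.mul_apply, Fintype.sum_prod_type]
  · simp [blkDiag4, Matrix.mul_apply, Fintype.sum_prod_type, h]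

theorem blkDiag4_one {n : ℕ} :
    blkDiag4 (fun _ => (1 : Matrix (Fin n) (Fin n) F)) = 1 := by
  ext ⟨i, a⟩ ⟨j, b⟩
  simp only [blkDiag4, Matrix.one_apply, Prod.mk.injEq, ite_and]

theorem J4_mul_blkDiag4 {n : ℕ} (S : Matrix (Fin n) (Fin n) F) :
    J4 F n * blkDiag4 (fun _ => S) = blkDiag4 (fun _ => S) * J4 F n := by
  ext ⟨i, a⟩ ⟨j, b⟩
  fin_cases i <;> fin_cases j <;>
    simp [J4, blkDiag4, Matrix.mul_apply, Fintype.sum_prod_type, Fin.sum_univ_four]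

theorem starMat_J4 (σ : F →+* F) (n : ℕ) : starMat σ (J4 F n) = (J4 F n)ᵀ := by
  ext p q
  simp [starMat, J4, apply_ite σ]

theorem starMat_Dmat (σ : F →+* F) {n : ℕ} (A B : Matrix (Fin n) (Fin n) F) :
    starMat σ (Dmat A B) = Dmat (starMat σ A) (starMat σ B) := by
  rw [Dmat, starMat_blkDiag4, Dmat]
  congr 1
  funext k
  fin_cases k
  · exact starMat_one σ
  · rfl
  · rfl
  · simp [starMat]

theorem blkDiag4_mul_Dmat_mul {n : ℕ} {R S : Matrix (Fin n) (Fin n) F} (h : R * S = 1)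
    (A B : Matrix (Fin n) (Fin n) F) :
    blkDiag4 (fun _ => R) * Dmat A B * blkDiag4 (fun _ => S) =
      Dmat (R * A * S) (R * B * S) := by
  rw [Dmat, blkDiag4_mul, blkDiag4_mul, Dmat]
  congr 1
  funext k
  fin_cases k <;> simp [h]

theorem blkDiag4_mul_J4_mul {n : ℕ} {R S : Matrix (Fin n) (Fin n) F} (h : R * S = 1) :
    blkDiag4 (fun _ => R) * J4 F n * blkDiag4 (fun _ => S) = J4 F n := by
  rw [Matrix.mul_assoc, J4_mul_blkDiag4, ← Matrix.mul_assoc, blkDiag4_mul, h, blkDiag4_one,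
    Matrix.one_mul]

/-- Conjugating the off-diagonal pair `X`, `ε X*` by `(R*, S)` only requires knowing `R X S`. -/
theorem starMat_congr_fromBlocks {σ : F →+* F} (hσ : Function.Involutive σ) {m : Type}
    [Fintype m] {R S X Y : Matrix m m F} (ε : F) (h : R * X * S = Y) :
    starMat σ (fromBlocks (starMat σ R) 0 0 S) * fromBlocks 0 X (ε • starMat σ X) 0 *
      fromBlocks (starMat σ R) 0 0 S = fromBlocks 0 Y (ε • starMat σ Y) 0 := by
  rw [starMat_fromBlocks_diag, starMat_starMat hσ, fromBlocks_multiply, fromBlocks_multiply,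
    ← h, starMat_mul, starMat_mul]
  simp [Matrix.mul_assoc]

theorem Ttriple_eq (σ : F →+* F) (ε₁ ε₂ ε₃ : F) {n : ℕ} (A B : Matrix (Fin n) (Fin n) F) :
    Ttriple σ ε₁ ε₂ ε₃ A B =
      ![fromBlocks 0 1 (ε₁ • starMat σ 1) 0,
        fromBlocks 0 (J4 F n) (ε₂ • starMat σ (J4 F n)) 0,
        fromBlocks 0 (Dmat A B) (ε₃ • starMat σ (Dmat A B)) 0] := by
  rw [Ttriple, starMat_one, starMat_J4, starMat_Dmat]

/-- If an equivalence of matrices fixes an invertible `M`, then its right factor intertwines the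
quotients by `M` of all other pairs it carries into one another. -/
theorem intertwines_of_equivalence {m : Type} [Fintype m] [DecidableEq m]
    {U S L M X Y : Matrix m m F} (hL : M * L = 1) (hM : U * M * S = M) (hX : U * X * S = Y) :
    L * X * S = S * (L * Y) := by
  have hL' : L * M = 1 := mul_eq_one_comm.mp hL
  have h : S * (L * U * M) = 1 := by
    rw [mul_eq_one_comm]
    simp only [Matrix.mul_assoc] at hM ⊢
    rw [hM, hL']
  calc L * X * S = S * (L * U * M) * (L * X * S) := by rw [h, Matrix.one_mul]
    _ = S * (L * (U * ((M * L) * X) * S)) := by simp only [Matrix.mul_assoc]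
    _ = S * (L * Y) := by rw [hL, Matrix.one_mul, hX]

/-- The same intertwining relation for block off-diagonal matrices, read off on the right column
of blocks. -/
theorem right_blocks_intertwine {m : Type} [Fintype m] [DecidableEq m] {ε : F} (hε : ε ≠ 0)
    {U : Matrix (m ⊕ m) (m ⊕ m) F} {P Y Q Z X₁ X₂ Y₁ Y₂ : Matrix m m F}
    (hM : U * fromBlocks 0 1 (ε • 1) 0 * fromBlocks P Y Q Z = fromBlocks 0 1 (ε • 1) 0)
    (hX : U * fromBlocks 0 X₁ X₂ 0 * fromBlocks P Y Q Z = fromBlocks 0 Y₁ Y₂ 0) :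
    ε⁻¹ • (X₂ * Y) = Y * Y₁ ∧ X₁ * Z = Z * Y₁ := by
  have hL : (fromBlocks 0 1 (ε • 1) 0 : Matrix (m ⊕ m) (m ⊕ m) F) *
      fromBlocks 0 (ε⁻¹ • 1) 1 0 = 1 := by
    simp [fromBlocks_multiply, hε, smul_smul]
  have h := intertwines_of_equivalence hL hM hX
  simp only [fromBlocks_multiply, fromBlocks_inj] at h
  exact ⟨by simpa using h.2.1, by simpa using h.2.2.2⟩

theorem J4_mul_apply {n : ℕ} (Z : Matrix (Fin 4 × Fin n) (Fin 4 × Fin n) F) (i : Fin 3)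
    (a : Fin n) (q : Fin 4 × Fin n) : (J4 F n * Z) (i.castSucc, a) q = Z (i.succ, a) q := by
  fin_cases i <;>
    simp [J4, Matrix.mul_apply, Fintype.sum_prod_type, Fin.sum_univ_four]

theorem J4_transpose_mul_apply {n : ℕ} (Y : Matrix (Fin 4 × Fin n) (Fin 4 × Fin n) F)
    (i : Fin 3) (a : Fin n) (q : Fin 4 × Fin n) :
    ((J4 F n)ᵀ * Y) (i.succ, a) q = Y (i.castSucc, a) q := by
  fin_cases i <;>
    simp [J4, Matrix.mul_apply, Fintype.sum_prod_type, Fin.sum_univ_four]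

theorem mul_J4_apply_zero {n : ℕ} (Z : Matrix (Fin 4 × Fin n) (Fin 4 × Fin n) F)
    (p : Fin 4 × Fin n) (b : Fin n) : (Z * J4 F n) p (0, b) = 0 := by
  simp [J4, Matrix.mul_apply]

theorem mul_J4_apply_succ {n : ℕ} (Z : Matrix (Fin 4 × Fin n) (Fin 4 × Fin n) F) (j : Fin 3)
    (p : Fin 4 × Fin n) (b : Fin n) : (Z * J4 F n) p (j.succ, b) = Z p (j.castSucc, b) := by
  fin_cases j <;>
    simp [J4, Matrix.mul_apply, Fintype.sum_prod_type, Fin.sum_univ_four]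

theorem blkDiag4_mul_apply {n : ℕ} (M : Fin 4 → Matrix (Fin n) (Fin n) F)
    (Z : Matrix (Fin 4 × Fin n) (Fin 4 × Fin n) F) (i j : Fin 4) (a b : Fin n) :
    (blkDiag4 M * Z) (i, a) (j, b) = (M i * Z.submatrix (Prod.mk i) (Prod.mk j)) a b := by
  simp [blkDiag4, Matrix.mul_apply, Fintype.sum_prod_type]

theorem mul_blkDiag4_apply {n : ℕ} (M : Fin 4 → Matrix (Fin n) (Fin n) F)
    (Z : Matrix (Fin 4 × Fin n) (Fin 4 × Fin n) F) (i j : Fin 4) (a b : Fin n) :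
    (Z * blkDiag4 M) (i, a) (j, b) = (Z.submatrix (Prod.mk i) (Prod.mk j) * M j) a b := by
  simp [blkDiag4, Matrix.mul_apply, Fintype.sum_prod_type]

/-- A matrix intertwining `c J₄ᵀ` with `J₄` and `d D*` with `D` has zero first block column. -/
theorem first_col_eq_zero {n : ℕ} {c d : F} (hc : c ≠ 0)
    {A B C D : Matrix (Fin n) (Fin n) F} {Y : Matrix (Fin 4 × Fin n) (Fin 4 × Fin n) F}
    (hJ : c • ((J4 F n)ᵀ * Y) = Y * J4 F n) (hD : d • (Dmat A B * Y) = Y * Dmat C D)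
    (p : Fin 4 × Fin n) (b : Fin n) : Y p (0, b) = 0 := by
  obtain ⟨i, a⟩ := p
  induction i using Fin.lastCases with
  | last =>
    have h := congrFun₂ hD (3, a) (0, b)
    rw [Matrix.smul_apply, Dmat, Dmat, blkDiag4_mul_apply, mul_blkDiag4_apply] at h
    simpa using h.symm
  | cast i =>
    have h := congrFun₂ hJ (i.succ, a) (0, b)
    rw [Matrix.smul_apply, J4_transpose_mul_apply, mul_J4_apply_zero] at h
    simpa [hc] using h

/-- A matrix commuting with `J₄` has zero first block column below the diagonal. -/
theorem first_col_succ_eq_zero {n : ℕ} {Z : Matrix (Fin 4 × Fin n) (Fin 4 × Fin n) F}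
    (hJ : J4 F n * Z = Z * J4 F n) (i : Fin 3) (a b : Fin n) : Z (i.succ, a) (0, b) = 0 := by
  rw [← J4_mul_apply Z i, hJ, mul_J4_apply_zero]

/-- A matrix commuting with `J₄` has constant block diagonal. -/
theorem diag_block_eq {n : ℕ} {Z : Matrix (Fin 4 × Fin n) (Fin 4 × Fin n) F}
    (hJ : J4 F n * Z = Z * J4 F n) (i : Fin 4) :
    Z.submatrix (Prod.mk i) (Prod.mk i) = Z.submatrix (Prod.mk 0) (Prod.mk 0) := by
  induction i using Fin.induction with
  | zero => rfl
  | succ i ih =>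
    rw [← ih]
    ext a b
    have h := congrFun₂ hJ (i.castSucc, a) (i.succ, b)
    rwa [J4_mul_apply, mul_J4_apply_succ] at h

theorem diag_block_intertwines {n : ℕ} {M N : Fin 4 → Matrix (Fin n) (Fin n) F}
    {Z : Matrix (Fin 4 × Fin n) (Fin 4 × Fin n) F} (hJ : J4 F n * Z = Z * J4 F n)
    (hM : blkDiag4 M * Z = Z * blkDiag4 N) (i : Fin 4) :
    M i * Z.submatrix (Prod.mk 0) (Prod.mk 0) = Z.submatrix (Prod.mk 0) (Prod.mk 0) * N i := by
  rw [← diag_block_eq hJ i]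
  ext a b
  rw [← blkDiag4_mul_apply, ← mul_blkDiag4_apply, hM]

/-- Theorem 2.1(a): for an algebraically closed field of characteristic ≠ 2 with an
involution, nonzero ε₁, ε₂ and any ε₃, pairs (A,B) and (C,D) of n×n matrices are similar
iff T_ε(A,B) and T_ε(C,D) are *congruent. -/
theorem stmt0 [IsAlgClosed F] (hchar : ringChar F ≠ 2)
    (σ : F →+* F) (hσ : Function.Involutive σ)
    (ε₁ ε₂ ε₃ : F) (hε₁ : ε₁ ≠ 0) (hε₂ : ε₂ ≠ 0)
    (n : ℕ) (A B C D : Matrix (Fin n) (Fin n) F) :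
    (∃ S : (Matrix (Fin n) (Fin n) F)ˣ,
        (↑S⁻¹ : Matrix (Fin n) (Fin n) F) * A * (↑S : Matrix (Fin n) (Fin n) F) = C ∧
        (↑S⁻¹ : Matrix (Fin n) (Fin n) F) * B * (↑S : Matrix (Fin n) (Fin n) F) = D) ↔
    (∃ S : (Matrix ((Fin 4 × Fin n) ⊕ (Fin 4 × Fin n)) ((Fin 4 × Fin n) ⊕ (Fin 4 × Fin n)) F)ˣ,
        ∀ i, starMat σ (↑S : Matrix _ _ F) * Ttriple σ ε₁ ε₂ ε₃ A B i *
              (↑S : Matrix _ _ F) = Ttriple σ ε₁ ε₂ ε₃ C D i) := by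
  constructor
  · rintro ⟨S, rfl, rfl⟩
    have h₁ : (↑S⁻¹ : Matrix (Fin n) (Fin n) F) * (S : Matrix (Fin n) (Fin n) F) = 1 :=
      S.inv_mul
    let R' := blkDiag4 fun _ : Fin 4 => (↑S⁻¹ : Matrix (Fin n) (Fin n) F)
    let S' := blkDiag4 fun _ : Fin 4 => (S : Matrix (Fin n) (Fin n) F)
    have hRS : R' * S' = 1 := by simp only [R', S', blkDiag4_mul, h₁, blkDiag4_one]
    have hSR : S' * R' = 1 := mul_eq_one_comm.mp hRS
    have hunit : fromBlocks (starMat σ R') 0 0 S' * fromBlocks (starMat σ S') 0 0 R' = 1 := by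
      simp [fromBlocks_multiply, ← starMat_mul, hSR, starMat_one]
    refine ⟨⟨fromBlocks (starMat σ R') 0 0 S', fromBlocks (starMat σ S') 0 0 R', hunit,
      mul_eq_one_comm.mp hunit⟩, fun i => ?_⟩
    rw [Ttriple_eq, Ttriple_eq]
    fin_cases i
    · exact starMat_congr_fromBlocks hσ ε₁ (by rw [Matrix.mul_one, hRS])
    · exact starMat_congr_fromBlocks hσ ε₂ (blkDiag4_mul_J4_mul h₁)
    · exact starMat_congr_fromBlocks hσ ε₃ (blkDiag4_mul_Dmat_mul h₁ A B)
  · rintro ⟨S, hS⟩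
    obtain ⟨P, Y, Q, Z, hblocks⟩ : ∃ P Y Q Z : Matrix (Fin 4 × Fin n) (Fin 4 × Fin n) F,
        (S : Matrix _ _ F) = fromBlocks P Y Q Z :=
      ⟨_, _, _, _, (fromBlocks_toBlocks _).symm⟩
    obtain ⟨W, hW⟩ : ∃ W, W * fromBlocks P Y Q Z = 1 := ⟨_, hblocks ▸ S.inv_mul⟩
    rw [hblocks] at hS
    obtain ⟨hYJ, hZJ⟩ := right_blocks_intertwine hε₁ (hS 0) (hS 1)
    obtain ⟨hYD, hZD⟩ := right_blocks_intertwine hε₁ (hS 0) (hS 2)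
    rw [Matrix.smul_mul, smul_smul] at hYJ hYD
    have hY := first_col_eq_zero (mul_ne_zero (inv_ne_zero hε₁) hε₂) hYJ hYD
    let T := Z.submatrix (Prod.mk (0 : Fin 4)) (Prod.mk (0 : Fin 4))
    let V := W.submatrix (fun a => Sum.inr ((0 : Fin 4), a)) (fun a => Sum.inr ((0 : Fin 4), a))
    have hVT : V * T = 1 := by
      ext a b
      have h := congrFun₂ hW (Sum.inr (0, a)) (Sum.inr (0, b))
      rw [Matrix.mul_apply, Fintype.sum_sum_type] at h
      simp only [fromBlocks_apply₁₂, fromBlocks_apply₂₂, hY, mul_zero, Finset.sum_const_zero,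
        zero_add, Fintype.sum_prod_type, Fin.sum_univ_succ (n := 3),
        first_col_succ_eq_zero hZJ, add_zero] at h
      simpa [Matrix.mul_apply, Matrix.one_apply, V, T] using h
    refine ⟨⟨T, V, mul_eq_one_comm.mp hVT, hVT⟩, ?_, ?_⟩
    · change V * A * T = C
      have h : A * T = T * C := diag_block_intertwines hZJ hZD 1
      rw [Matrix.mul_assoc, h, ← Matrix.mul_assoc, hVT, Matrix.one_mul]
    · change V * B * T = D
      have h : B * T = T * D := diag_block_intertwines hZJ hZD 2
      rw [Matrix.mul_assoc, h, ← Matrix.mul_assoc, hVT, Matrix.one_mul]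
end

section
/- Each tuple of m×n matrices over a field F is equivalent to a direct sum of tuples that are indecomposable with respect to equivalence, and this direct sum is determined uniquely up to permutation of the summands and replacement of each summand by an equivalent tuple. -/
open Matrix

variable {F : Type} [Field F]

/-- Tuples of matrices (of possibly different index types) are equivalent when
`R · T1 k · S = T2 k` for all `k`, for some invertible `R`, `S`. -/
def TupEquiv {t : ℕ} {I J I' J' : Type}
    [Fintype I] [Fintype J] [Fintype I'] [Fintype J']
    [DecidableEq I] [DecidableEq J] [DecidableEq I'] [DecidableEq J']
    (T1 : Fin t → Matrix I J F) (T2 : Fin t → Matrix I' J' F) : Prop :=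
  ∃ (R : Matrix I' I F) (R' : Matrix I I' F) (S : Matrix J J' F) (S' : Matrix J' J F),
    R * R' = 1 ∧ R' * R = 1 ∧ S * S' = 1 ∧ S' * S = 1 ∧ ∀ k, R * T1 k * S = T2 k

/-- A tuple is indecomposable with respect to equivalence if it has positive size and is not
equivalent to a direct sum of two tuples of positive sizes. -/
def Indecomp {t : ℕ} {I J : Type} [Fintype I] [Fintype J] [DecidableEq I] [DecidableEq J]
    (T : Fin t → Matrix I J F) : Prop :=
  0 < Fintype.card I + Fintype.card J ∧
  ¬ ∃ (p q p' q' : ℕ) (T1 : Fin t → Matrix (Fin p) (Fin q) F)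
      (T2 : Fin t → Matrix (Fin p') (Fin q') F),
      0 < p + q ∧ 0 < p' + q' ∧
      TupEquiv T (fun k => Matrix.fromBlocks (T1 k) 0 0 (T2 k))

open CategoryTheory Polynomial

/-- An element of a finite-dimensional algebra without nontrivial idempotents is a unit or
nilpotent. -/
theorem isUnit_or_isNilpotent_of_idempotent_trivial {K A : Type*} [Field K] [Ring A] [Algebra K A]
    [FiniteDimensional K A] (hA : ∀ e : A, e * e = e → e = 0 ∨ e = 1) (a : A) :
    IsUnit a ∨ IsNilpotent a := by
  have hint : IsIntegral K a := Algebra.IsIntegral.isIntegral a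
  obtain ⟨q, hq, hdvd⟩ :=
    (minpoly K a).exists_eq_pow_rootMultiplicity_mul_and_not_dvd (minpoly.ne_zero hint) 0
  rw [C_0, sub_zero] at hq hdvd
  set n := (minpoly K a).rootMultiplicity 0
  have hco : IsCoprime (X ^ (n + 1)) q :=
    ((Polynomial.irreducible_X).coprime_iff_not_dvd.2 hdvd).pow_left
  have hzero : aeval a (X ^ (n + 1) * q) = 0 := by
    rw [pow_succ', mul_assoc, ← hq, map_mul, minpoly.aeval, mul_zero]
  obtain ⟨u, v, huv⟩ := hco
  have hidem : aeval a (u * X ^ (n + 1)) * aeval a (u * X ^ (n + 1)) =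
      aeval a (u * X ^ (n + 1)) := by
    have h : u * X ^ (n + 1) * (u * X ^ (n + 1)) =
        u * X ^ (n + 1) - u * v * (X ^ (n + 1) * q) := by
      linear_combination (u * X ^ (n + 1)) * huv
    rw [← map_mul, h, map_sub, map_mul (aeval a) (u * v), hzero, mul_zero, sub_zero]
  rcases hA _ hidem with h | h
  · right
    refine ⟨n + 1, ?_⟩
    have h' : (X ^ (n + 1) : K[X]) = X ^ (n + 1) * (u * X ^ (n + 1)) +
        v * (X ^ (n + 1) * q) := by
      linear_combination (-X ^ (n + 1)) * huv
    have := congrArg (aeval a) h'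
    rw [map_add, map_mul (aeval a) v, hzero, map_mul, h] at this
    simpa using this
  · left
    have h1 : aeval a (u * X ^ n) * a = 1 := by
      rw [pow_succ, ← mul_assoc, map_mul, aeval_X] at h
      exact h
    have h2 : a * aeval a (u * X ^ n) = 1 := by
      rw [pow_succ, ← mul_assoc, mul_comm, map_mul, aeval_X] at h
      exact h
    exact ⟨⟨a, _, h2, h1⟩, rfl⟩

section KrullSchmidt

variable {C : Type*} [Category C] [Preadditive C]

/-- The object `M` is a biproduct of the family `Y`. -/
def IsBiproductOf {κ : Type*} [Fintype κ] (M : C) (Y : κ → C) : Prop :=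
  ∃ (i : ∀ j, Y j ⟶ M) (p : ∀ j, M ⟶ Y j), (∀ j, i j ≫ p j = 𝟙 (Y j)) ∧
    (∀ j k, j ≠ k → i j ≫ p k = 0) ∧ ∑ j, p j ≫ i j = 𝟙 M

/-- A nonzero object whose only idempotent endomorphisms are zero and the identity. -/
def IdempotentTrivial (X : C) : Prop :=
  𝟙 X ≠ 0 ∧ ∀ e : X ⟶ X, e ≫ e = e → e = 0 ∨ e = 𝟙 X

theorem IsBiproductOf.reindex {κ κ' : Type*} [Fintype κ] [Fintype κ'] {M : C} {Y : κ → C}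
    (h : IsBiproductOf M Y) (e : κ' ≃ κ) : IsBiproductOf M (Y ∘ e) := by
  obtain ⟨i, p, h1, h2, h3⟩ := h
  refine ⟨fun j => i (e j), fun j => p (e j), fun j => h1 _,
    fun j k hjk => h2 _ _ (e.injective.ne hjk), ?_⟩
  rw [← h3]
  exact e.sum_comp fun j => p j ≫ i j

theorem IsBiproductOf.trans_sum {κ₁ κ₂ : Type*} [Fintype κ₁] [Fintype κ₂] {M X₁ X₂ : C}
    {Y : κ₁ → C} {Z : κ₂ → C} {i₁ : X₁ ⟶ M} {i₂ : X₂ ⟶ M} {p₁ : M ⟶ X₁} {p₂ : M ⟶ X₂}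
    (h₁₁ : i₁ ≫ p₁ = 𝟙 X₁) (h₂₂ : i₂ ≫ p₂ = 𝟙 X₂) (h₁₂ : i₁ ≫ p₂ = 0) (h₂₁ : i₂ ≫ p₁ = 0)
    (htot : p₁ ≫ i₁ + p₂ ≫ i₂ = 𝟙 M) (hY : IsBiproductOf X₁ Y) (hZ : IsBiproductOf X₂ Z) :
    IsBiproductOf M (Sum.elim Y Z) := by
  obtain ⟨i, p, hi, hne, hs⟩ := hY
  obtain ⟨i', p', hi', hne', hs'⟩ := hZ
  refine ⟨fun | .inl a => i a ≫ i₁ | .inr b => i' b ≫ i₂,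
    fun | .inl a => p₁ ≫ p a | .inr b => p₂ ≫ p' b, ?_, ?_, ?_⟩
  · rintro (a | b)
    · simp [reassoc_of% h₁₁, hi]
    · simp [reassoc_of% h₂₂, hi']
  · rintro (a | a) (b | b) hab
    · change (i a ≫ i₁) ≫ p₁ ≫ p b = 0
      rw [Category.assoc, reassoc_of% h₁₁]
      exact hne a b (fun h => hab (by rw [h]))
    · change (i a ≫ i₁) ≫ p₂ ≫ p' b = 0
      rw [Category.assoc, reassoc_of% h₁₂, Limits.zero_comp, Limits.comp_zero]
    · change (i' a ≫ i₂) ≫ p₁ ≫ p b = 0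
      rw [Category.assoc, reassoc_of% h₂₁, Limits.zero_comp, Limits.comp_zero]
    · change (i' a ≫ i₂) ≫ p₂ ≫ p' b = 0
      rw [Category.assoc, reassoc_of% h₂₂]
      exact hne' a b (fun h => hab (by rw [h]))
  · rw [Fintype.sum_sum_type]
    change ∑ a, (p₁ ≫ p a) ≫ i a ≫ i₁ + ∑ b, (p₂ ≫ p' b) ≫ i' b ≫ i₂ = 𝟙 M
    have e₁ := congrArg (fun f => p₁ ≫ f ≫ i₁) hs
    have e₂ := congrArg (fun f => p₂ ≫ f ≫ i₂) hs'
    simp only [Preadditive.sum_comp, Preadditive.comp_sum, Category.assoc,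
      Category.id_comp] at e₁ e₂
    simp only [Category.assoc, e₁, e₂, htot]

theorem IdempotentTrivial.isIso_or_isIso (K : Type*) [Field K] [Linear K C]
    [∀ X Y : C, FiniteDimensional K (X ⟶ Y)]
    {X : C} (hX : IdempotentTrivial X) {f g : X ⟶ X}
    (h : IsIso (f + g)) : IsIso f ∨ IsIso g := by
  have key (a : X ⟶ X) : IsIso a ∨ IsNilpotent (R := End X) a := by
    have : FiniteDimensional K (End X) := inferInstanceAs (FiniteDimensional K (X ⟶ X))
    rcases isUnit_or_isNilpotent_of_idempotent_trivial (K := K) (A := End X)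
      (fun e he => hX.2 e he) a with h | h
    · exact Or.inl ((isUnit_iff_isIso _).1 h)
    · exact Or.inr h
  have hsum : f ≫ inv (f + g) + g ≫ inv (f + g) = 𝟙 X := by
    rw [← Preadditive.add_comp, IsIso.hom_inv_id]
  rcases key (f ≫ inv (f + g)) with h1 | h1
  · left
    have : IsIso ((f ≫ inv (f + g)) ≫ (f + g)) := inferInstance
    rwa [Category.assoc, IsIso.inv_hom_id, Category.comp_id] at this
  · right
    have h2 : IsUnit (M := End X) (g ≫ inv (f + g)) := by
      rw [← eq_sub_iff_add_eq'] at hsum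
      rw [hsum]
      exact IsNilpotent.isUnit_one_sub (R := End X) h1
    have h3 := (isUnit_iff_isIso _).1 h2
    have : IsIso ((g ≫ inv (f + g)) ≫ (f + g)) := inferInstance
    rwa [Category.assoc, IsIso.inv_hom_id, Category.comp_id] at this

variable {K : Type*} [Field K] [Linear K C] [∀ X Y : C, FiniteDimensional K (X ⟶ Y)]

variable (K) in
/-- The radical of `X ⟶ M`, for an object `X` with local endomorphism ring. -/
def homRadical {X : C} (hX : IdempotentTrivial X) (M : C) : Submodule K (X ⟶ M) where
  carrier := {f | ∀ g : M ⟶ X, ¬ IsIso (f ≫ g)}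
  add_mem' := by
    intro f f' hf hf' g hg
    rw [Preadditive.add_comp] at hg
    rcases hX.isIso_or_isIso K hg with h | h
    exacts [hf g h, hf' g h]
  zero_mem' := by
    intro g hg
    rw [Limits.zero_comp] at hg
    apply hX.1
    rw [← IsIso.hom_inv_id (0 : X ⟶ X), Limits.zero_comp]
  smul_mem' := by
    intro c f hf g hg
    refine hf (c • g) ?_
    rwa [Linear.comp_smul, ← Linear.smul_comp]

variable {X : C} (hX : IdempotentTrivial X)

theorem homRadical_comp {M N : C} {f : X ⟶ M} (hf : f ∈ homRadical K hX M) (g : M ⟶ N) :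
    f ≫ g ∈ homRadical K hX N := by
  intro h
  rw [Category.assoc]
  exact hf _

variable (K) in
/-- The multiplicity of `X` in `M`, as the dimension of `X ⟶ M` modulo its radical. -/
noncomputable def homMultiplicity (M : C) : ℕ :=
  Module.finrank K ((X ⟶ M) ⧸ homRadical K hX M)

theorem homMultiplicity_eq_sum {κ : Type*} [Fintype κ] {M : C} {Y : κ → C}
    (h : IsBiproductOf M Y) :
    homMultiplicity K hX M = ∑ j, homMultiplicity K hX (Y j) := by
  classical
  obtain ⟨i, p, h1, h2, h3⟩ := h
  let φ : (X ⟶ M) →ₗ[K] ∀ j, (X ⟶ Y j) ⧸ homRadical K hX (Y j) :=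
    LinearMap.pi fun j => (homRadical K hX (Y j)).mkQ ∘ₗ Linear.rightComp K X (p j)
  have hφ (f : X ⟶ M) (j : κ) : φ f j = (homRadical K hX (Y j)).mkQ (f ≫ p j) := rfl
  have hker : LinearMap.ker φ = homRadical K hX M := by
    ext f
    rw [LinearMap.mem_ker, funext_iff]
    simp only [hφ, Pi.zero_apply, Submodule.mkQ_apply, Submodule.Quotient.mk_eq_zero]
    refine ⟨fun hf => ?_, fun hf j => homRadical_comp hX hf _⟩
    have : f = ∑ j, (f ≫ p j) ≫ i j := by
      simp only [Category.assoc, ← Preadditive.comp_sum, h3, Category.comp_id]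
    rw [this]
    exact Submodule.sum_mem _ fun j _ => homRadical_comp hX (hf j) _
  have hsurj : Function.Surjective φ := by
    intro w
    choose g hg using fun j => (homRadical K hX (Y j)).mkQ_surjective (w j)
    refine ⟨∑ j, g j ≫ i j, ?_⟩
    ext j
    rw [hφ, Preadditive.sum_comp, Finset.sum_eq_single j, Category.assoc, h1, Category.comp_id,
      hg]
    · intro k _ hk
      rw [Category.assoc, h2 k j hk, Limits.comp_zero]
    · simp
  rw [homMultiplicity, ← hker, (φ.quotKerEquivOfSurjective hsurj).finrank_eq,
    Module.finrank_pi_fintype]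
  rfl

theorem homMultiplicity_congr {M N : C} (e : M ≅ N) :
    homMultiplicity K hX M = homMultiplicity K hX N := by
  have h : IsBiproductOf M (fun _ : Unit => N) :=
    ⟨fun _ => e.inv, fun _ => e.hom, by simp, by simp, by simp⟩
  simpa using homMultiplicity_eq_sum (K := K) hX h

theorem homMultiplicity_self_pos : 0 < homMultiplicity K hX X := by
  have : Nontrivial ((X ⟶ X) ⧸ homRadical K hX X) := by
    rw [Submodule.Quotient.nontrivial_iff]
    intro h
    have : 𝟙 X ∈ homRadical K hX X := h ▸ Submodule.mem_top
    exact this (𝟙 X) (by rw [Category.comp_id]; infer_instance)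
  exact Module.finrank_pos

theorem homMultiplicity_eq_zero {Y : C} (hY : IdempotentTrivial Y) (h : IsEmpty (Y ≅ X)) :
    homMultiplicity K hX Y = 0 := by
  have : homRadical K hX Y = ⊤ := by
    refine eq_top_iff.2 fun f _ g hfg => h.false ?_
    have h1 : f ≫ g ≫ inv (f ≫ g) = 𝟙 X := by
      rw [← Category.assoc, IsIso.hom_inv_id]
    have h2 : (g ≫ inv (f ≫ g)) ≫ f = 𝟙 Y := by
      refine (hY.2 ((g ≫ inv (f ≫ g)) ≫ f) ?_).resolve_left fun h0 => hX.1 ?_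
      · simp only [Category.assoc]
        rw [reassoc_of% h1]
      · calc 𝟙 X = (f ≫ g ≫ inv (f ≫ g)) ≫ (f ≫ g ≫ inv (f ≫ g)) := by rw [h1, Category.comp_id]
          _ = f ≫ ((g ≫ inv (f ≫ g)) ≫ f) ≫ g ≫ inv (f ≫ g) := by simp only [Category.assoc]
          _ = 0 := by rw [h0, Limits.zero_comp, Limits.comp_zero]
    exact ⟨g ≫ inv (f ≫ g), f, h2, h1⟩
  rw [homMultiplicity, this]
  exact Module.finrank_zero_of_subsingleton

open Classical in
theorem homMultiplicity_eq_card_mul {κ : Type*} [Fintype κ] {M : C} {Y : κ → C}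
    (h : IsBiproductOf M Y) (hY : ∀ j, IdempotentTrivial (Y j)) :
    homMultiplicity K hX M =
      Fintype.card {j // Nonempty (Y j ≅ X)} * homMultiplicity K hX X := by
  rw [homMultiplicity_eq_sum hX h, Fintype.card_subtype, ← smul_eq_mul, ← Finset.sum_const,
    Finset.sum_filter]
  refine Finset.sum_congr rfl fun j _ => ?_
  split_ifs with hj
  · exact homMultiplicity_congr hX hj.some
  · exact homMultiplicity_eq_zero hX (hY j) (not_nonempty_iff.1 hj)

/-- The Krull–Schmidt theorem: biproduct decompositions into objects without nontrivial
idempotents are unique. -/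
theorem IsBiproductOf.exists_equiv (K : Type*) [Field K] [Linear K C]
    [∀ X Y : C, FiniteDimensional K (X ⟶ Y)]
    {κ κ' : Type*} [Fintype κ] [Fintype κ'] {M : C} {Y : κ → C}
    {Z : κ' → C} (hMY : IsBiproductOf M Y) (hMZ : IsBiproductOf M Z)
    (hY : ∀ j, IdempotentTrivial (Y j)) (hZ : ∀ j, IdempotentTrivial (Z j)) :
    ∃ π : κ ≃ κ', ∀ j, Nonempty (Y j ≅ Z (π j)) := by
  classical
  have hcard (X : C) (hX : IdempotentTrivial X) :
      Fintype.card {j // Nonempty (Y j ≅ X)} = Fintype.card {j // Nonempty (Z j ≅ X)} :=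
    Nat.eq_of_mul_eq_mul_right (homMultiplicity_self_pos (K := K) hX)
      ((homMultiplicity_eq_card_mul hX hMY hY).symm.trans (homMultiplicity_eq_card_mul hX hMZ hZ))
  let cls : C → Quotient (isIsomorphicSetoid C) := Quotient.mk _
  have hcls {A B : C} : cls A = cls B ↔ Nonempty (A ≅ B) := Quotient.eq
  have hfib (q : Quotient (isIsomorphicSetoid C)) :
      Nonempty ({j // cls (Y j) = q} ≃ {j // cls (Z j) = q}) := by
    have aux (X : C) (hX : IdempotentTrivial X) (hq : cls X = q) :
        Nonempty ({j // cls (Y j) = q} ≃ {j // cls (Z j) = q}) := by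
      subst hq
      simp only [hcls]
      exact ⟨Fintype.equivOfCardEq (hcard X hX)⟩
    by_cases h1 : ∃ j, cls (Y j) = q
    · exact aux _ (hY h1.choose) h1.choose_spec
    by_cases h2 : ∃ j, cls (Z j) = q
    · exact aux _ (hZ h2.choose) h2.choose_spec
    push Not at h1 h2
    have := Subtype.isEmpty_of_false h1
    have := Subtype.isEmpty_of_false h2
    exact ⟨Equiv.equivOfIsEmpty _ _⟩
  let π : κ ≃ κ' := Equiv.ofFiberEquiv (f := fun j => cls (Y j)) (g := fun j => cls (Z j))
    fun q => (hfib q).some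
  refine ⟨π, fun j => hcls.1 ?_⟩
  exact (Equiv.ofFiberEquiv_map (f := fun j => cls (Y j)) (g := fun j => cls (Z j))
    (fun q => (hfib q).some) j).symm

end KrullSchmidt

/-- Objects of the category of `t`-tuples of matrices of the same size over `F`. -/
structure MatrixTuple (F : Type) (t : ℕ) where
  /-- The number of rows. -/
  rows : ℕ
  /-- The number of columns. -/
  cols : ℕ
  /-- The matrices. -/
  mat : Fin t → Matrix (Fin rows) (Fin cols) F

namespace MatrixTuple

variable {t : ℕ}

/-- Morphisms of matrix tuples: pairs of matrices intertwining the two tuples. -/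
def homs (X Y : MatrixTuple F t) :
    Submodule F (Matrix (Fin Y.rows) (Fin X.rows) F × Matrix (Fin Y.cols) (Fin X.cols) F) where
  carrier := {f | ∀ k, f.1 * X.mat k = Y.mat k * f.2}
  add_mem' {f g} hf hg k := by
    simp only [Prod.fst_add, Prod.snd_add, Matrix.add_mul, Matrix.mul_add, hf k, hg k]
  zero_mem' k := by simp
  smul_mem' c f hf k := by
    simp only [Prod.smul_fst, Prod.smul_snd, Matrix.smul_mul, Matrix.mul_smul, hf k]

instance : Category (MatrixTuple F t) where
  Hom X Y := homs X Y
  id X := ⟨(1, 1), fun k => by simp⟩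
  comp f g := ⟨(g.1.1 * f.1.1, g.1.2 * f.1.2), fun k => by
    simp only [Matrix.mul_assoc, f.2 k]
    rw [← Matrix.mul_assoc, g.2 k, Matrix.mul_assoc]⟩
  id_comp f := Subtype.ext (by simp)
  comp_id f := Subtype.ext (by simp)
  assoc f g h := Subtype.ext (by simp [Matrix.mul_assoc])

instance : Preadditive (MatrixTuple F t) where
  homGroup X Y := inferInstanceAs (AddCommGroup (homs X Y))
  add_comp _ _ _ _ _ _ := Subtype.ext (Prod.ext (Matrix.mul_add _ _ _) (Matrix.mul_add _ _ _))
  comp_add _ _ _ _ _ _ := Subtype.ext (Prod.ext (Matrix.add_mul _ _ _) (Matrix.add_mul _ _ _))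

instance : Linear F (MatrixTuple F t) where
  homModule X Y := inferInstanceAs (Module F (homs X Y))
  smul_comp _ _ _ _ _ _ :=
    Subtype.ext (Prod.ext (Matrix.mul_smul _ _ _) (Matrix.mul_smul _ _ _))
  comp_smul _ _ _ _ _ _ :=
    Subtype.ext (Prod.ext (Matrix.smul_mul _ _ _) (Matrix.smul_mul _ _ _))

instance (X Y : MatrixTuple F t) : FiniteDimensional F (X ⟶ Y) :=
  inferInstanceAs (FiniteDimensional F (homs X Y))

variable {X Y Z : MatrixTuple F t}

/-- The matrix of a morphism on rows. -/
def rowMap (f : X ⟶ Y) : Matrix (Fin Y.rows) (Fin X.rows) F := f.1.1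

/-- The matrix of a morphism on columns. -/
def colMap (f : X ⟶ Y) : Matrix (Fin Y.cols) (Fin X.cols) F := f.1.2

/-- The morphism given by a pair of intertwining matrices. -/
def homMk (P : Matrix (Fin Y.rows) (Fin X.rows) F) (Q : Matrix (Fin Y.cols) (Fin X.cols) F)
    (h : ∀ k, P * X.mat k = Y.mat k * Q) : X ⟶ Y := ⟨(P, Q), h⟩

theorem rowMap_mul_mat (f : X ⟶ Y) (k : Fin t) : rowMap f * X.mat k = Y.mat k * colMap f :=
  f.2 k

theorem hom_ext_iff {f g : X ⟶ Y} : f = g ↔ rowMap f = rowMap g ∧ colMap f = colMap g :=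
  Subtype.ext_iff.trans Prod.ext_iff

@[simp] theorem rowMap_homMk (P : Matrix (Fin Y.rows) (Fin X.rows) F)
    (Q : Matrix (Fin Y.cols) (Fin X.cols) F) (h) : rowMap (homMk P Q h) = P := rfl

@[simp] theorem colMap_homMk (P : Matrix (Fin Y.rows) (Fin X.rows) F)
    (Q : Matrix (Fin Y.cols) (Fin X.cols) F) (h) : colMap (homMk P Q h) = Q := rfl

@[simp] theorem rowMap_id : rowMap (𝟙 X) = 1 := rfl

@[simp] theorem colMap_id : colMap (𝟙 X) = 1 := rfl

@[simp] theorem rowMap_comp (f : X ⟶ Y) (g : Y ⟶ Z) :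
    rowMap (f ≫ g) = rowMap g * rowMap f := rfl

@[simp] theorem colMap_comp (f : X ⟶ Y) (g : Y ⟶ Z) :
    colMap (f ≫ g) = colMap g * colMap f := rfl

@[simp] theorem rowMap_zero : rowMap (0 : X ⟶ Y) = 0 := rfl

@[simp] theorem colMap_zero : colMap (0 : X ⟶ Y) = 0 := rfl

@[simp] theorem rowMap_add (f g : X ⟶ Y) : rowMap (f + g) = rowMap f + rowMap g := rfl

@[simp] theorem colMap_add (f g : X ⟶ Y) : colMap (f + g) = colMap f + colMap g := rfl

@[simp] theorem rowMap_sum {κ : Type*} (s : Finset κ) (f : κ → (X ⟶ Y)) :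
    rowMap (∑ j ∈ s, f j) = ∑ j ∈ s, rowMap (f j) :=
  map_sum (AddMonoidHom.mk' rowMap rowMap_add) f s

@[simp] theorem colMap_sum {κ : Type*} (s : Finset κ) (f : κ → (X ⟶ Y)) :
    colMap (∑ j ∈ s, f j) = ∑ j ∈ s, colMap (f j) :=
  map_sum (AddMonoidHom.mk' colMap colMap_add) f s

theorem tupEquiv_of_iso (e : X ≅ Y) : TupEquiv X.mat Y.mat := by
  have h₁ := hom_ext_iff.1 e.hom_inv_id
  have h₂ := hom_ext_iff.1 e.inv_hom_id
  simp only [rowMap_comp, colMap_comp, rowMap_id, colMap_id] at h₁ h₂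
  refine ⟨rowMap e.hom, rowMap e.inv, colMap e.inv, colMap e.hom, h₂.1, h₁.1, h₁.2, h₂.2,
    fun k => ?_⟩
  rw [rowMap_mul_mat, Matrix.mul_assoc, h₂.2, Matrix.mul_one]

theorem isBiproductOf_of_tupEquiv {κ : Type} [Fintype κ] [DecidableEq κ]
    {Y : κ → MatrixTuple F t}
    (h : TupEquiv X.mat (fun i => Matrix.blockDiagonal' (fun j => (Y j).mat i))) :
    IsBiproductOf X Y := by
  obtain ⟨R, R', S, S', hRR', hR'R, hSS', hS'S, hT⟩ := h
  beta_reduce at hT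
  have hi (j : κ) (k : Fin t) : R'.submatrix id (Sigma.mk j) * (Y j).mat k =
      X.mat k * S.submatrix id (Sigma.mk j) := by
    have h1 : R' * Matrix.blockDiagonal' (fun j => (Y j).mat k) = X.mat k * S := by
      rw [← hT k, ← Matrix.mul_assoc, ← Matrix.mul_assoc, hR'R, Matrix.one_mul]
    ext a b
    have h2 := congrFun (congrFun h1 a) ⟨j, b⟩
    rw [Matrix.mul_apply, Fintype.sum_sigma, Finset.sum_eq_single j] at h2
    · simpa [Matrix.mul_apply, Matrix.blockDiagonal'_apply_eq] using h2
    · intro l _ hl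
      simp [Matrix.blockDiagonal'_apply_ne _ _ _ hl]
    · simp
  have hp (j : κ) (k : Fin t) : R.submatrix (Sigma.mk j) id * X.mat k =
      (Y j).mat k * S'.submatrix (Sigma.mk j) id := by
    have h1 : R * X.mat k = Matrix.blockDiagonal' (fun j => (Y j).mat k) * S' := by
      rw [← hT k, Matrix.mul_assoc, hSS', Matrix.mul_one]
    ext a b
    have h2 := congrFun (congrFun h1 ⟨j, a⟩) b
    rw [Matrix.mul_apply (M := Matrix.blockDiagonal' _), Fintype.sum_sigma,
      Finset.sum_eq_single j] at h2
    · simpa [Matrix.mul_apply, Matrix.blockDiagonal'_apply_eq] using h2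
    · intro l _ hl
      simp [Matrix.blockDiagonal'_apply_ne _ _ _ hl.symm]
    · simp
  refine ⟨fun j => homMk _ _ (hi j), fun j => homMk _ _ (hp j), fun j => ?_, fun j l hjl => ?_, ?_⟩
  · rw [hom_ext_iff]
    constructor
    · ext a b
      have := congrFun (congrFun hRR' ⟨j, a⟩) ⟨j, b⟩
      simpa [Matrix.mul_apply, Matrix.one_apply] using this
    · ext a b
      have := congrFun (congrFun hS'S ⟨j, a⟩) ⟨j, b⟩
      simpa [Matrix.mul_apply, Matrix.one_apply] using this
  · rw [hom_ext_iff]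
    constructor
    · ext a b
      have := congrFun (congrFun hRR' ⟨l, a⟩) ⟨j, b⟩
      simpa [Matrix.mul_apply, Matrix.one_apply, hjl.symm] using this
    · ext a b
      have := congrFun (congrFun hS'S ⟨l, a⟩) ⟨j, b⟩
      simpa [Matrix.mul_apply, Matrix.one_apply, hjl.symm] using this
  · rw [hom_ext_iff]
    constructor
    · rw [rowMap_id, ← hR'R]
      ext a b
      simp [Matrix.sum_apply, Matrix.mul_apply, Fintype.sum_sigma]
    · rw [colMap_id, ← hSS']
      ext a b
      simp [Matrix.sum_apply, Matrix.mul_apply, Fintype.sum_sigma]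

theorem tupEquiv_of_isBiproductOf {κ : Type} [Fintype κ] [DecidableEq κ]
    {Y : κ → MatrixTuple F t} (h : IsBiproductOf X Y) :
    TupEquiv X.mat (fun i => Matrix.blockDiagonal' (fun j => (Y j).mat i)) := by
  obtain ⟨i, p, h1, h2, h3⟩ := h
  let R : Matrix (Σ j, Fin (Y j).rows) (Fin X.rows) F := Matrix.of fun s a => rowMap (p s.1) s.2 a
  let R' : Matrix (Fin X.rows) (Σ j, Fin (Y j).rows) F := Matrix.of fun a s => rowMap (i s.1) a s.2
  let S : Matrix (Fin X.cols) (Σ j, Fin (Y j).cols) F := Matrix.of fun a s => colMap (i s.1) a s.2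
  let S' : Matrix (Σ j, Fin (Y j).cols) (Fin X.cols) F := Matrix.of fun s a => colMap (p s.1) s.2 a
  have hip (j l : κ) : (rowMap (p l) * rowMap (i j) = if h : j = l then h ▸ 1 else 0) ∧
      (colMap (p l) * colMap (i j) = if h : j = l then h ▸ 1 else 0) := by
    split_ifs with h
    · subst h
      exact hom_ext_iff.1 (h1 j)
    · exact hom_ext_iff.1 (h2 j l h)
  have hRR' : R * R' = 1 := by
    ext ⟨l, a⟩ ⟨j, b⟩
    have := congrFun (congrFun (hip j l).1 a) b
    by_cases hjl : j = l
    · subst hjl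
      simpa [R, R', Matrix.mul_apply, Matrix.one_apply] using this
    · simpa [R, R', Matrix.mul_apply, Matrix.one_apply, hjl, Ne.symm hjl] using this
  have hS'S : S' * S = 1 := by
    ext ⟨l, a⟩ ⟨j, b⟩
    have := congrFun (congrFun (hip j l).2 a) b
    by_cases hjl : j = l
    · subst hjl
      simpa [S, S', Matrix.mul_apply, Matrix.one_apply] using this
    · simpa [S, S', Matrix.mul_apply, Matrix.one_apply, hjl, Ne.symm hjl] using this
  have htot := hom_ext_iff.1 h3
  simp only [rowMap_sum, colMap_sum, rowMap_comp, colMap_comp, rowMap_id, colMap_id] at htot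
  refine ⟨R, R', S, S', hRR', ?_, ?_, hS'S, fun k => ?_⟩
  · rw [← htot.1]
    ext a b
    simp [R, R', Matrix.sum_apply, Matrix.mul_apply, Fintype.sum_sigma]
  · rw [← htot.2]
    ext a b
    simp [S, S', Matrix.sum_apply, Matrix.mul_apply, Fintype.sum_sigma]
  · have hR : R * X.mat k = Matrix.blockDiagonal' (fun j => (Y j).mat k) * S' := by
      ext ⟨j, a⟩ b
      have := congrFun (congrFun (rowMap_mul_mat (p j) k) a) b
      rw [Matrix.mul_apply (M := Matrix.blockDiagonal' _), Fintype.sum_sigma,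
        Finset.sum_eq_single j]
      · simpa [R, S', Matrix.mul_apply, Matrix.blockDiagonal'_apply_eq] using this
      · intro l _ hl
        simp [Matrix.blockDiagonal'_apply_ne _ _ _ hl.symm]
      · simp
    rw [hR, Matrix.mul_assoc, hS'S, Matrix.mul_one]

theorem exists_split_idempotent {n : ℕ} {P : Matrix (Fin n) (Fin n) F} (hP : P * P = P) :
    ∃ (p : ℕ) (A : Matrix (Fin n) (Fin p) F) (A' : Matrix (Fin p) (Fin n) F),
      A' * A = 1 ∧ A * A' = P := by
  let f := Matrix.toLin' P
  have hf (v) : f (f v) = f v := by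
    rw [← LinearMap.comp_apply, ← Matrix.toLin'_mul, hP]
  let b := Module.finBasis F (LinearMap.range f)
  let c := Pi.basisFun F (Fin n)
  refine ⟨_, LinearMap.toMatrix b c (LinearMap.range f).subtype,
    LinearMap.toMatrix c b f.rangeRestrict, ?_, ?_⟩
  · rw [← LinearMap.toMatrix_comp b c b, ← LinearMap.toMatrix_id b]
    congr 1
    ext ⟨_, v, rfl⟩ : 2
    exact hf v
  · rw [← LinearMap.toMatrix_comp c b c]
    exact LinearMap.toMatrix'_toLin' P

theorem one_eq_zero_iff_eq_zero {n : ℕ} : (1 : Matrix (Fin n) (Fin n) F) = 0 ↔ n = 0 := by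
  constructor
  · intro h
    by_contra hn
    have := congrFun (congrFun h ⟨0, Nat.pos_of_ne_zero hn⟩) ⟨0, Nat.pos_of_ne_zero hn⟩
    simp at this
  · rintro rfl
    exact Subsingleton.elim _ _

theorem idempotentTrivial_of_indecomp (h : Indecomp X.mat) : IdempotentTrivial X := by
  obtain ⟨hpos, hdec⟩ := h
  refine ⟨fun h0 => ?_, fun e he => ?_⟩
  · have h1 := hom_ext_iff.1 h0
    simp only [rowMap_id, colMap_id, rowMap_zero, colMap_zero, one_eq_zero_iff_eq_zero] at h1
    simp [h1.1, h1.2] at hpos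
  by_contra! hne
  apply hdec
  have hidem := hom_ext_iff.1 he
  have hmat := rowMap_mul_mat e
  rw [rowMap_comp, colMap_comp] at hidem
  simp only [ne_eq, hom_ext_iff, rowMap_id, colMap_id, rowMap_zero, colMap_zero] at hne
  set P := rowMap e
  set Q := colMap e
  have hcompl {n : ℕ} {E : Matrix (Fin n) (Fin n) F} (hE : E * E = E) :
      (1 - E) * (1 - E) = 1 - E := by
    rw [Matrix.mul_sub, Matrix.sub_mul, Matrix.sub_mul, hE]; simp
  obtain ⟨p, A, A', hA, hAP⟩ := exists_split_idempotent hidem.1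
  obtain ⟨q, C, C', hC, hCQ⟩ := exists_split_idempotent hidem.2
  obtain ⟨p', B, B', hB, hBP⟩ := exists_split_idempotent (hcompl hidem.1)
  obtain ⟨q', D, D', hD, hDQ⟩ := exists_split_idempotent (hcompl hidem.2)
  have hzero {n a b : ℕ} {E : Matrix (Fin n) (Fin n) F} {G : Matrix (Fin n) (Fin a) F}
      {G' : Matrix (Fin a) (Fin n) F} {H : Matrix (Fin n) (Fin b) F}
      {H' : Matrix (Fin b) (Fin n) F} (hE : E * E = E) (hG : G' * G = 1) (hH : H' * H = 1)
      (hGE : G * G' = E) (hHE : H * H' = 1 - E) :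
      G' * H = 0 ∧ H' * G = 0 ∧ G' * E = G' ∧ E * G = G ∧ E * H = 0 ∧ H' * E = 0 := by
    have h1 : G' * E = G' := by rw [← hGE, ← Matrix.mul_assoc, hG, Matrix.one_mul]
    have h2 : E * G = G := by rw [← hGE, Matrix.mul_assoc, hG, Matrix.mul_one]
    have h3 : E * H = 0 := by
      have : (1 - E) * H = H := by rw [← hHE, Matrix.mul_assoc, hH, Matrix.mul_one]
      rwa [Matrix.sub_mul, Matrix.one_mul, sub_eq_self] at this
    have h4 : H' * E = 0 := by
      have : H' * (1 - E) = H' := by rw [← hHE, ← Matrix.mul_assoc, hH, Matrix.one_mul]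
      rwa [Matrix.mul_sub, Matrix.mul_one, sub_eq_self] at this
    refine ⟨?_, ?_, h1, h2, h3, h4⟩
    · rw [← h1, Matrix.mul_assoc, h3, Matrix.mul_zero]
    · rw [← h2, ← Matrix.mul_assoc, h4, Matrix.zero_mul]
  obtain ⟨hAB, hBA, hAe, -, -, hBe⟩ := hzero hidem.1 hA hB hAP hBP
  obtain ⟨hCD, hDC, -, hCe, hDe, -⟩ := hzero hidem.2 hC hD hCQ hDQ
  refine ⟨p, q, p', q', fun k => A' * X.mat k * C, fun k => B' * X.mat k * D, ?_, ?_,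
    Matrix.fromRows A' B', Matrix.fromCols A B, Matrix.fromCols C D, Matrix.fromRows C' D',
    ?_, ?_, ?_, ?_, fun k => ?_⟩
  · by_contra h0
    obtain ⟨rfl, rfl⟩ : p = 0 ∧ q = 0 := by omega
    exact hne.1 ⟨by rw [← hAP, Subsingleton.elim A 0, Matrix.zero_mul],
      by rw [← hCQ, Subsingleton.elim C 0, Matrix.zero_mul]⟩
  · by_contra h0
    obtain ⟨rfl, rfl⟩ : p' = 0 ∧ q' = 0 := by omega
    refine hne.2 ⟨(sub_eq_zero.1 ?_).symm, (sub_eq_zero.1 ?_).symm⟩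
    · rw [← hBP, Subsingleton.elim B 0, Matrix.zero_mul]
    · rw [← hDQ, Subsingleton.elim D 0, Matrix.zero_mul]
  · rw [Matrix.fromRows_mul_fromCols, hA, hAB, hBA, hB, Matrix.fromBlocks_one]
  · rw [Matrix.fromCols_mul_fromRows, hAP, hBP, add_sub_cancel]
  · rw [Matrix.fromCols_mul_fromRows, hCQ, hDQ, add_sub_cancel]
  · rw [Matrix.fromRows_mul_fromCols, hC, hCD, hDC, hD, Matrix.fromBlocks_one]
  · rw [Matrix.fromRows_mul, Matrix.fromRows_mul_fromCols]
    congr 1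
    · rw [← hAe, Matrix.mul_assoc A', hmat, Matrix.mul_assoc, Matrix.mul_assoc, hDe]
      simp
    · rw [← hCe, ← Matrix.mul_assoc, Matrix.mul_assoc B', ← hmat, ← Matrix.mul_assoc, hBe]
      simp

/-- A tuple equivalent to a direct sum of two tuples is their biproduct. -/
theorem exists_binary_biproduct_of_tupEquiv {X₁ X₂ : MatrixTuple F t}
    (h : TupEquiv X.mat (fun k => Matrix.fromBlocks (X₁.mat k) 0 0 (X₂.mat k))) :
    X.rows = X₁.rows + X₂.rows ∧ X.cols = X₁.cols + X₂.cols ∧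
    ∃ (i₁ : X₁ ⟶ X) (i₂ : X₂ ⟶ X) (p₁ : X ⟶ X₁) (p₂ : X ⟶ X₂), i₁ ≫ p₁ = 𝟙 X₁ ∧ i₂ ≫ p₂ = 𝟙 X₂ ∧
      i₁ ≫ p₂ = 0 ∧ i₂ ≫ p₁ = 0 ∧ p₁ ≫ i₁ + p₂ ≫ i₂ = 𝟙 X := by
  obtain ⟨R, R', S, S', hRR', hR'R, hSS', hS'S, hT⟩ := h
  beta_reduce at hT
  have hR'T (k) : R' * Matrix.fromBlocks (X₁.mat k) 0 0 (X₂.mat k) = X.mat k * S := by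
    rw [← hT k, ← Matrix.mul_assoc, ← Matrix.mul_assoc, hR'R, Matrix.one_mul]
  have hRT (k) : R * X.mat k = Matrix.fromBlocks (X₁.mat k) 0 0 (X₂.mat k) * S' := by
    rw [← hT k, Matrix.mul_assoc, hSS', Matrix.mul_one]
  refine ⟨by simpa using Matrix.square_of_invertible R' R hR'R hRR',
    by simpa using Matrix.square_of_invertible S S' hSS' hS'S, ?_⟩
  clear hT
  obtain ⟨R₁, R₂, rfl⟩ : ∃ R₁ R₂, R = Matrix.fromRows R₁ R₂ :=
    ⟨_, _, (Matrix.fromRows_toRows R).symm⟩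
  obtain ⟨R₁', R₂', rfl⟩ : ∃ R₁' R₂', R' = Matrix.fromCols R₁' R₂' :=
    ⟨_, _, (Matrix.fromCols_toCols R').symm⟩
  obtain ⟨S₁, S₂, rfl⟩ : ∃ S₁ S₂, S = Matrix.fromCols S₁ S₂ :=
    ⟨_, _, (Matrix.fromCols_toCols S).symm⟩
  obtain ⟨S₁', S₂', rfl⟩ : ∃ S₁' S₂', S' = Matrix.fromRows S₁' S₂' :=
    ⟨_, _, (Matrix.fromRows_toRows S').symm⟩
  simp only [Matrix.fromRows_mul, Matrix.fromBlocks_mul_fromRows, Matrix.zero_mul, add_zero,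
    zero_add, Matrix.fromRows_ext_iff] at hRT
  simp only [Matrix.mul_fromCols, Matrix.fromCols_mul_fromBlocks, Matrix.mul_zero, add_zero,
    zero_add, Matrix.fromCols_ext_iff] at hR'T
  rw [Matrix.fromRows_mul_fromCols, ← Matrix.fromBlocks_one, Matrix.fromBlocks_inj] at hRR' hS'S
  rw [Matrix.fromCols_mul_fromRows] at hR'R hSS'
  refine ⟨homMk R₁' S₁ fun k => (hR'T k).1, homMk R₂' S₂ fun k => (hR'T k).2,
    homMk R₁ S₁' fun k => (hRT k).1, homMk R₂ S₂' fun k => (hRT k).2, ?_, ?_, ?_, ?_, ?_⟩ <;>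
    rw [hom_ext_iff]
  · exact ⟨hRR'.1, hS'S.1⟩
  · exact ⟨hRR'.2.2.2, hS'S.2.2.2⟩
  · exact ⟨hRR'.2.2.1, hS'S.2.2.1⟩
  · exact ⟨hRR'.2.1, hS'S.2.1⟩
  · exact ⟨hR'R, hSS'⟩

theorem exists_isBiproductOf_indecomp (X : MatrixTuple F t) :
    ∃ (κ : Type) (_ : Fintype κ) (Y : κ → MatrixTuple F t),
      (∀ j, Indecomp (Y j).mat) ∧ IsBiproductOf X Y := by
  induction hN : X.rows + X.cols using Nat.strong_induction_on generalizing X with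
  | _ N ih =>
    subst hN
    by_cases h0 : X.rows + X.cols = 0
    · refine ⟨Empty, inferInstance, fun j => j.elim, fun j => j.elim, fun j => j.elim,
        fun j => j.elim, fun j => j.elim, fun j => j.elim, ?_⟩
      obtain ⟨hr, hc⟩ : X.rows = 0 ∧ X.cols = 0 := by omega
      rw [Finset.univ_eq_empty, Finset.sum_empty, hom_ext_iff]
      exact ⟨(one_eq_zero_iff_eq_zero.2 hr).symm, (one_eq_zero_iff_eq_zero.2 hc).symm⟩
    by_cases hX : Indecomp X.mat
    · exact ⟨Unit, inferInstance, fun _ => X, fun _ => hX, fun _ => 𝟙 X, fun _ => 𝟙 X,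
        by simp, by simp, by simp⟩
    simp only [Indecomp, Fintype.card_fin, Nat.pos_of_ne_zero h0, true_and, not_not] at hX
    obtain ⟨p, q, p', q', T₁, T₂, hpq, hpq', hT⟩ := hX
    obtain ⟨hr, hc, i₁, i₂, p₁, p₂, h₁₁, h₂₂, h₁₂, h₂₁, htot⟩ :=
      exists_binary_biproduct_of_tupEquiv (X₁ := ⟨p, q, T₁⟩) (X₂ := ⟨p', q', T₂⟩) hT
    simp only at hr hc
    obtain ⟨κ₁, _, Y, hY, hXY⟩ := ih (p + q) (by omega) ⟨p, q, T₁⟩ rfl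
    obtain ⟨κ₂, _, Z, hZ, hXZ⟩ := ih (p' + q') (by omega) ⟨p', q', T₂⟩ rfl
    exact ⟨κ₁ ⊕ κ₂, inferInstance, Sum.elim Y Z, Sum.rec hY hZ,
      IsBiproductOf.trans_sum h₁₁ h₂₂ h₁₂ h₂₁ htot hXY hXZ⟩

end MatrixTuple

/-- Lemma 2(a): every tuple of m×n matrices is equivalent to a direct sum of tuples
indecomposable with respect to equivalence, and this sum is unique up to permutation of
summands and replacement of summands by equivalent tuples. -/
theorem stmt2 {t m n : ℕ} (T : Fin t → Matrix (Fin m) (Fin n) F) :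
    (∃ (k : ℕ) (ms ns : Fin k → ℕ)
        (Ts : ∀ j : Fin k, Fin t → Matrix (Fin (ms j)) (Fin (ns j)) F),
        (∀ j, Indecomp (Ts j)) ∧
        TupEquiv T (fun i => Matrix.blockDiagonal' (fun j => Ts j i))) ∧
    (∀ (k₁ : ℕ) (ms₁ ns₁ : Fin k₁ → ℕ)
        (Ts₁ : ∀ j : Fin k₁, Fin t → Matrix (Fin (ms₁ j)) (Fin (ns₁ j)) F)
        (k₂ : ℕ) (ms₂ ns₂ : Fin k₂ → ℕ)
        (Ts₂ : ∀ j : Fin k₂, Fin t → Matrix (Fin (ms₂ j)) (Fin (ns₂ j)) F),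
        (∀ j, Indecomp (Ts₁ j)) →
        TupEquiv T (fun i => Matrix.blockDiagonal' (fun j => Ts₁ j i)) →
        (∀ j, Indecomp (Ts₂ j)) →
        TupEquiv T (fun i => Matrix.blockDiagonal' (fun j => Ts₂ j i)) →
        ∃ π : Fin k₁ ≃ Fin k₂, ∀ j, TupEquiv (Ts₁ j) (Ts₂ (π j))) := by
  refine ⟨?_, ?_⟩
  · obtain ⟨κ, _, Y, hY, hTY⟩ := MatrixTuple.exists_isBiproductOf_indecomp ⟨m, n, T⟩
    let e := (Fintype.equivFin κ).symm
    exact ⟨_, fun j => (Y (e j)).rows, fun j => (Y (e j)).cols, fun j => (Y (e j)).mat,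
      fun j => hY (e j), MatrixTuple.tupEquiv_of_isBiproductOf (hTY.reindex e)⟩
  · intro k₁ ms₁ ns₁ Ts₁ k₂ ms₂ ns₂ Ts₂ h₁ hT₁ h₂ hT₂
    let Y (j : Fin k₁) : MatrixTuple F t := ⟨ms₁ j, ns₁ j, Ts₁ j⟩
    let Z (j : Fin k₂) : MatrixTuple F t := ⟨ms₂ j, ns₂ j, Ts₂ j⟩
    obtain ⟨π, hπ⟩ := IsBiproductOf.exists_equiv F
      (MatrixTuple.isBiproductOf_of_tupEquiv (X := ⟨m, n, T⟩) (Y := Y) hT₁)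
      (MatrixTuple.isBiproductOf_of_tupEquiv (X := ⟨m, n, T⟩) (Y := Z) hT₂)
      (fun j => MatrixTuple.idempotentTrivial_of_indecomp (h₁ j))
      (fun j => MatrixTuple.idempotentTrivial_of_indecomp (h₂ j))
    exact ⟨π, fun j => MatrixTuple.tupEquiv_of_iso (hπ j).some⟩
end

section
/- Let F be an algebraically closed field of characteristic not 2 with an involution a↦ā (possibly the identity). Each tuple of n×n matrices over F is *congruent to a direct sum of tuples that are indecomposable with respect to *congruence, and this direct sum is determined uniquely up to permutation of the summands and replacement of each summand by a *congruent tuple. -/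
open Matrix

variable {F : Type} [Field F]

/-- Tuples of square matrices are *congruent when `(S.map σ)ᵀ · T1 k · S = T2 k` for all `k`,
for some invertible `S` (here `(S.map σ)ᵀ = S*` is the conjugate transpose w.r.t. the
involution `σ`). -/
def StarCongTup (σ : F →+* F) {t : ℕ} {I I' : Type}
    [Fintype I] [Fintype I'] [DecidableEq I] [DecidableEq I']
    (T1 : Fin t → Matrix I I F) (T2 : Fin t → Matrix I' I' F) : Prop :=
  ∃ (S : Matrix I I' F) (S' : Matrix I' I F),
    S * S' = 1 ∧ S' * S = 1 ∧ ∀ k, (S.map σ)ᵀ * T1 k * S = T2 k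

/-- A tuple of square matrices is indecomposable with respect to *congruence if it has
positive size and is not *congruent to a direct sum of two tuples of positive sizes. -/
def IndecompStar (σ : F →+* F) {t : ℕ} {I : Type} [Fintype I] [DecidableEq I]
    (T : Fin t → Matrix I I F) : Prop :=
  0 < Fintype.card I ∧
  ¬ ∃ (p p' : ℕ) (T1 : Fin t → Matrix (Fin p) (Fin p) F)
      (T2 : Fin t → Matrix (Fin p') (Fin p') F),
      0 < p ∧ 0 < p' ∧
      StarCongTup σ T (fun k => Matrix.fromBlocks (T1 k) 0 0 (T2 k))

namespace StarCongruence

/-- A square root modulo nilpotents lifts to a square root (Newton's method). -/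
lemma exists_sq_eq_of_isNilpotent {C : Type*} [CommRing C] {x h : C}
    (hu : IsUnit (2 * x)) (hn : IsNilpotent (x ^ 2 - h)) :
    ∃ s, s ^ 2 = h ∧ IsNilpotent (x - s) := by
  obtain ⟨s, ⟨hs, hs'⟩, -⟩ := Polynomial.existsUnique_nilpotent_sub_and_aeval_eq_zero
    (P := (Polynomial.X ^ 2 - Polynomial.C h : Polynomial C)) (x := x)
    (by simpa using hn) (by simpa [one_add_one_eq_two] using hu)
  exact ⟨s, by simpa [sub_eq_zero] using hs', hs⟩

lemma isUnit_one_sub_mul_swap {R : Type*} [Ring R] {a b : R} (h : IsUnit (1 - a * b)) :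
    IsUnit (1 - b * a) := by
  obtain ⟨⟨_, c, h₁, h₂⟩, rfl⟩ := h
  have e₁ : a * b * c = c - 1 := by rw [sub_mul, one_mul] at h₁; rw [← h₁]; abel
  have e₂ : c * (a * b) = c - 1 := by rw [mul_sub, mul_one] at h₂; rw [← h₂]; abel
  refine ⟨⟨1 - b * a, 1 + b * c * a, ?_, ?_⟩, rfl⟩
  · have : (1 - b * a) * (1 + b * c * a) = 1 - b * a + b * c * a - b * (a * b * c) * a := by
      noncomm_ring
    rw [this, e₁]; noncomm_ring
  · have : (1 + b * c * a) * (1 - b * a) = 1 - b * a + b * c * a - b * (c * (a * b)) * a := by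
      noncomm_ring
    rw [this, e₂]; noncomm_ring

/-! ### Fixed elements of an involution of an algebraically closed field -/

section Involution

variable {σ : F →+* F}

lemma map_eq_neg_of_map_ne_self {i : F} (hi : i * i = -1) (hσi : σ i ≠ i) : σ i = -i := by
  have h : (σ i - i) * (σ i + i) = 0 := by
    have : σ i * σ i = -1 := by rw [← map_mul, hi, map_neg, map_one]
    linear_combination this - hi
  rcases mul_eq_zero.mp h with h | h
  · exact absurd (sub_eq_zero.mp h) hσi
  · exact eq_neg_of_add_eq_zero_left h

lemma ne_neg_one_of_map_eq_self (h2 : (2 : F) ≠ 0) {i : F} (hi : i * i = -1) (hσi : σ i = -i)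
    {c : F} (hc : σ c = c) : c * c ≠ -1 := by
  intro h
  have hi0 : i ≠ 0 := by rintro rfl; simp at hi
  have : (c - i) * (c + i) = 0 := by linear_combination h - hi
  have h0 : 2 * i = 0 := by
    rcases mul_eq_zero.mp this with h | h
    · obtain rfl : c = i := sub_eq_zero.mp h
      linear_combination hσi - hc
    · obtain rfl : c = -i := eq_neg_of_add_eq_zero_left h
      rw [map_neg, hσi] at hc
      linear_combination hc
  simp [h2, hi0] at h0

variable [IsAlgClosed F]

lemma eq_self_of_map_eq_self (h2 : (2 : F) ≠ 0) (hσ : Function.Involutive σ) {i : F}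
    (hi : i * i = -1) (hσi : σ i = i) (a : F) : σ a = a := by
  obtain ⟨b, hb⟩ := IsAlgClosed.exists_pow_nat_eq (a - σ a) (n := 2) (by norm_num)
  have h₁ : σ (a - σ a) = -(a - σ a) := by simp [hσ a]
  have h₂ : σ b ^ 2 = -(b ^ 2) := by rw [← map_pow, hb, h₁]
  have h₃ : (b * σ b - i * b ^ 2) * (b * σ b + i * b ^ 2) = 0 := by
    linear_combination b ^ 2 * h₂ - b ^ 4 * hi
  have h₄ : σ (b * σ b) = b * σ b := by rw [map_mul, hσ b, mul_comm]
  have h₅ : σ (i * b ^ 2) = -(i * b ^ 2) := by rw [map_mul, hσi, map_pow, h₂]; ring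
  have h₆ : 2 * (i * b ^ 2) = 0 := by
    rcases mul_eq_zero.mp h₃ with h | h
    · have := congrArg σ h
      rw [map_sub, h₄, h₅, map_zero] at this
      linear_combination this - h
    · have := congrArg σ h
      rw [map_add, h₄, h₅, map_zero] at this
      linear_combination h - this
  have hi0 : i ≠ 0 := by rintro rfl; simp at hi
  have : b ^ 2 = 0 := by simpa [h2, hi0] using h₆
  rw [hb, sub_eq_zero] at this
  exact this.symm

lemma exists_sq_eq_or_neg_sq_eq (hσ : Function.Involutive σ) (h2 : (2 : F) ≠ 0) {i : F}
    (hi : i * i = -1) {c : F} (hc : σ c = c) :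
    ∃ s, σ s = s ∧ (s * s = c ∨ s * s = -c ∧ σ i = -i) := by
  obtain ⟨w, hw⟩ := IsAlgClosed.exists_pow_nat_eq c (n := 2) (by norm_num)
  by_cases hσi : σ i = i
  · exact ⟨w, eq_self_of_map_eq_self h2 hσ hi hσi w, Or.inl (by rw [← hw, sq])⟩
  replace hσi := map_eq_neg_of_map_ne_self hi hσi
  have h : (σ w - w) * (σ w + w) = 0 := by
    have : σ w ^ 2 = c := by rw [← map_pow, hw, hc]
    linear_combination this - hw
  rcases mul_eq_zero.mp h with h | h
  · exact ⟨w, sub_eq_zero.mp h, Or.inl (by rw [← hw, sq])⟩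
  · refine ⟨i * w, ?_, Or.inr ⟨by linear_combination w ^ 2 * hi - hw, hσi⟩⟩
    rw [map_mul, hσi, eq_neg_of_add_eq_zero_left h]; ring

lemma exists_sq_eq_sum_sq (hσ : Function.Involutive σ) {i : F} (hi : i * i = -1) (hσi : σ i = -i)
    {ι : Type*} (S : Finset ι) (a : ι → F) (ha : ∀ j ∈ S, σ (a j) = a j) :
    ∃ s, σ s = s ∧ s * s = ∑ j ∈ S, a j * a j := by
  classical
  induction S using Finset.induction_on with
  | empty => exact ⟨0, by simp⟩
  | insert j S hj ih =>
    obtain ⟨s, hs, hs'⟩ := ih fun k hk => ha k (Finset.mem_insert_of_mem hk)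
    obtain ⟨w, hw⟩ := IsAlgClosed.exists_pow_nat_eq (a j + i * s) (n := 2) (by norm_num)
    refine ⟨w * σ w, by rw [map_mul, hσ w, mul_comm], ?_⟩
    have : σ w ^ 2 = a j - i * s := by
      rw [← map_pow, hw, map_add, map_mul, hσi, hs, ha j (Finset.mem_insert_self _ _)]; ring
    rw [Finset.sum_insert hj, ← hs']
    linear_combination σ w ^ 2 * hw + (a j + i * s) * this - s ^ 2 * hi

end Involution

/-! ### Square roots in commutative local algebras over the fixed field -/

/-- The subfield of elements fixed by `σ`. -/
abbrev fixedField (σ : F →+* F) : Subfield F := σ.eqLocusField (RingHom.id F)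

section CommLocal

variable {σ : F →+* F} {C : Type} [CommRing C] {κ : fixedField σ →+* C}

lemma isUnit_two (κ : fixedField σ →+* C) (h2 : (2 : F) ≠ 0) : IsUnit (2 : C) := by
  have h2' : (1 + 1 : fixedField σ) ≠ 0 := fun h => h2 <| by
    have : (1 + 1 : F) = 0 := congrArg Subtype.val h
    rwa [one_add_one_eq_two] at this
  have := (isUnit_iff_ne_zero.mpr h2').map κ
  rwa [map_add, map_one, one_add_one_eq_two] at this

lemma exists_sq_eq_of_sub_scalar (h2 : (2 : F) ≠ 0) {h : C} {b : fixedField σ}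
    (hb : b ≠ 0) (hn : IsNilpotent (h - κ (b * b))) :
    ∃ s, s ^ 2 = h ∧ IsNilpotent (s - κ b) := by
  obtain ⟨s, hs, hs'⟩ := exists_sq_eq_of_isNilpotent (C := C) (x := κ b) (h := h)
    ((isUnit_two κ h2).mul ((isUnit_iff_ne_zero.mpr hb).map κ)) (by
      rw [← isNilpotent_neg_iff]
      convert hn using 1
      rw [map_mul]; ring)
  exact ⟨s, hs, by rw [← isNilpotent_neg_iff]; simpa using hs'⟩

lemma exists_sq_eq_neg_one (h2 : (2 : F) ≠ 0) {h : C} {a b : fixedField σ} (hb : b ≠ 0)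
    (hn : IsNilpotent ((h - κ a) ^ 2 + κ b ^ 2)) :
    ∃ t, t ^ 2 = -1 ∧ IsNilpotent (h - (κ a + κ b * t)) := by
  have hb' : κ b⁻¹ * κ b = 1 := by rw [← map_mul, inv_mul_cancel₀ hb, map_one]
  set t₀ := κ b⁻¹ * (h - κ a) with ht₀
  have hn' : IsNilpotent (t₀ ^ 2 - -1) := by
    have e : t₀ ^ 2 - -1 = κ b⁻¹ ^ 2 * ((h - κ a) ^ 2 + κ b ^ 2) := by
      rw [ht₀]; linear_combination (-1 - κ b⁻¹ * κ b) * hb'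
    rw [e]
    exact (Commute.all _ _).isNilpotent_mul_left hn
  have hu : IsUnit (t₀ ^ 2) := by
    have := hn'.isUnit_one_sub.neg
    convert this using 1; ring
  obtain ⟨t, ht, ht'⟩ := exists_sq_eq_of_isNilpotent
    ((isUnit_two κ h2).mul ((isUnit_pow_iff two_ne_zero).mp hu)) hn'
  refine ⟨t, ht, ?_⟩
  have e : h - (κ a + κ b * t) = κ b * (t₀ - t) := by
    rw [ht₀]; linear_combination (κ a - h) * hb'
  rw [e]
  exact (Commute.all _ _).isNilpotent_mul_left ht'

variable [IsAlgClosed F]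

/-- Every unit of a commutative local algebra over the fixed field, with residue field contained
in `F`, is up to sign a square. -/
lemma exists_sq_eq_or_of_not_isNilpotent (h2 : (2 : F) ≠ 0) (hσ : Function.Involutive σ) {i : F}
    (hi : i * i = -1) (hloc : ∀ x : C, IsNilpotent x ∨ IsUnit x) {h : C} (hh : ¬ IsNilpotent h)
    (heig : (∃ c, ¬ IsUnit (h - κ c)) ∨
      σ i = -i ∧ ∃ a b, b ≠ 0 ∧ ¬ IsUnit ((h - κ a) ^ 2 + κ b ^ 2)) :
    (∃ s, s ^ 2 = h) ∨ σ i = -i ∧ ∃ s c, s ^ 2 = -h ∧ IsNilpotent (s - κ c) := by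
  rcases heig with ⟨c, hc⟩ | ⟨hσi, a, b, hb, hab⟩
  · replace hc := (hloc _).resolve_right hc
    have hc0 : c ≠ 0 := by rintro rfl; simp [hh] at hc
    obtain ⟨s, hs, hs'⟩ := exists_sq_eq_or_neg_sq_eq hσ h2 hi c.2
    have hs0 : s ≠ 0 := by
      rintro rfl
      have hc : (c : F) = 0 := by
        rcases hs' with hs' | ⟨hs', -⟩ <;> simpa [eq_comm] using hs'
      exact hc0 (Subtype.ext hc)
    lift s to fixedField σ using hs
    have hs0' : s ≠ 0 := fun h => hs0 (congrArg Subtype.val h)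
    rcases hs' with hs' | ⟨hs', hσi⟩
    · obtain rfl : s * s = c := Subtype.ext hs'
      obtain ⟨r, hr, -⟩ := exists_sq_eq_of_sub_scalar h2 hs0' hc
      exact Or.inl ⟨r, hr⟩
    · obtain rfl : c = -(s * s) := Subtype.ext (by simp [hs'])
      obtain ⟨r, hr, hr'⟩ := exists_sq_eq_of_sub_scalar (h := -h) (κ := κ) h2 hs0' (by
        rw [← isNilpotent_neg_iff]; convert hc using 1; rw [map_neg]; ring)
      exact Or.inr ⟨hσi, r, s, hr, hr'⟩
  · obtain ⟨t, ht, ht'⟩ := exists_sq_eq_neg_one h2 hb ((hloc _).resolve_right hab)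
    obtain ⟨w, hw⟩ := IsAlgClosed.exists_pow_nat_eq ((a : F) + i * b) (n := 2) (by norm_num)
    have ha' : σ a = a := a.2
    have hb' : σ b = b := b.2
    have hw' : σ w ^ 2 = a - i * b := by
      rw [← map_pow, hw, map_add, map_mul, hσi, ha', hb']; ring
    let α : fixedField σ := ⟨(w + σ w) / 2, by
      change σ ((w + σ w) / 2) = _
      rw [map_div₀, map_add, hσ w, map_ofNat, add_comm, RingHom.id_apply]⟩
    let β : fixedField σ := ⟨(w - σ w) / 2 * (-i), by
      change σ ((w - σ w) / 2 * (-i)) = _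
      rw [map_mul, map_div₀, map_sub, hσ w, map_ofNat, map_neg, hσi, RingHom.id_apply]; ring⟩
    have h₁ : α * α - β * β = a := Subtype.ext <| by
      change (w + σ w) / 2 * ((w + σ w) / 2) -
        (w - σ w) / 2 * (-i) * ((w - σ w) / 2 * (-i)) = a
      field_simp
      linear_combination 2 * hw + 2 * hw' - (w - σ w) ^ 2 * hi
    have h₂ : 2 * (α * β) = b := Subtype.ext <| by
      change 2 * ((w + σ w) / 2 * ((w - σ w) / 2 * (-i))) = b
      field_simp
      linear_combination (-i) * hw + i * hw' - 2 * b * hi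
    have h₃ : α * α + β * β ≠ 0 := by
      intro h
      have h := congrArg Subtype.val h
      change (w + σ w) / 2 * ((w + σ w) / 2) +
        (w - σ w) / 2 * (-i) * ((w - σ w) / 2 * (-i)) = 0 at h
      have h0 : w * σ w = 0 := by
        field_simp at h
        have h4 : (4 : F) ≠ 0 := by
          rw [show (4 : F) = 2 * 2 by norm_num]; exact mul_ne_zero h2 h2
        apply mul_left_cancel₀ h4
        linear_combination h - (w - σ w) ^ 2 * hi
      have hw0 : w = 0 := by simpa using h0
      apply hb
      ext
      have hi0 : i ≠ 0 := by rintro rfl; simp at hi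
      have : 2 * i * b = 0 := by
        rw [hw0] at hw hw'
        rw [map_zero] at hw'
        linear_combination hw' - hw
      simpa [h2, hi0] using this
    left
    have e : (κ α + κ β * t) ^ 2 = κ a + κ b * t := by
      rw [← h₁, ← h₂]
      simp only [map_sub, map_mul, map_ofNat]
      linear_combination κ β ^ 2 * ht
    have hu : IsUnit (κ α + κ β * t) := by
      apply isUnit_of_mul_isUnit_left (y := κ α - κ β * t)
      convert (isUnit_iff_ne_zero.mpr h₃).map κ using 1
      simp only [map_add, map_mul]
      linear_combination - κ β ^ 2 * ht
    obtain ⟨s, hs, -⟩ := exists_sq_eq_of_isNilpotent ((isUnit_two κ h2).mul hu) (h := h) (by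
      rw [e, ← isNilpotent_neg_iff]; convert ht' using 1; ring)
    exact ⟨s, hs⟩

end CommLocal

/-! ### Spaces of symmetric elements without nontrivial idempotents -/

/-- `H` behaves like the set of symmetric elements of an `F`-algebra `R` with a `σ`-semilinear
involution in which the only symmetric idempotents are `0` and `1`. -/
structure IsLocalSymmetric (σ : F →+* F) {R : Type} [Ring R] [Algebra F R] (H : Set R) : Prop where
  scalar_mem : ∀ {c : F}, σ c = c → algebraMap F R c ∈ H
  add_mem : ∀ {x y : R}, x ∈ H → y ∈ H → x + y ∈ H
  neg_mem : ∀ {x : R}, x ∈ H → -x ∈ H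
  mul_mem : ∀ {x y : R}, x ∈ H → y ∈ H → x * y = y * x → x * y ∈ H
  conj_mem : ∀ {x y : R}, x ∈ H → y ∈ H → x * y * x ∈ H
  inv_mem : ∀ {x y : R}, x ∈ H → x * y = 1 → y * x = 1 → y ∈ H
  isNilpotent_or_isUnit : ∀ {x : R}, x ∈ H → IsNilpotent x ∨ IsUnit x
  exists_eigenvalue : ∀ {x : R}, x ∈ H → ∃ c, ¬ IsUnit (x - algebraMap F R c)

namespace IsLocalSymmetric

variable {σ : F →+* F} {R : Type} [Ring R] [Algebra F R] {H : Set R}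

/-- The commutative ring of symmetric elements in the bicommutant of `h`. -/
def bicommutant (hH : IsLocalSymmetric σ H) (h : R) : Subring R where
  carrier := {x | x ∈ H ∧ ∀ y, h * y = y * h → x * y = y * x}
  zero_mem' := ⟨by simpa using hH.scalar_mem (map_zero σ), by simp⟩
  one_mem' := ⟨by simpa using hH.scalar_mem (map_one σ), by simp⟩
  add_mem' hx hy := ⟨hH.add_mem hx.1 hy.1, fun z hz => by
    rw [add_mul, mul_add, hx.2 z hz, hy.2 z hz]⟩
  neg_mem' hx := ⟨hH.neg_mem hx.1, fun z hz => by rw [neg_mul, mul_neg, hx.2 z hz]⟩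
  mul_mem' {x y} hx hy := ⟨hH.mul_mem hx.1 hy.1 (hx.2 y (hy.2 h rfl).symm), fun z hz => by
    rw [mul_assoc, hy.2 z hz, ← mul_assoc, hx.2 z hz, mul_assoc]⟩

section Bicommutant

variable (hH : IsLocalSymmetric σ H) {h : R}

instance : CommRing (hH.bicommutant h) where
  __ := (hH.bicommutant h).toRing
  mul_comm x y := Subtype.ext (x.2.2 y (y.2.2 h rfl).symm)

/-- Fixed scalars as symmetric elements. -/
def scalar (h : R) : fixedField σ →+* hH.bicommutant h :=
  ((algebraMap F R).comp (fixedField σ).subtype).codRestrict _ fun c =>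
    ⟨hH.scalar_mem c.2, fun _ _ => Algebra.commutes _ _⟩

/-- `h` as an element of its bicommutant. -/
def self (hh : h ∈ H) : hH.bicommutant h := ⟨h, hh, fun _ hy => hy⟩

lemma coe_isNilpotent {x : hH.bicommutant h} : IsNilpotent (x : R) ↔ IsNilpotent x :=
  IsNilpotent.map_iff (f := (hH.bicommutant h).subtype) Subtype.val_injective

lemma coe_isUnit {x : hH.bicommutant h} : IsUnit (x : R) ↔ IsUnit x := by
  refine ⟨?_, fun hx => hx.map (hH.bicommutant h).subtype⟩
  rintro ⟨⟨x', y, h₁, h₂⟩, rfl : x' = x⟩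
  refine IsUnit.of_mul_eq_one ⟨y, hH.inv_mem x.2.1 h₁ h₂, fun z hz => ?_⟩ (Subtype.ext h₁)
  have := x.2.2 z hz
  calc y * z = y * (z * x) * y := by rw [mul_assoc, mul_assoc, h₁, mul_one]
    _ = z * y := by rw [← this, ← mul_assoc, h₂, one_mul]

lemma bicommutant_isNilpotent_or_isUnit (x : hH.bicommutant h) : IsNilpotent x ∨ IsUnit x := by
  rw [← hH.coe_isNilpotent, ← hH.coe_isUnit]
  exact hH.isNilpotent_or_isUnit x.2.1

lemma sub_scalar_or [IsAlgClosed F] (h2 : (2 : F) ≠ 0) (hσ : Function.Involutive σ) {i : F}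
    (hi : i * i = -1) (hh : h ∈ H) :
    (∃ c, ¬ IsUnit (hH.self hh - hH.scalar h c)) ∨ σ i = -i ∧ ∃ a b, b ≠ 0 ∧
      ¬ IsUnit ((hH.self hh - hH.scalar h a) ^ 2 + hH.scalar h b ^ 2) := by
  obtain ⟨l, hl⟩ := hH.exists_eigenvalue hh
  by_cases hσl : σ l = l
  · exact Or.inl ⟨⟨l, hσl⟩, fun hu => hl (hH.coe_isUnit.mpr hu)⟩
  have hσi : σ i = -i := map_eq_neg_of_map_ne_self hi fun h =>
    hσl (eq_self_of_map_eq_self h2 hσ hi h l)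
  let a : fixedField σ := ⟨(l + σ l) / 2, by
    change σ ((l + σ l) / 2) = _
    rw [map_div₀, map_add, hσ l, map_ofNat, add_comm, RingHom.id_apply]⟩
  let b : fixedField σ := ⟨(l - σ l) / 2 * (-i), by
    change σ ((l - σ l) / 2 * (-i)) = _
    rw [map_mul, map_div₀, map_sub, hσ l, map_ofNat, map_neg, hσi, RingHom.id_apply]; ring⟩
  have hb : b ≠ 0 := by
    intro h
    have h : (l - σ l) / 2 * (-i) = 0 := congrArg Subtype.val h
    have hi0 : i ≠ 0 := by rintro rfl; simp at hi
    simp only [mul_eq_zero, div_eq_zero_iff, h2, or_false, neg_eq_zero, hi0, sub_eq_zero] at h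
    exact hσl h.symm
  refine Or.inr ⟨hσi, a, b, hb, fun hu => hl ?_⟩
  rw [← hH.coe_isUnit] at hu
  have hal : (a : F) + i * b = l := by
    change (l + σ l) / 2 + i * ((l - σ l) / 2 * (-i)) = l
    field_simp
    linear_combination (σ l - l) * hi
  clear_value a b
  have key : (((hH.self hh - hH.scalar h a) ^ 2 + hH.scalar h b ^ 2 : hH.bicommutant h) : R) =
      (h - algebraMap F R (a - i * b)) * (h - algebraMap F R l) := by
    have e : (((hH.self hh - hH.scalar h a) ^ 2 + hH.scalar h b ^ 2 : hH.bicommutant h) : R) =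
      (h - algebraMap F R a) ^ 2 + algebraMap F R b ^ 2 := rfl
    have e₁ : algebraMap F R b ^ 2 = -algebraMap F R (i * b) ^ 2 := by
      rw [← map_pow, ← map_pow, ← map_neg]
      congr 1
      linear_combination (b : F) ^ 2 * hi
    have e₂ : Commute (h - algebraMap F R a) (algebraMap F R (i * b)) :=
      Algebra.commute_algebraMap_right _ _
    rw [e, e₁, ← hal, map_add, map_sub, ← sub_eq_add_neg, e₂.sq_sub_sq, sub_add, sub_sub]
  rw [key, Commute.isUnit_mul_iff] at hu
  · exact hu.2
  · exact ((Commute.refl _).sub_right (Algebra.commute_algebraMap_right _ _)).sub_left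
      (Algebra.commute_algebraMap_left _ _)

end Bicommutant

lemma one_mem (hH : IsLocalSymmetric σ H) : (1 : R) ∈ H := by simpa using hH.scalar_mem (map_one σ)

lemma sub_mem (hH : IsLocalSymmetric σ H) {x y : R} (hx : x ∈ H) (hy : y ∈ H) : x - y ∈ H := by
  simpa [sub_eq_add_neg] using hH.add_mem hx (hH.neg_mem hy)

lemma isNilpotent_conj (hH : IsLocalSymmetric σ H) {x q : R} (hx : x ∈ H) (hq : q ∈ H)
    (hx' : IsNilpotent x) (hq' : IsUnit q) [Nontrivial R] : IsNilpotent (q * x * q) := by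
  refine (hH.isNilpotent_or_isUnit (hH.conj_mem hq hx)).resolve_right fun hu => ?_
  rw [hq'.mul_right_iff, hq'.mul_left_iff] at hu
  exact hx'.not_isUnit hu

lemma exists_isUnit_one_sub (hH : IsLocalSymmetric σ H) (h2 : (2 : F) ≠ 0) {s : R} (hs : s ∈ H) :
    ∃ r ∈ H, r * r = s * s ∧ IsUnit (1 - r) := by
  rcases hH.isNilpotent_or_isUnit (hH.sub_mem hH.one_mem hs) with hn | hu
  · refine ⟨-s, hH.neg_mem hs, neg_mul_neg s s, ?_⟩
    have h2' : IsUnit (algebraMap F R 2) := (isUnit_iff_ne_zero.mpr h2).map _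
    rw [map_ofNat] at h2'
    have e : 1 - -s = 2 + -(1 - s) := by rw [← one_add_one_eq_two]; abel
    rw [e]
    exact hn.neg.isUnit_add_left_of_commute h2' (Commute.ofNat_right _ 2)
  · exact ⟨s, hs, rfl, hu⟩

variable {h : R} [IsAlgClosed F]

lemma exists_sq_or (hH : IsLocalSymmetric σ H) (h2 : (2 : F) ≠ 0)
    (hσ : Function.Involutive σ) {i : F} (hi : i * i = -1) (hh : h ∈ H) (hn : ¬ IsNilpotent h) :
    (∃ s ∈ H, s * s = h) ∨ σ i = -i ∧
      ∃ s ∈ H, ∃ c, σ c = c ∧ s * s = -h ∧ IsNilpotent (s - algebraMap F R c) := by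
  rcases exists_sq_eq_or_of_not_isNilpotent h2 hσ hi hH.bicommutant_isNilpotent_or_isUnit
    (mt hH.coe_isNilpotent.mpr hn) (hH.sub_scalar_or h2 hσ hi hh) with ⟨s, hs⟩ | ⟨hσi, s, c, hs, hc⟩
  · exact Or.inl ⟨s, s.2.1, by rw [← sq]; exact congrArg Subtype.val hs⟩
  · exact Or.inr ⟨hσi, s, s.2.1, c, c.2, by rw [← sq]; exact congrArg Subtype.val hs,
      hH.coe_isNilpotent.mpr hc⟩

lemma isNilpotent_sub_or_exists_sq_eq_neg_one (hH : IsLocalSymmetric σ H) (h2 : (2 : F) ≠ 0)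
    (hσ : Function.Involutive σ) {i : F} (hi : i * i = -1) (hh : h ∈ H) :
    (∃ c, σ c = c ∧ IsNilpotent (h - algebraMap F R c)) ∨ ∃ t ∈ H, t * t = -1 := by
  rcases hH.sub_scalar_or h2 hσ hi hh with ⟨c, hc⟩ | ⟨-, a, b, hb, hab⟩
  · exact Or.inl ⟨c, c.2, hH.coe_isNilpotent.mpr
      ((hH.bicommutant_isNilpotent_or_isUnit _).resolve_right hc)⟩
  · obtain ⟨t, ht, -⟩ := exists_sq_eq_neg_one h2 hb
      ((hH.bicommutant_isNilpotent_or_isUnit _).resolve_right hab)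
    exact Or.inr ⟨t, t.2.1, by rw [← sq]; exact congrArg Subtype.val ht⟩

lemma exists_sq_eq_or_neg (hH : IsLocalSymmetric σ H) (h2 : (2 : F) ≠ 0)
    (hσ : Function.Involutive σ) {i : F}
    (hi : i * i = -1) (hh : h ∈ H) (hu : IsUnit h) [Nontrivial R] :
    ∃ s ∈ H, IsUnit s ∧ (h = s * s ∨ h = -(s * s)) := by
  rcases hH.exists_sq_or h2 hσ hi hh (fun hn => hn.not_isUnit hu) with
    ⟨s, hs, e⟩ | ⟨-, s, hs, c, -, e, -⟩
  · refine ⟨s, hs, ?_, Or.inl e.symm⟩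
    rw [← e, ← sq] at hu
    exact (isUnit_pow_iff two_ne_zero).mp hu
  · have e' : h = -(s * s) := by rw [e, neg_neg]
    refine ⟨s, hs, ?_, Or.inr e'⟩
    rw [e', IsUnit.neg_iff, ← sq] at hu
    exact (isUnit_pow_iff two_ne_zero).mp hu

lemma isNilpotent_add (hH : IsLocalSymmetric σ H) (h2 : (2 : F) ≠ 0)
    (hσ : Function.Involutive σ) {i : F}
    (hi : i * i = -1) [Nontrivial R] {k : R} (hh : h ∈ H) (hk : k ∈ H) (hh' : IsNilpotent h)
    (hk' : IsNilpotent k) : IsNilpotent (h + k) := by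
  have hhk := hH.add_mem hh hk
  refine (hH.isNilpotent_or_isUnit hhk).resolve_right fun hu => ?_
  obtain ⟨_, hs, ⟨⟨s, r, hsr, hrs⟩, rfl⟩, e⟩ := hH.exists_sq_eq_or_neg h2 hσ hi hhk hu
  have hr := hH.inv_mem hs hsr hrs
  have hru : IsUnit r := ⟨⟨r, s, hrs, hsr⟩, rfl⟩
  have hn := hH.isNilpotent_conj hh hr hh' hru
  have hn' := hH.isNilpotent_conj hk hr hk' hru
  have e₁ : r * (s * s) * r = 1 := by rw [mul_assoc, mul_assoc, hsr, mul_one, hrs]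
  have e₂ : r * k * r = r * (h + k) * r - r * h * r := by noncomm_ring
  dsimp only at e
  refine hn'.not_isUnit ?_
  rcases e with e | e
  · rw [e₂, e, e₁]; exact hn.isUnit_one_sub
  · rw [e₂, e, mul_neg, neg_mul, e₁, ← neg_add', IsUnit.neg_iff]; exact hn.isUnit_one_add

lemma isNilpotent_sum (hH : IsLocalSymmetric σ H) (h2 : (2 : F) ≠ 0)
    (hσ : Function.Involutive σ) {i : F}
    (hi : i * i = -1) [Nontrivial R] {ι : Type*} (S : Finset ι) (f : ι → R)
    (hf : ∀ j ∈ S, f j ∈ H) (hn : ∀ j ∈ S, IsNilpotent (f j)) : IsNilpotent (∑ j ∈ S, f j) :=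
  (Finset.sum_induction f (fun x => x ∈ H ∧ IsNilpotent x)
    (fun _ _ hx hy => ⟨hH.add_mem hx.1 hy.1, hH.isNilpotent_add h2 hσ hi hx.1 hy.1 hx.2 hy.2⟩)
    ⟨by simpa using hH.scalar_mem (map_zero σ), IsNilpotent.zero⟩
    fun j hj => ⟨hf j hj, hn j hj⟩).2

lemma isUnit_one_sub_mul (hH : IsLocalSymmetric σ H) (h2 : (2 : F) ≠ 0)
    (hσ : Function.Involutive σ) {i : F}
    (hi : i * i = -1) (hσi : σ i = -i) [Nontrivial R] {t s : R} {c : F} (ht : t ∈ H)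
    (ht' : t * t = -1) (hs : s ∈ H) (hc : σ c = c) (hn : IsNilpotent (s - algebraMap F R c)) :
    IsUnit (1 - t * s) := by
  have hcc : c * c + 1 ≠ 0 := fun h => ne_neg_one_of_map_eq_self h2 hi hσi hc
    (eq_neg_of_add_eq_zero_left h)
  set n := s - algebraMap F R c with hn_def
  have hnH : n ∈ H := hH.sub_mem hs (hH.scalar_mem hc)
  have hct : Commute (algebraMap F R c) t := Algebra.commutes _ _
  set z := algebraMap F R c with hz
  have hzz : algebraMap F R ((c * c + 1)⁻¹) * (z * z + 1) = 1 := by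
    rw [hz, ← map_one (algebraMap F R), ← map_mul, ← map_add, ← map_mul, inv_mul_cancel₀ hcc]
  set d := algebraMap F R ((c * c + 1)⁻¹) with hd
  have hdH : d ∈ H := hH.scalar_mem (by simp [hc])
  have hdc : ∀ x, d * x = x * d := Algebra.commutes _
  have hp : d * (t - z) ∈ H := hH.mul_mem hdH (hH.sub_mem ht (hH.scalar_mem hc)) (hdc _)
  have e₁ : (1 - z * t) * (t - z) = (z * z + 1) * t := by
    have : z * t * z = z * z * t := by rw [mul_assoc, mul_assoc, hct.eq]
    have h' : z * t * t = -z := by rw [mul_assoc, ht', mul_neg_one]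
    rw [sub_mul, one_mul, mul_sub, this, h', add_mul, one_mul]; abel
  have e₂ : (1 - z * t) * (d * (t - z)) = t := by
    rw [← mul_assoc, ← hdc, mul_assoc, e₁, ← mul_assoc, hzz, one_mul]
  have htu : IsUnit t := ⟨⟨t, -t, by simp [ht'], by simp [ht']⟩, rfl⟩
  have hcomm : Commute (1 - z * t) (d * (t - z)) := by
    refine Commute.mul_right (hdc _).symm ?_
    exact (Commute.one_left _).sub_left
      (Commute.mul_left (Algebra.commutes _ _) ((Commute.refl t).sub_right hct.symm))
  rw [← e₂, hcomm.isUnit_mul_iff] at htu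
  obtain ⟨q, hq, hqu, hpq⟩ := hH.exists_sq_eq_or_neg h2 hσ hi hp htu.2
  have hqn := hH.isNilpotent_conj hnH hq hn hqu
  have e₃ : 1 - t * s = (1 - z * t) * (1 - d * (t - z) * n) := by
    rw [mul_sub, ← mul_assoc, e₂, hn_def, mul_sub, hct.eq, mul_one]; abel
  rw [e₃]
  refine htu.1.mul ?_
  rcases hpq with hpq | hpq
  · rw [hpq, mul_assoc]
    exact isUnit_one_sub_mul_swap hqn.isUnit_one_sub
  · rw [hpq, neg_mul, mul_assoc, ← mul_neg]
    apply isUnit_one_sub_mul_swap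
    rw [neg_mul, sub_neg_eq_add]
    exact hqn.isUnit_one_add

/-- If symmetric elements sum to `1`, then one of them factors as `x* * x` with `1 - x` and
`1 - x*` invertible. -/
theorem exists_eq_mul_of_sum_eq_one (hH : IsLocalSymmetric σ H) (h2 : (2 : F) ≠ 0)
    (hσ : Function.Involutive σ)
    [Nontrivial R] {ι : Type*} (S : Finset ι) (f : ι → R) (hf : ∀ j ∈ S, f j ∈ H)
    (hsum : ∑ j ∈ S, f j = 1) :
    ∃ j ∈ S, ∃ a ∈ H, ∃ b ∈ H, IsUnit (f j) ∧ f j = b * a * (a * b) ∧ IsUnit (1 - a * b) ∧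
      IsUnit (1 - b * a) := by
  obtain ⟨i, hi⟩ : ∃ i : F, i * i = -1 := by
    obtain ⟨i, hi⟩ := IsAlgClosed.exists_pow_nat_eq (-1 : F) (n := 2) (by norm_num)
    exact ⟨i, by rw [← hi, sq]⟩
  have of_sq : ∀ j ∈ S, ∀ s ∈ H, s * s = f j → ¬ IsNilpotent (f j) →
      ∃ j ∈ S, ∃ a ∈ H, ∃ b ∈ H, IsUnit (f j) ∧ f j = b * a * (a * b) ∧
        IsUnit (1 - a * b) ∧ IsUnit (1 - b * a) := by
    intro j hj s hs e hn
    obtain ⟨r, hr, e', hu⟩ := hH.exists_isUnit_one_sub h2 hs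
    exact ⟨j, hj, r, hr, 1, hH.one_mem, (hH.isNilpotent_or_isUnit (hf j hj)).resolve_left hn,
      by rw [one_mul, mul_one, e', e], by rwa [mul_one], by rwa [one_mul]⟩
  by_cases ht : ∃ t ∈ H, t * t = -1
  · obtain ⟨t, ht, ht'⟩ := ht
    obtain ⟨j, hj, hn⟩ : ∃ j ∈ S, ¬ IsNilpotent (f j) := by
      by_contra! h
      have := hH.isNilpotent_sum h2 hσ hi S f hf h
      rw [hsum] at this
      exact this.not_isUnit isUnit_one
    rcases hH.exists_sq_or h2 hσ hi (hf j hj) hn with ⟨s, hs, e⟩ | ⟨hσi, s, hs, c, hc, e, hsc⟩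
    · exact of_sq j hj s hs e hn
    · have hu := hH.isUnit_one_sub_mul h2 hσ hi hσi ht ht' hs hc hsc
      refine ⟨j, hj, t, ht, s, hs, (hH.isNilpotent_or_isUnit (hf j hj)).resolve_left hn, ?_, hu,
        isUnit_one_sub_mul_swap hu⟩
      have : s * t * (t * s) = s * (t * t) * s := by noncomm_ring
      rw [this, ht', mul_neg_one, neg_mul, e, neg_neg]
  · have hσi : σ i = -i := map_eq_neg_of_map_ne_self hi fun h =>
      ht ⟨algebraMap F R i, hH.scalar_mem h, by rw [← map_mul, hi, map_neg, map_one]⟩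
    have hc : ∀ j ∈ S, ∃ c, σ c = c ∧ IsNilpotent (f j - algebraMap F R c) := fun j hj =>
      (hH.isNilpotent_sub_or_exists_sq_eq_neg_one h2 hσ hi (hf j hj)).resolve_right ht
    choose! c hcσ hcn using hc
    have hc1 : ∑ j ∈ S, c j = 1 := by
      have hn := hH.isNilpotent_sum h2 hσ hi S (fun j => f j - algebraMap F R (c j))
        (fun j hj => hH.sub_mem (hf j hj) (hH.scalar_mem (hcσ j hj))) hcn
      rw [Finset.sum_sub_distrib, hsum, ← map_sum, ← map_one (algebraMap F R), ← map_sub,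
        IsNilpotent.map_iff (algebraMap F R).injective, isNilpotent_iff_eq_zero, sub_eq_zero] at hn
      exact hn.symm
    obtain ⟨j, hj, b, hb, e, hb0⟩ : ∃ j ∈ S, ∃ b, σ b = b ∧ b * b = c j ∧ b ≠ 0 := by
      by_contra! h
      have hneg : ∀ j ∈ S, ∃ a, σ a = a ∧ a * a = -c j := by
        intro j hj
        obtain ⟨s, hs, e | e⟩ := exists_sq_eq_or_neg_sq_eq hσ h2 hi (hcσ j hj)
        · exact ⟨0, map_zero σ, by rw [← e, h j hj s hs e]; simp⟩
        · exact ⟨s, hs, e.1⟩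
      choose! a haσ ha using hneg
      obtain ⟨s, hs, e⟩ := exists_sq_eq_sum_sq hσ hi hσi S a haσ
      rw [Finset.sum_congr rfl ha, Finset.sum_neg_distrib, hc1] at e
      exact ne_neg_one_of_map_eq_self h2 hi hσi hs e
    lift b to fixedField σ using hb
    have hcn' := hcn j hj
    rw [← e] at hcn'
    have hb0' : b ≠ 0 := by rintro rfl; exact hb0 rfl
    obtain ⟨s, hs, -⟩ := exists_sq_eq_of_sub_scalar (κ := hH.scalar (f j)) h2
      (h := hH.self (hf j hj)) hb0' (hH.coe_isNilpotent.mp hcn')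
    refine of_sq j hj s s.2.1 (by rw [← sq]; exact congrArg Subtype.val hs) fun hn => ?_
    have := hH.isNilpotent_add h2 hσ hi (hf j hj)
      (hH.neg_mem (hH.sub_mem (hf j hj) (hH.scalar_mem (hcσ j hj)))) hn (hcn j hj).neg
    rw [neg_sub, add_sub_cancel, IsNilpotent.map_iff (algebraMap F R).injective,
      isNilpotent_iff_eq_zero, ← e] at this
    exact hb0 (by simpa using this)

end IsLocalSymmetric

/-! ### Vector-valued sesquilinear forms -/

section Forms

variable {σ : F →+* F} {V V' V'' X Z W : Type} [AddCommGroup V] [Module F V] [AddCommGroup V']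
  [Module F V'] [AddCommGroup V''] [Module F V''] [AddCommGroup X] [Module F X] [AddCommGroup Z]
  [Module F Z] [AddCommGroup W] [Module F W]

/-- Isometry of vector-valued sesquilinear forms. -/
def Isom (B : V →ₛₗ[σ] V →ₗ[F] W) (B' : V' →ₛₗ[σ] V' →ₗ[F] W) : Prop :=
  ∃ φ : V ≃ₗ[F] V', ∀ x y, B' (φ x) (φ y) = B x y

lemma Isom.symm {B : V →ₛₗ[σ] V →ₗ[F] W} {B' : V' →ₛₗ[σ] V' →ₗ[F] W} (h : Isom B B') :
    Isom B' B := by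
  obtain ⟨φ, hφ⟩ := h
  exact ⟨φ.symm, fun x y => by rw [← hφ, φ.apply_symm_apply, φ.apply_symm_apply]⟩

lemma Isom.trans {B : V →ₛₗ[σ] V →ₗ[F] W} {B' : V' →ₛₗ[σ] V' →ₗ[F] W}
    {B'' : V'' →ₛₗ[σ] V'' →ₗ[F] W} (h : Isom B B') (h' : Isom B' B'') : Isom B B'' := by
  obtain ⟨φ, hφ⟩ := h
  obtain ⟨ψ, hψ⟩ := h'
  exact ⟨φ.trans ψ, fun x y => by simp [hφ, hψ]⟩

/-- An endomorphism which is adjoint to itself. -/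
def IsSelfAdj (B : V →ₛₗ[σ] V →ₗ[F] W) (f : Module.End F V) : Prop :=
  ∀ x y, B (f x) y = B x (f y)

lemma IsSelfAdj.pow {B : V →ₛₗ[σ] V →ₗ[F] W} {f : Module.End F V} (hf : IsSelfAdj B f) (n : ℕ) :
    IsSelfAdj B (f ^ n) := by
  induction n with
  | zero => exact fun _ _ => rfl
  | succ n ih => intro x y; rw [pow_succ, Module.End.mul_apply, ih, hf, ← Module.End.mul_apply,
      ← pow_succ', pow_succ]

/-- A form on a nonzero space all of whose self-adjoint idempotents are trivial. -/
def IsIndec (B : V →ₛₗ[σ] V →ₗ[F] W) : Prop :=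
  Nontrivial V ∧ ∀ e : Module.End F V, e * e = e → IsSelfAdj B e → e = 0 ∨ e = 1

lemma IsIndec.isNilpotent_or_isUnit [FiniteDimensional F V] {B : V →ₛₗ[σ] V →ₗ[F] W}
    (hB : IsIndec B) {f : Module.End F V} (hf : IsSelfAdj B f) : IsNilpotent f ∨ IsUnit f := by
  obtain ⟨n, hn, hn1⟩ := (f.eventually_isCompl_ker_pow_range_pow.and
    (Filter.eventually_ne_atTop 0)).exists
  have hker : ∀ x, (f ^ n) (Submodule.projection _ _ hn x) = 0 := fun x =>
    LinearMap.mem_ker.mp (Submodule.projection_apply_mem hn x)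
  have hrange : ∀ x, ∃ z, (f ^ n) z = x - Submodule.projection _ _ hn x := fun x => by
    have : x - Submodule.projection _ _ hn x ∈ LinearMap.range (f ^ n) := by
      rw [← Submodule.projection_apply_eq_zero_iff hn, map_sub, sub_eq_zero]
      exact (Submodule.projection_apply_of_mem_left hn (Submodule.projection_apply_mem hn x)).symm
    exact this
  set e : Module.End F V := Submodule.projection _ _ hn with he
  have hee : e * e = e := LinearMap.ext fun x =>
    Submodule.projection_apply_of_mem_left hn (Submodule.projection_apply_mem hn x)
  have h₁ : ∀ x y, B (e x) y = B (e x) (e y) := fun x y => by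
    obtain ⟨z, hz⟩ := hrange y
    rw [← sub_eq_zero, ← map_sub, ← hz, ← hf.pow n, hker, map_zero, LinearMap.zero_apply]
  have h₂ : ∀ x y, B x (e y) = B (e x) (e y) := fun x y => by
    obtain ⟨z, hz⟩ := hrange x
    rw [← sub_eq_zero, ← LinearMap.sub_apply, ← map_sub, ← hz, hf.pow n, hker, map_zero]
  rcases hB.2 e hee fun x y => (h₁ x y).trans (h₂ x y).symm with h | h
  · right
    rw [← isUnit_pow_iff hn1, LinearMap.isUnit_iff_ker_eq_bot, ← Submodule.range_projection hn,
      ← he, h, LinearMap.range_zero]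
  · left
    refine ⟨n, LinearMap.ext fun x => ?_⟩
    have := hker x
    rwa [h] at this

lemma IsIndec.isLocalSymmetric [IsAlgClosed F] [FiniteDimensional F V]
    {B : V →ₛₗ[σ] V →ₗ[F] W} (hB : IsIndec B) : IsLocalSymmetric σ {f | IsSelfAdj B f} where
  scalar_mem hc x y := by simp [Module.algebraMap_end_apply, hc]
  add_mem hf hg x y := by simp [hf x y, hg x y]
  neg_mem hf x y := by simp [hf x y]
  mul_mem {f g} hf hg h x y := by
    rw [Module.End.mul_apply, hf, hg, ← Module.End.mul_apply, h]
  conj_mem {f g} hf hg x y := by simp only [Module.End.mul_apply]; rw [hf, hg, hf]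
  inv_mem {f g} hf h₁ h₂ x y := by
    have h : ∀ z, f (g z) = z := LinearMap.congr_fun h₁
    rw [← h y, ← hf, h, h]
  isNilpotent_or_isUnit hf := hB.isNilpotent_or_isUnit hf
  exists_eigenvalue {f} _ := by
    have := hB.1
    obtain ⟨c, hc⟩ := Module.End.exists_eigenvalue f
    refine ⟨c, fun hu => ?_⟩
    have := Module.End.hasEigenvalue_iff_mem_spectrum.mp hc
    rw [spectrum.mem_iff, ← IsUnit.neg_iff, neg_sub] at this
    exact this hu

/-- The orthogonal sum of two forms. -/
def prodForm (B : V →ₛₗ[σ] V →ₗ[F] W) (C : X →ₛₗ[σ] X →ₗ[F] W) :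
    V × X →ₛₗ[σ] V × X →ₗ[F] W :=
  LinearMap.mk₂'ₛₗ σ (RingHom.id F) (fun x y => B x.1 y.1 + C x.2 y.2)
    (fun x x' y => by simp; abel) (fun c x y => by simp)
    (fun x y y' => by simp; abel) (fun c x y => by simp)

@[simp]
lemma prodForm_apply (B : V →ₛₗ[σ] V →ₗ[F] W) (C : X →ₛₗ[σ] X →ₗ[F] W) (x y : V × X) :
    prodForm B C x y = B x.1 y.1 + C x.2 y.2 := rfl

/-- The upper left corner of a map between binary direct sums. -/
def corner (S : (V × X) ≃ₗ[F] (V' × Z)) : V →ₗ[F] V' :=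
  LinearMap.fst F V' Z ∘ₗ (S : _ →ₗ[F] _) ∘ₗ LinearMap.inl F V X

lemma corner_apply (S : (V × X) ≃ₗ[F] (V' × Z)) (v : V) : corner S v = (S (v, 0)).1 := rfl

lemma corner_adjoint {B : V →ₛₗ[σ] V →ₗ[F] W} {C : X →ₛₗ[σ] X →ₗ[F] W}
    {B' : V' →ₛₗ[σ] V' →ₗ[F] W} {D : Z →ₛₗ[σ] Z →ₗ[F] W} {S : (V × X) ≃ₗ[F] (V' × Z)}
    (hS : ∀ x y, prodForm B' D (S x) (S y) = prodForm B C x y) (v : V) (y : V') :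
    B' (corner S v) y = B v (corner S.symm y) := by
  have := hS (v, 0) (S.symm (y, 0))
  simpa [corner_apply] using this

lemma corner_adjoint' {B : V →ₛₗ[σ] V →ₗ[F] W} {C : X →ₛₗ[σ] X →ₗ[F] W}
    {B' : V' →ₛₗ[σ] V' →ₗ[F] W} {D : Z →ₛₗ[σ] Z →ₗ[F] W} {S : (V × X) ≃ₗ[F] (V' × Z)}
    (hS : ∀ x y, prodForm B' D (S x) (S y) = prodForm B C x y) (y : V') (v : V) :
    B (corner S.symm y) v = B' y (corner S v) :=
  corner_adjoint (S := S.symm) (fun x y => by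
    rw [← hS, S.apply_symm_apply, S.apply_symm_apply]) y v

/-- The map obtained from `S : V × X ≃ V × Z` by connecting the output in `V` to the input
in `V`, where `g` is an inverse of `1 - corner S`. -/
def feedback (S : (V × X) ≃ₗ[F] (V × Z)) (g : Module.End F V) : X →ₗ[F] Z :=
  LinearMap.snd F V Z ∘ₗ (S : _ →ₗ[F] _) ∘ₗ
    (g ∘ₗ LinearMap.fst F V Z ∘ₗ (S : _ →ₗ[F] _) ∘ₗ LinearMap.inr F V X).prod LinearMap.id

lemma fst_apply_mk (S : (V × X) ≃ₗ[F] (V × Z)) (v : V) (x : X) :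
    (S (v, x)).1 = corner S v + (S (0, x)).1 := by
  rw [corner_apply, ← Prod.fst_add, ← map_add, Prod.mk_add_mk, add_zero, zero_add]

lemma exists_apply_eq_feedback {S : (V × X) ≃ₗ[F] (V × Z)} {g : Module.End F V}
    (hg : (1 - corner S) * g = 1) (x : X) : ∃ y, S (y, x) = (y, feedback S g x) := by
  refine ⟨g (S (0, x)).1, Prod.ext ?_ rfl⟩
  have := LinearMap.congr_fun hg (S (0, x)).1
  rw [fst_apply_mk]
  simp only [Module.End.mul_apply, LinearMap.sub_apply, Module.End.one_apply] at this
  nth_rw 2 [← this]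
  abel

lemma feedback_eq {S : (V × X) ≃ₗ[F] (V × Z)} {g : Module.End F V} (hg : g * (1 - corner S) = 1)
    {y : V} {x : X} {z : Z} (h : S (y, x) = (y, z)) : feedback S g x = z := by
  have h₁ := fst_apply_mk S y x
  rw [h] at h₁
  have h₂ := LinearMap.congr_fun hg y
  simp only [Module.End.mul_apply, LinearMap.sub_apply, Module.End.one_apply] at h₂
  rw [← eq_sub_iff_add_eq'.mpr h₁.symm] at h₂
  change (S (g (S (0, x)).1, x)).2 = z
  rw [h₂, h]

/-- Cancellation along an isometry with well-behaved corners. -/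
lemma isom_of_isUnit_one_sub_corner {B : V →ₛₗ[σ] V →ₗ[F] W} {C : X →ₛₗ[σ] X →ₗ[F] W}
    {D : Z →ₛₗ[σ] Z →ₗ[F] W} {S : (V × X) ≃ₗ[F] (V × Z)}
    (hS : ∀ x y, prodForm B D (S x) (S y) = prodForm B C x y)
    (h₁ : IsUnit (1 - corner S)) (h₂ : IsUnit (1 - corner S.symm)) : Isom C D := by
  obtain ⟨⟨_, g, hg, hg'⟩, rfl⟩ := h₁
  obtain ⟨⟨_, k, hk, hk'⟩, rfl⟩ := h₂
  refine ⟨LinearEquiv.ofLinearMap (feedback S g) (feedback S.symm k) ?_ ?_, fun x x' => ?_⟩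
  · ext z
    obtain ⟨y, hy⟩ := exists_apply_eq_feedback hk z
    exact feedback_eq hg' ((LinearEquiv.symm_apply_eq _).mp hy).symm
  · ext x
    obtain ⟨y, hy⟩ := exists_apply_eq_feedback hg x
    exact feedback_eq hk' ((LinearEquiv.symm_apply_eq _).mpr hy.symm)
  · obtain ⟨y, hy⟩ := exists_apply_eq_feedback hg x
    obtain ⟨y', hy'⟩ := exists_apply_eq_feedback hg x'
    have := hS (y, x) (y', x')
    rw [hy, hy'] at this
    simpa using this

/-- An isometry of the first summand extends to an isometry of orthogonal sums. -/
lemma prodForm_prodCongr {B : V →ₛₗ[σ] V →ₗ[F] W} {B' : V' →ₛₗ[σ] V' →ₗ[F] W} (φ : V ≃ₗ[F] V')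
    (hφ : ∀ x y, B' (φ x) (φ y) = B x y) (C : X →ₛₗ[σ] X →ₗ[F] W) (x y : V × X) :
    prodForm B' C (φ.prodCongr (LinearEquiv.refl F X) x) (φ.prodCongr (LinearEquiv.refl F X) y) =
      prodForm B C x y := by
  simp [hφ]

/-- If the corners of an isometry compose to `β * α * (α * β)` with `1 - α * β` invertible, then
the corresponding summands cancel. -/
lemma isom_of_corner_comp [FiniteDimensional F V] {B : V →ₛₗ[σ] V →ₗ[F] W}
    {C : X →ₛₗ[σ] X →ₗ[F] W} {B' : V' →ₛₗ[σ] V' →ₗ[F] W} {D : Z →ₛₗ[σ] Z →ₗ[F] W}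
    (hB : IsIndec B) (hB' : IsIndec B') {S : (V × X) ≃ₗ[F] (V' × Z)}
    (hS : ∀ x y, prodForm B' D (S x) (S y) = prodForm B C x y) {α β : Module.End F V}
    (hα : IsSelfAdj B α) (hβ : IsSelfAdj B β) (hu : IsUnit (β * α * (α * β)))
    (h : corner S.symm ∘ₗ corner S = β * α * (α * β)) (h₁ : IsUnit (1 - α * β))
    (h₂ : IsUnit (1 - β * α)) : Isom B B' ∧ Isom C D := by
  have hadj : ∀ x y, B ((α * β) x) y = B x ((β * α) y) := fun x y => by
    rw [Module.End.mul_apply, hα, hβ, Module.End.mul_apply]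
  have hadj' : ∀ x y, B ((β * α) x) y = B x ((α * β) y) := fun x y => by
    rw [Module.End.mul_apply, hβ, hα, Module.End.mul_apply]
  obtain ⟨hu', hu⟩ : IsUnit (β * α) ∧ IsUnit (α * β) := by
    simp only [LinearMap.isUnit_iff_isUnit_det, IsUnit.mul_iff] at hu ⊢
    tauto
  obtain ⟨⟨x, y, hxy, hyx⟩, hx : x = _⟩ := hu
  obtain ⟨⟨x', y', hxy', hyx'⟩, hx' : x' = _⟩ := hu'
  rw [← hx, ← hx'] at hadj hadj' h
  rw [← hx] at h₁
  rw [← hx'] at h₂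
  have hxy1 : ∀ v, x (y v) = v := LinearMap.congr_fun hxy
  have hyx1 : ∀ v, y (x v) = v := LinearMap.congr_fun hyx
  have hxy1' : ∀ v, x' (y' v) = v := LinearMap.congr_fun hxy'
  have hyx1' : ∀ v, y' (x' v) = v := LinearMap.congr_fun hyx'
  have hh : ∀ v, corner S.symm (corner S v) = x' (x v) := LinearMap.congr_fun h
  have hyadj : ∀ v w, B (y v) w = B v (y' w) := fun v w => by
    conv_rhs => rw [← hxy1 v, hadj, hxy1']
  have hyadj' : ∀ v w, B (y' v) w = B v (y w) := fun v w => by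
    conv_rhs => rw [← hxy1' v, hadj', hxy1]
  set a := corner S
  set a' := corner S.symm
  have haadj : ∀ v w, B' (a v) w = B v (a' w) := corner_adjoint hS
  have haadj' : ∀ w v, B (a' w) v = B' w (a v) := corner_adjoint' hS
  have huu : ∀ v, y' (a' (a (y v))) = v := fun v => by rw [hh, hxy1, hyx1']
  have hidem : a ∘ₗ y ∘ₗ y' ∘ₗ a' = (1 : Module.End F V') := by
    refine (hB'.2 (a ∘ₗ y ∘ₗ y' ∘ₗ a') ?_ fun v w => ?_).resolve_left fun h0 => ?_
    · ext w
      simp only [Module.End.mul_apply, LinearMap.comp_apply]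
      rw [huu]
    · simp only [LinearMap.comp_apply]
      rw [haadj, hyadj, hyadj', haadj']
    · have := hB.1
      obtain ⟨v, hv⟩ := exists_ne (0 : V)
      apply hv
      have h := LinearMap.congr_fun h0 (a (y v))
      simp only [LinearMap.comp_apply, huu, LinearMap.zero_apply] at h
      rw [← huu v, h, map_zero, map_zero]
  let φ : V ≃ₗ[F] V' := LinearEquiv.ofLinearMap (a ∘ₗ y) (y' ∘ₗ a')
    (LinearMap.ext fun w => LinearMap.congr_fun hidem w) (LinearMap.ext huu)
  have hφ : ∀ v w, B' (φ v) (φ w) = B v w := fun v w => by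
    change B' (a (y v)) (a (y w)) = _
    rw [haadj, hyadj, huu]
  refine ⟨⟨φ, hφ⟩, ?_⟩
  let S' : (V × X) ≃ₗ[F] (V × Z) := S.trans (φ.symm.prodCongr (LinearEquiv.refl F Z))
  have hS' : ∀ v w, prodForm B D (S' v) (S' w) = prodForm B C v w := fun v w => by
    rw [← hS, ← prodForm_prodCongr φ hφ]
    simp [S']
  refine isom_of_isUnit_one_sub_corner hS' ?_ ?_
  · have e : corner S' = x := LinearMap.ext fun v => by
      change y' (a' (a v)) = x v
      rw [hh, hyx1']
    rwa [e]
  · have e : corner S'.symm = x' := LinearMap.ext fun v => by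
      change a' (a (y v)) = x' v
      rw [hh, hxy1]
    rwa [e]

section Split

variable {J : Type} [DecidableEq J] {Y : J → Type} [∀ j, AddCommGroup (Y j)] [∀ j, Module F (Y j)]

/-- Splitting off a component of a product, as a linear equivalence. -/
def piSplit (F : Type) [Field F] (Y : J → Type) [∀ j, AddCommGroup (Y j)]
    [∀ j, Module F (Y j)] (j : J) : (∀ j, Y j) ≃ₗ[F] (Y j × ∀ i : {i // i ≠ j}, Y i) where
  __ := Equiv.piSplitAt j Y
  map_add' _ _ := rfl
  map_smul' _ _ := rfl

lemma piSplit_apply (j : J) (y : ∀ j, Y j) : piSplit F Y j y =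
    (y j, fun i : {i // i ≠ j} => y i) := rfl

lemma piSplit_symm_apply (j : J) (y : Y j) : (piSplit F Y j).symm (y, 0) = Pi.single j y := by
  rw [LinearEquiv.symm_apply_eq, piSplit_apply, Pi.single_eq_same]
  exact Prod.ext rfl (funext fun i => (Pi.single_eq_of_ne i.2 y).symm)

end Split

section Pi

variable {J : Type} [Fintype J] {Y : J → Type} [∀ j, AddCommGroup (Y j)] [∀ j, Module F (Y j)]

/-- The orthogonal sum of a finite family of forms. -/
def piForm (D : ∀ j, Y j →ₛₗ[σ] Y j →ₗ[F] W) : (∀ j, Y j) →ₛₗ[σ] (∀ j, Y j) →ₗ[F] W :=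
  LinearMap.mk₂'ₛₗ σ (RingHom.id F) (fun x y => ∑ j, D j (x j) (y j))
    (fun x x' y => by simp [Finset.sum_add_distrib]) (fun c x y => by simp [Finset.smul_sum])
    (fun x y y' => by simp [Finset.sum_add_distrib]) (fun c x y => by simp [Finset.smul_sum])

lemma piForm_apply (D : ∀ j, Y j →ₛₗ[σ] Y j →ₗ[F] W) (x y : ∀ j, Y j) :
    piForm D x y = ∑ j, D j (x j) (y j) := rfl

variable [DecidableEq J]

lemma prodForm_piSplit (D : ∀ j, Y j →ₛₗ[σ] Y j →ₗ[F] W) (j : J) (x y : ∀ j, Y j) :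
    prodForm (D j) (piForm fun i : {i // i ≠ j} => D i) (piSplit F Y j x) (piSplit F Y j y) =
      piForm D x y := by
  rw [piForm_apply, Fintype.sum_eq_add_sum_subtype_ne _ j]
  rfl

/-- An indecomposable summand can be exchanged with, and cancelled against, a summand of any
other decomposition. -/
theorem exists_isom_and_isom [IsAlgClosed F] (h2 : (2 : F) ≠ 0) (hσ : Function.Involutive σ)
    [FiniteDimensional F V] {B : V →ₛₗ[σ] V →ₗ[F] W} {C : X →ₛₗ[σ] X →ₗ[F] W}
    {D : ∀ j, Y j →ₛₗ[σ] Y j →ₗ[F] W} (hB : IsIndec B) (hD : ∀ j, IsIndec (D j))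
    (h : Isom (prodForm B C) (piForm D)) :
    ∃ j, Isom B (D j) ∧ Isom C (piForm fun i : {i // i ≠ j} => D i) := by
  obtain ⟨S, hS⟩ := h
  have := hB.1
  let T (j : J) := S.trans (piSplit F Y j)
  have hT (j x y) : prodForm (D j) (piForm fun i : {i // i ≠ j} => D i) (T j x) (T j y) =
      prodForm B C x y := by
    rw [← hS, ← prodForm_piSplit D j]; rfl
  obtain ⟨j, -, α, hα, β, hβ, hu, he, h₁, h₂⟩ :=
    hB.isLocalSymmetric.exists_eq_mul_of_sum_eq_one h2 hσ Finset.univ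
      (fun j => (corner (T j).symm ∘ₗ corner (T j) : Module.End F V))
      (fun j _ x y => by
        simp only [LinearMap.comp_apply]
        rw [corner_adjoint' (hT j), corner_adjoint (hT j)])
      (by
        ext v
        have e (j : J) : (corner (T j).symm ∘ₗ corner (T j)) v =
            (S.symm (Pi.single j (S (v, 0) j))).1 := by
          rw [← piSplit_symm_apply (F := F)]; rfl
        rw [LinearMap.sum_apply]
        simp only [e]
        rw [← Prod.fst_sum, ← map_sum, Finset.univ_sum_single, S.symm_apply_apply]
        rfl)
  exact ⟨j, isom_of_corner_comp hB (hD j) (hT j) hα hβ (he ▸ hu) he h₁ h₂⟩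

end Pi

/-- Decompositions into orthogonal sums of indecomposable forms are unique. -/
theorem exists_equiv_of_isom_piForm [IsAlgClosed F] (h2 : (2 : F) ≠ 0)
    (hσ : Function.Involutive σ) {k : ℕ} {U : Fin k → Type} [∀ j, AddCommGroup (U j)]
    [∀ j, Module F (U j)] [∀ j, FiniteDimensional F (U j)] {J : Type} [Fintype J]
    {Y : J → Type} [∀ j, AddCommGroup (Y j)] [∀ j, Module F (Y j)]
    {B : ∀ j, U j →ₛₗ[σ] U j →ₗ[F] W} {D : ∀ j, Y j →ₛₗ[σ] Y j →ₗ[F] W}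
    (hB : ∀ j, IsIndec (B j)) (hD : ∀ j, IsIndec (D j)) (h : Isom (piForm B) (piForm D)) :
    ∃ π : Fin k ≃ J, ∀ j, Isom (B j) (D (π j)) := by
  classical
  induction k generalizing J with
  | zero =>
    obtain ⟨φ, -⟩ := h
    have : IsEmpty J := ⟨fun j => by
      have := (hD j).1
      obtain ⟨y, hy⟩ := exists_ne (0 : Y j)
      have h : Pi.single j y = (0 : ∀ j, Y j) := φ.symm.injective (Subsingleton.elim _ _)
      exact hy (by simpa using congrFun h j)⟩
    exact ⟨Equiv.equivOfIsEmpty _ _, fun j => j.elim0⟩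
  | succ k ih =>
    have h' : Isom (prodForm (B 0) (piForm fun i : Fin k => B i.succ)) (piForm B) :=
      ⟨Fin.consLinearEquiv F U, fun x y => by simp [piForm_apply, Fin.sum_univ_succ]⟩
    obtain ⟨j, h₀, h₁⟩ := exists_isom_and_isom h2 hσ (hB 0) hD (h'.trans h)
    obtain ⟨π, hπ⟩ := ih (fun i => hB i.succ) (fun i : {i // i ≠ j} => hD i) h₁
    have of_eq : ∀ (i : Fin (k + 1)) (j j' : J), j = j' → Isom (B i) (D j) → Isom (B i) (D j') := by
      rintro i j _ rfl h; exact h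
    refine ⟨(finSuccEquiv k).trans ((Equiv.optionCongr π).trans (Equiv.optionSubtypeNe j)),
      Fin.cases (of_eq 0 j _ (by simp) h₀) fun i => of_eq i.succ _ _ (by simp) (hπ i)⟩

lemma Isom.prodForm {B : V →ₛₗ[σ] V →ₗ[F] W} {B' : V' →ₛₗ[σ] V' →ₗ[F] W}
    {C : X →ₛₗ[σ] X →ₗ[F] W} {D : Z →ₛₗ[σ] Z →ₗ[F] W} (h : Isom B B') (h' : Isom C D) :
    Isom (prodForm B C) (prodForm B' D) := by
  obtain ⟨φ, hφ⟩ := h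
  obtain ⟨ψ, hψ⟩ := h'
  exact ⟨φ.prodCongr ψ, fun x y => by simp [hφ, hψ]⟩

/-- The restriction of a form to a subspace. -/
def restrictForm (B : V →ₛₗ[σ] V →ₗ[F] W) (P : Submodule F V) : P →ₛₗ[σ] P →ₗ[F] W :=
  LinearMap.mk₂'ₛₗ σ (RingHom.id F) (fun x y => B x y) (fun x x' y => by simp)
    (fun c x y => by simp) (fun x y y' => by simp) (fun c x y => by simp)

lemma isom_prodForm_restrictForm {B : V →ₛₗ[σ] V →ₗ[F] W} {P Q : Submodule F V}
    (hPQ : IsCompl P Q) (h : ∀ x ∈ P, ∀ y ∈ Q, B x y = 0) (h' : ∀ x ∈ P, ∀ y ∈ Q, B y x = 0) :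
    Isom (prodForm (restrictForm B P) (restrictForm B Q)) B :=
  ⟨Submodule.prodEquivOfIsCompl P Q hPQ, fun x y => by
    simp [restrictForm, h x.1 x.1.2 y.2 y.2.2, h' y.1 y.1.2 x.2 x.2.2]⟩

section Matrices

variable {t : ℕ} {I I' : Type} [Fintype I'] [Fintype I]

/-- The vector-valued form given by a tuple of matrices. -/
def matrixForm (σ : F →+* F) (T : Fin t → Matrix I I F) :
    (I → F) →ₛₗ[σ] (I → F) →ₗ[F] (Fin t → F) :=
  LinearMap.mk₂'ₛₗ σ (RingHom.id F) (fun x y k => (σ ∘ x) ⬝ᵥ (T k *ᵥ y))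
    (fun x x' y => by
      ext k; simp only [dotProduct, Function.comp_apply, Pi.add_apply, map_add, add_mul,
        Finset.sum_add_distrib])
    (fun c x y => by
      ext k; simp only [dotProduct, Function.comp_apply, Pi.smul_apply, smul_eq_mul, map_mul,
        mul_assoc, Finset.mul_sum])
    (fun x y y' => by ext k; simp [mulVec_add])
    (fun c x y => by ext k; simp [mulVec_smul])

lemma matrixForm_apply (T : Fin t → Matrix I I F) (x y : I → F) (k : Fin t) :
    matrixForm σ T x y k = (σ ∘ x) ⬝ᵥ (T k *ᵥ y) := rfl

lemma matrixForm_mulVec (T : Fin t → Matrix I I F) (S : Matrix I I' F) (x y : I' → F) :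
    matrixForm σ T (S *ᵥ x) (S *ᵥ y) =
      matrixForm σ (fun k => (S.map σ)ᵀ * T k * S) x y := by
  ext k
  have : σ ∘ (S *ᵥ x) = (S.map σ) *ᵥ (σ ∘ x) := funext fun i => RingHom.map_mulVec σ S x i
  rw [matrixForm_apply, matrixForm_apply, this, ← mulVec_mulVec, ← mulVec_mulVec,
    dotProduct_mulVec _ (S.map σ)ᵀ, vecMul_transpose]

lemma isom_matrixForm_fromBlocks (T : Fin t → Matrix I I F) (T' : Fin t → Matrix I' I' F) :
    Isom (matrixForm σ fun k => Matrix.fromBlocks (T k) 0 0 (T' k))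
      (prodForm (matrixForm σ T) (matrixForm σ T')) := by
  refine ⟨LinearEquiv.sumArrowLequivProdArrow I I' F F, fun x y => ?_⟩
  ext k
  simp [matrixForm_apply, dotProduct, fromBlocks_mulVec]
  rfl

variable [DecidableEq I] [DecidableEq I']

lemma matrixForm_single (T : Fin t → Matrix I I F) (a b : I) (k : Fin t) :
    matrixForm σ T (Pi.single a 1) (Pi.single b 1) k = T k a b := by
  have : σ ∘ Pi.single a 1 = Pi.single a 1 := by
    ext i; by_cases hi : i = a <;> simp [hi]
  rw [matrixForm_apply, this]
  simp

lemma eq_of_matrixForm_eq {T T' : Fin t → Matrix I I F}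
    (h : ∀ x y, matrixForm σ T x y = matrixForm σ T' x y) : T = T' := by
  funext k
  ext a b
  rw [← matrixForm_single (σ := σ) T, h, matrixForm_single]

lemma exists_matrixForm_eq (B : (I → F) →ₛₗ[σ] (I → F) →ₗ[F] (Fin t → F)) :
    ∃ T : Fin t → Matrix I I F, ∀ x y, matrixForm σ T x y = B x y := by
  refine ⟨fun k => Matrix.of fun a b => B (Pi.single a 1) (Pi.single b 1) k, fun x y => ?_⟩
  ext k
  conv_rhs => rw [← Finset.univ_sum_single x, ← Finset.univ_sum_single y]
  have hs (z : I → F) (a : I) : Pi.single a (z a) = z a • (Pi.single a 1 : I → F) := by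
    rw [← Pi.single_smul, smul_eq_mul, mul_one]
  simp only [hs, map_sum, LinearMap.sum_apply, LinearMap.map_smulₛₗ, LinearMap.smul_apply,
    Finset.sum_apply, Pi.smul_apply, smul_eq_mul, RingHom.id_apply, matrixForm_apply, dotProduct,
    mulVec, Function.comp_apply, Finset.mul_sum, Matrix.of_apply]
  rw [Finset.sum_comm]
  refine Finset.sum_congr rfl fun a _ => Finset.sum_congr rfl fun b _ => ?_
  ring

lemma starCongTup_iff_isom {T : Fin t → Matrix I I F} {T' : Fin t → Matrix I' I' F} :
    StarCongTup σ T T' ↔ Isom (matrixForm σ T') (matrixForm σ T) := by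
  constructor
  · rintro ⟨S, S', h₁, h₂, h⟩
    refine ⟨LinearEquiv.ofLinearMap S.mulVecLin S'.mulVecLin ?_ ?_, fun x y => ?_⟩
    · rw [← mulVecLin_mul, h₁, mulVecLin_one]
    · rw [← mulVecLin_mul, h₂, mulVecLin_one]
    · rw [← funext h]
      exact matrixForm_mulVec T S x y
  · rintro ⟨φ, hφ⟩
    refine ⟨LinearMap.toMatrix' (φ : (I' → F) →ₗ[F] I → F),
      LinearMap.toMatrix' (φ.symm : (I → F) →ₗ[F] I' → F), ?_, ?_, congrFun (g := T') ?_⟩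
    · rw [← LinearMap.toMatrix'_comp]; simp
    · rw [← LinearMap.toMatrix'_comp]; simp
    · refine eq_of_matrixForm_eq (σ := σ) fun x y => ?_
      rw [← matrixForm_mulVec, ← hφ, LinearMap.toMatrix'_mulVec, LinearMap.toMatrix'_mulVec]
      rfl

lemma exists_isom_matrixForm [FiniteDimensional F V] (B : V →ₛₗ[σ] V →ₗ[F] (Fin t → F)) :
    ∃ T : Fin t → Matrix (Fin (Module.finrank F V)) (Fin (Module.finrank F V)) F,
      Isom (matrixForm σ T) B := by
  let φ : V ≃ₗ[F] (Fin (Module.finrank F V) → F) := (Module.finBasis F V).equivFun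
  obtain ⟨T, hT⟩ := exists_matrixForm_eq (LinearMap.mk₂'ₛₗ σ (RingHom.id F)
    (fun x y => B (φ.symm x) (φ.symm y)) (fun x x' y => by simp) (fun c x y => by simp)
    (fun x y y' => by simp) (fun c x y => by simp))
  exact ⟨T, φ.symm, fun x y => (hT x y).symm⟩

lemma isom_matrixForm_blockDiagonal' {J : Type} [Fintype J] [DecidableEq J] {I : J → Type}
    [∀ j, Fintype (I j)] [∀ j, DecidableEq (I j)] (T : ∀ j, Fin t → Matrix (I j) (I j) F) :
    Isom (matrixForm σ fun k => Matrix.blockDiagonal' fun j => T j k)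
      (piForm fun j => matrixForm σ (T j)) := by
  refine ⟨LinearEquiv.piCurry F fun _ _ => F, fun x y => ?_⟩
  ext k
  rw [piForm_apply, Finset.sum_apply, matrixForm_apply, dotProduct, Fintype.sum_sigma]
  refine Finset.sum_congr rfl fun j _ => Finset.sum_congr rfl fun a _ => ?_
  congr 1
  rw [mulVec, mulVec, dotProduct, dotProduct, Fintype.sum_sigma, Finset.sum_eq_single j]
  · simp [blockDiagonal'_apply_eq]
    rfl
  · intro j' _ hj'
    simp [blockDiagonal'_apply_ne _ _ _ hj'.symm]
  · simp

lemma IndecompStar.isIndec {T : Fin t → Matrix I I F} (hT : IndecompStar σ T) :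
    IsIndec (matrixForm σ T) := by
  have : Nonempty I := Fintype.card_pos_iff.mp hT.1
  refine ⟨inferInstance, fun e he hadj => ?_⟩
  by_contra! hne
  have he' : ∀ x, e (e x) = e x := LinearMap.congr_fun he
  have hc : IsCompl (LinearMap.range e) (LinearMap.ker e) :=
    LinearMap.IsIdempotentElem.isCompl he
  have h := isom_prodForm_restrictForm (B := matrixForm σ T) hc
    (by
      rintro _ ⟨x, rfl⟩ y hy
      rw [hadj, LinearMap.mem_ker.mp hy, map_zero])
    (by
      rintro _ ⟨x, rfl⟩ y hy
      rw [← hadj, LinearMap.mem_ker.mp hy, map_zero, LinearMap.zero_apply])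
  obtain ⟨T₁, h₁⟩ := exists_isom_matrixForm (restrictForm (matrixForm σ T) (LinearMap.range e))
  obtain ⟨T₂, h₂⟩ := exists_isom_matrixForm (restrictForm (matrixForm σ T) (LinearMap.ker e))
  refine hT.2 ⟨_, _, T₁, T₂, ?_, ?_,
    starCongTup_iff_isom.mpr ((isom_matrixForm_fromBlocks T₁ T₂).trans ((h₁.prodForm h₂).trans h))⟩
  · rw [Nat.pos_iff_ne_zero, Ne, Submodule.finrank_eq_zero, LinearMap.range_eq_bot]
    exact hne.1
  · rw [Nat.pos_iff_ne_zero, Ne, Submodule.finrank_eq_zero, LinearMap.ker_eq_bot]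
    intro hinj
    exact hne.2 (LinearMap.ext fun x => hinj (he' x))

/-- Every tuple of matrices decomposes into indecomposable tuples. -/
theorem exists_isom_piForm {n : ℕ} (T : Fin t → Matrix (Fin n) (Fin n) F) :
    ∃ (J : Type) (_ : Fintype J) (ns : J → ℕ)
      (Ts : ∀ j, Fin t → Matrix (Fin (ns j)) (Fin (ns j)) F),
      (∀ j, IndecompStar σ (Ts j)) ∧
        Isom (piForm fun j => matrixForm σ (Ts j)) (matrixForm σ T) := by
  induction n using Nat.strong_induction_on with
  | _ n ih =>
  rcases Nat.eq_zero_or_pos n with rfl | hn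
  · refine ⟨Empty, inferInstance, fun _ => 0, fun j => j.elim, fun j => j.elim,
      0, fun x y => ?_⟩
    rw [Subsingleton.elim x 0, map_zero, map_zero, map_zero, LinearMap.zero_apply,
      LinearMap.zero_apply]
  by_cases hT : IndecompStar σ T
  · refine ⟨Unit, inferInstance, fun _ => n, fun _ => T, fun _ => hT,
      LinearEquiv.funUnique Unit F (Fin n → F), fun x y => ?_⟩
    simp [piForm_apply]
  · simp only [IndecompStar, Fintype.card_fin, hn, true_and, not_not] at hT
    obtain ⟨p, q, T₁, T₂, hp, hq, h⟩ := hT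
    replace h := (starCongTup_iff_isom.mp h).symm.trans (isom_matrixForm_fromBlocks T₁ T₂)
    have hpq : n = p + q := by
      obtain ⟨φ, -⟩ := h
      simpa using φ.finrank_eq
    obtain ⟨J₁, _, ns₁, Ts₁, hi₁, h₁⟩ := ih p (by omega) T₁
    obtain ⟨J₂, _, ns₂, Ts₂, hi₂, h₂⟩ := ih q (by omega) T₂
    refine ⟨J₁ ⊕ J₂, inferInstance, Sum.elim ns₁ ns₂, Sum.rec Ts₁ Ts₂, Sum.rec hi₁ hi₂, ?_⟩
    refine Isom.trans ⟨LinearEquiv.sumPiEquivProdPi F J₁ J₂ _, fun x y => ?_⟩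
      ((h₁.prodForm h₂).trans h.symm)
    exact (Fintype.sum_sum_type fun j => matrixForm σ (Sum.rec Ts₁ Ts₂ j : Fin t →
      Matrix (Fin (Sum.elim ns₁ ns₂ j)) (Fin (Sum.elim ns₁ ns₂ j)) F) (x j) (y j)).symm

end Matrices

end Forms

end StarCongruence

/-- Lemma 2(b): over an algebraically closed field of characteristic ≠ 2 with an involution,
every tuple of n×n matrices is *congruent to a direct sum of tuples indecomposable with
respect to *congruence, and this sum is unique up to permutation of summands and replacement
of summands by *congruent tuples. -/
theorem stmt3 [IsAlgClosed F] (hchar : ringChar F ≠ 2)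
    (σ : F →+* F) (hσ : Function.Involutive σ)
    {t n : ℕ} (T : Fin t → Matrix (Fin n) (Fin n) F) :
    (∃ (k : ℕ) (ns : Fin k → ℕ)
        (Ts : ∀ j : Fin k, Fin t → Matrix (Fin (ns j)) (Fin (ns j)) F),
        (∀ j, IndecompStar σ (Ts j)) ∧
        StarCongTup σ T (fun i => Matrix.blockDiagonal' (fun j => Ts j i))) ∧
    (∀ (k₁ : ℕ) (ns₁ : Fin k₁ → ℕ)
        (Ts₁ : ∀ j : Fin k₁, Fin t → Matrix (Fin (ns₁ j)) (Fin (ns₁ j)) F)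
        (k₂ : ℕ) (ns₂ : Fin k₂ → ℕ)
        (Ts₂ : ∀ j : Fin k₂, Fin t → Matrix (Fin (ns₂ j)) (Fin (ns₂ j)) F),
        (∀ j, IndecompStar σ (Ts₁ j)) →
        StarCongTup σ T (fun i => Matrix.blockDiagonal' (fun j => Ts₁ j i)) →
        (∀ j, IndecompStar σ (Ts₂ j)) →
        StarCongTup σ T (fun i => Matrix.blockDiagonal' (fun j => Ts₂ j i)) →
        ∃ π : Fin k₁ ≃ Fin k₂, ∀ j, StarCongTup σ (Ts₁ j) (Ts₂ (π j))) := by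
  open StarCongruence in
  refine ⟨?_, fun k₁ ns₁ Ts₁ k₂ ns₂ Ts₂ hi₁ h₁ hi₂ h₂ => ?_⟩
  · obtain ⟨J, _, ns, Ts, hi, h⟩ := exists_isom_piForm (σ := σ) T
    let e := (Fintype.equivFin J).symm
    refine ⟨_, fun j => ns (e j), fun j => Ts (e j), fun j => hi (e j), ?_⟩
    refine starCongTup_iff_isom.mpr ((isom_matrixForm_blockDiagonal' _).trans (Isom.trans ?_ h))
    refine ⟨LinearEquiv.piCongrLeft F (fun j => Fin (ns j) → F) e, fun x y => ?_⟩
    rw [piForm_apply, piForm_apply, ← e.sum_comp]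
    refine Finset.sum_congr rfl fun j _ => ?_
    have h (z : ∀ j, Fin (ns (e j)) → F) :
        LinearEquiv.piCongrLeft F (fun j => Fin (ns j) → F) e z (e j) = z j :=
      Equiv.piCongrLeft_apply_apply (fun j => Fin (ns j) → F) e z j
    rw [h, h]
  · have h : Isom (piForm fun j => matrixForm σ (Ts₁ j)) (piForm fun j => matrixForm σ (Ts₂ j)) :=
      (((isom_matrixForm_blockDiagonal' Ts₁).symm.trans (starCongTup_iff_isom.mp h₁)).trans
        (starCongTup_iff_isom.mp h₂).symm).trans (isom_matrixForm_blockDiagonal' Ts₂)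
    obtain ⟨π, hπ⟩ := exists_equiv_of_isom_piForm (Ring.two_ne_zero hchar) hσ
      (fun j => (hi₁ j).isIndec) (fun j => (hi₂ j).isIndec) h
    exact ⟨π, fun j => starCongTup_iff_isom.mpr (hπ j).symm⟩
end

section
/- Let F be a field, n a natural number, and D any 4n×4n matrix over F. Every direct summand for equivalence of the triple G = (I_{4n}, J_4(0_n), D) is equivalent to a triple of the form (I_{4p}, J_4(0_p), M') for some p ≤ n and some 4p×4p matrix M'. -/
open Matrix

variable {F : Type} [Field F]

open scoped Kronecker in
theorem J4_eq_kronecker (n : ℕ) :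
    J4 F n = (!![0, 1, 0, 0; 0, 0, 1, 0; 0, 0, 0, 1; 0, 0, 0, 0] : Matrix (Fin 4) (Fin 4) F) ⊗ₖ
      (1 : Matrix (Fin n) (Fin n) F) := by
  ext ⟨i, k⟩ ⟨j, l⟩
  fin_cases i <;> fin_cases j <;> simp [J4, Matrix.one_apply]

open scoped Kronecker in
theorem J4_pow_four (n : ℕ) : J4 F n ^ 4 = 0 := by
  rw [J4_eq_kronecker]
  simp only [pow_succ, pow_zero, one_mul, ← Matrix.mul_kronecker_mul, mul_one]
  rw [← Matrix.zero_kronecker (1 : Matrix (Fin n) (Fin n) F)]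
  congr 1
  ext i j
  fin_cases i <;> fin_cases j <;> simp [Matrix.mul_apply, Fin.sum_univ_succ]

open scoped Kronecker in
/-- The projections onto the kernel and onto the last three block coordinates sum to `1`. -/
theorem J4_pow_three_mul_add_transpose_mul (n : ℕ) :
    J4 F n ^ 3 * (J4 F n)ᵀ ^ 3 + (J4 F n)ᵀ * J4 F n = 1 := by
  rw [J4_eq_kronecker, ← Matrix.kroneckerMap_transpose]
  simp only [pow_succ, pow_zero, one_mul, ← Matrix.mul_kronecker_mul, mul_one,
    Matrix.transpose_one, ← Matrix.add_kronecker]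
  rw [← Matrix.one_kronecker_one (m := Fin 4) (n := Fin n)]
  congr 1
  ext i j
  fin_cases i <;> fin_cases j <;> simp [Matrix.mul_apply, Matrix.vecMul, dotProduct, Fin.sum_univ_succ]

/-- An endomorphism `f` with `f ^ 4 = 0` and `ker f ≤ range (f ^ 3)` has a Jordan basis all of
whose blocks have size four. -/
theorem exists_basis_toMatrix_eq_J4 {V : Type} [AddCommGroup V] [Module F V]
    [FiniteDimensional F V] (f : Module.End F V) (hf : f ^ 4 = 0)
    (hker : ∀ x, f x = 0 → ∃ y, (f ^ 3) y = x) :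
    ∃ (p : ℕ) (b : Module.Basis (Fin 4 × Fin p) F V), LinearMap.toMatrix b b f = J4 F p := by
  let u := Module.finBasis F (LinearMap.ker f)
  set p := Module.finrank F (LinearMap.ker f)
  choose v hv using fun j => hker (u j : V) (u j).2
  let w : Fin 4 × Fin p → V := fun q => (f ^ (3 - (q.1 : ℕ))) (v q.2)
  have hw0 : ∀ j, w (0, j) = u j := fun j => hv j
  have hfw0 : ∀ j, f (w (0, j)) = 0 := fun j => by rw [hw0]; exact (u j).2
  have hfw : ∀ (i : Fin 3) j, f (w (i.succ, j)) = w (i.castSucc, j) := fun i j => by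
    fin_cases i <;> simp [w, pow_succ]
  have hind : LinearIndependent F w := by
    rw [Fintype.linearIndependent_iff]
    intro c hc
    have key : ∀ d : Fin p → F, ∑ j, d j • w (0, j) = 0 → d = 0 := fun d hd => by
      have := Fintype.linearIndependent_iff.1 u.linearIndependent d
        (Subtype.ext (by simpa [hw0] using hd))
      exact funext this
    have w1 : ∀ j, f (w (1, j)) = w (0, j) := hfw 0
    have w2 : ∀ j, f (w (2, j)) = w (1, j) := hfw 1
    have w3 : ∀ j, f (w (3, j)) = w (2, j) := hfw 2
    rw [Fintype.sum_prod_type, Fin.sum_univ_four] at hc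
    have h3 := key (fun j => c (3, j)) (by
      simpa [hfw0, w1, w2, w3] using congrArg (fun x => f (f (f x))) hc)
    simp only [funext_iff, Pi.zero_apply] at h3
    have h2 := key (fun j => c (2, j)) (by
      simpa [hfw0, w1, w2, h3] using congrArg (fun x => f (f x)) hc)
    simp only [funext_iff, Pi.zero_apply] at h2
    have h1 := key (fun j => c (1, j)) (by
      simpa [hfw0, w1, h2, h3] using congrArg (fun x => f x) hc)
    simp only [funext_iff, Pi.zero_apply] at h1
    have h0 := key (fun j => c (0, j)) (by simpa [h1, h2, h3] using hc)
    simp only [funext_iff, Pi.zero_apply] at h0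
    rintro ⟨i, j⟩
    fin_cases i
    exacts [h0 j, h1 j, h2 j, h3 j]
  have hspan : ∀ k ≤ 4, ∀ x, (f ^ k) x = 0 → x ∈ Submodule.span F (Set.range w) := by
    intro k
    induction k with
    | zero => intro _ x hx; simp_all
    | succ k ih =>
      intro hk x hx
      have hx' : (f ^ k) x ∈ LinearMap.ker f := by
        rw [LinearMap.mem_ker, ← Module.End.mul_apply, ← pow_succ']; exact hx
      let y := ∑ j, u.repr ⟨_, hx'⟩ j • w (⟨k, by omega⟩, j)
      have hy : (f ^ k) y = (f ^ k) x := by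
        have h := congrArg Subtype.val (u.sum_repr ⟨_, hx'⟩)
        simp only [Submodule.coe_sum, Submodule.coe_smul] at h
        rw [← h]
        simp only [y, map_sum, map_smul]
        refine Finset.sum_congr rfl fun j _ => ?_
        rw [← hv j, ← Module.End.mul_apply, ← pow_add]
        congr 3
        simp only
        omega
      have hmem : y ∈ Submodule.span F (Set.range w) :=
        Submodule.sum_mem _ fun j _ => Submodule.smul_mem _ _ (Submodule.subset_span ⟨_, rfl⟩)
      have := Submodule.add_mem _ (ih (by omega) (x - y) (by rw [map_sub, hy, sub_self])) hmem
      simpa using this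
  let b := Module.Basis.mk hind fun x _ => hspan 4 le_rfl x (by simp [hf])
  refine ⟨p, b, ?_⟩
  ext ⟨i, k⟩ ⟨j, l⟩
  have hb : ∀ q, w q = b q := fun q => (Module.Basis.mk_apply _ _ q).symm
  rw [LinearMap.toMatrix_apply, ← hb]
  refine Fin.cases ?_ (fun j => ?_) j
  · simp [hfw0, J4]
  · rw [hfw, hb, b.repr_self, Finsupp.single_apply]
    simp only [J4, Prod.mk.injEq, Fin.ext_iff, Fin.val_succ, Fin.val_castSucc]
    congr 1
    apply propext
    constructor <;> rintro ⟨h₁, h₂⟩ <;> constructor <;> omega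

theorem exists_conj_eq_J4 {I : Type} [Fintype I] [DecidableEq I] (X Y Z : Matrix I I F)
    (hX : X ^ 4 = 0) (hXY : X ^ 3 * Y + Z * X = 1) :
    ∃ (p : ℕ) (P : Matrix I (Fin 4 × Fin p) F) (Q : Matrix (Fin 4 × Fin p) I F),
      P * Q = 1 ∧ Q * P = 1 ∧ Q * X * P = J4 F p := by
  obtain ⟨p, b, hb⟩ := exists_basis_toMatrix_eq_J4 (Matrix.toLin' X)
    (by rw [← Matrix.toLin'_pow, hX, map_zero]) (fun x hx => ⟨Y *ᵥ x, by
      rw [Matrix.toLin'_apply] at hx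
      have h := congrArg (fun M => M *ᵥ x) hXY
      simp only [Matrix.add_mulVec, ← Matrix.mulVec_mulVec, hx, Matrix.mulVec_zero, add_zero,
        Matrix.one_mulVec] at h
      rwa [← Matrix.toLin'_pow, Matrix.toLin'_apply]⟩)
  refine ⟨p, (Pi.basisFun F I).toMatrix b, b.toMatrix (Pi.basisFun F I),
    Module.Basis.toMatrix_mul_toMatrix_flip _ _, Module.Basis.toMatrix_mul_toMatrix_flip _ _, ?_⟩
  rw [← hb, ← basis_toMatrix_mul_linearMap_toMatrix_mul_basis_toMatrix
    (b' := Pi.basisFun F I) (c' := Pi.basisFun F I), LinearMap.toMatrix_eq_toMatrix',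
    LinearMap.toMatrix'_toLin']

/-- Lemma 3(a): every direct summand for equivalence of the triple
`G = (I_{4n}, J₄(0ₙ), D)` is equivalent to a triple `(I_{4p}, J₄(0_p), M')`. -/
theorem stmt4 (n : ℕ) (D : Matrix (Fin 4 × Fin n) (Fin 4 × Fin n) F)
    (a b : ℕ) (T1 : Fin 3 → Matrix (Fin a) (Fin b) F)
    (hsize : 0 < a + b)
    (hsummand : ∃ (p' q' : ℕ) (T2 : Fin 3 → Matrix (Fin p') (Fin q') F),
      TupEquiv (![1, J4 F n, D])
        (fun k => Matrix.fromBlocks (T1 k) 0 0 (T2 k))) :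
    ∃ p : ℕ, p ≤ n ∧ ∃ M' : Matrix (Fin 4 × Fin p) (Fin 4 × Fin p) F,
      TupEquiv T1 (![1, J4 F p, M']) := by
  obtain ⟨p', q', T2, R, R', S, S', hR, hR', hS, hS', h⟩ := hsummand
  have h0 : R * S = fromBlocks (T1 0) 0 0 (T2 0) := by simpa using h 0
  have h1 : R * J4 F n * S = fromBlocks (T1 1) 0 0 (T2 1) := h 1
  obtain ⟨E, E₁₂, E₂₁, E₂₂, hE⟩ : ∃ E E₁₂ E₂₁ E₂₂, S' * R' = fromBlocks E E₁₂ E₂₁ E₂₂ :=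
    ⟨_, _, _, _, (fromBlocks_toBlocks _).symm⟩
  have hleft : S' * R' * (R * S) = 1 := by
    rw [Matrix.mul_assoc, ← Matrix.mul_assoc R', hR', Matrix.one_mul, hS']
  have hright : R * S * (S' * R') = 1 := by
    rw [Matrix.mul_assoc, ← Matrix.mul_assoc S, hS, Matrix.one_mul, hR]
  rw [h0, hE, fromBlocks_multiply, ← fromBlocks_one, fromBlocks_inj] at hleft hright
  simp only [Matrix.mul_zero, Matrix.zero_mul, add_zero, zero_add] at hleft hright
  obtain ⟨hEA, -, -, hEB⟩ := hleft
  obtain ⟨hAE, hAE₁₂, hBE₂₁, -⟩ := hright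
  have hE₁₂ : E₁₂ = 0 := by
    rw [← Matrix.one_mul E₁₂, ← hEA, Matrix.mul_assoc, hAE₁₂, Matrix.mul_zero]
  have hE₂₁ : E₂₁ = 0 := by
    rw [← Matrix.one_mul E₂₁, ← hEB, Matrix.mul_assoc, hBE₂₁, Matrix.mul_zero]
  have hconj : R * J4 F n * R' = fromBlocks (T1 1 * E) 0 0 (T2 1 * E₂₂) := by
    have : R * J4 F n * R' = R * J4 F n * S * (S' * R') := by
      rw [Matrix.mul_assoc (R * J4 F n) S, ← Matrix.mul_assoc S, hS, Matrix.one_mul]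
    rw [this, h1, hE, hE₁₂, hE₂₁, fromBlocks_multiply]
    simp
  have hmul : ∀ M N : Matrix (Fin 4 × Fin n) (Fin 4 × Fin n) F,
      R * (M * N) * R' = R * M * R' * (R * N * R') := fun M N => by
    simp only [Matrix.mul_assoc]
    rw [← Matrix.mul_assoc R' R, hR', Matrix.one_mul]
  have hpow : ∀ k : ℕ, R * J4 F n ^ k * R' =
      fromBlocks ((T1 1 * E) ^ k) 0 0 ((T2 1 * E₂₂) ^ k) := by
    intro k
    rw [← fromBlocks_diagonal_pow, ← hconj]
    induction k with
    | zero => simp [hR]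
    | succ k ih => rw [pow_succ, hmul, ih, pow_succ]
  have hX : (T1 1 * E) ^ 4 = 0 := by
    have h4 := hpow 4
    rw [J4_pow_four, Matrix.mul_zero, Matrix.zero_mul, ← fromBlocks_zero, fromBlocks_inj] at h4
    exact h4.1.symm
  have hXY : ∃ Y Z, (T1 1 * E) ^ 3 * Y + Z * (T1 1 * E) = 1 := by
    have hsum : R * J4 F n ^ 3 * R' * (R * (J4 F n)ᵀ ^ 3 * R') +
        R * (J4 F n)ᵀ * R' * (R * J4 F n * R') = 1 := by
      rw [← hmul, ← hmul, ← Matrix.add_mul, ← Matrix.mul_add,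
        J4_pow_three_mul_add_transpose_mul, Matrix.mul_one, hR]
    rw [hpow, hconj, ← fromBlocks_toBlocks (R * (J4 F n)ᵀ ^ 3 * R'),
      ← fromBlocks_toBlocks (R * (J4 F n)ᵀ * R'), fromBlocks_multiply, fromBlocks_multiply,
      fromBlocks_add, ← fromBlocks_one, fromBlocks_inj] at hsum
    simp only [Matrix.mul_zero, Matrix.zero_mul, add_zero] at hsum
    exact ⟨_, _, hsum.1⟩
  obtain ⟨Y, Z, hXY⟩ := hXY
  obtain ⟨p, P, Q, hPQ, hQP, hJ⟩ := exists_conj_eq_J4 _ Y Z hX hXY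
  have hap : a = 4 * p := by
    simpa using Matrix.square_of_invertible P Q hPQ hQP
  have han : a + p' = 4 * n := by
    simpa using Matrix.square_of_invertible R R' hR hR'
  refine ⟨p, by omega, Q * T1 2 * (E * P), Q, P, E * P, Q * T1 0, hQP, hPQ, ?_, ?_, ?_⟩
  · rw [Matrix.mul_assoc, ← Matrix.mul_assoc P, hPQ, Matrix.one_mul, hEA]
  · rw [Matrix.mul_assoc, ← Matrix.mul_assoc (T1 0), hAE, Matrix.one_mul, hQP]
  · intro k
    fin_cases k
    · change Q * T1 0 * (E * P) = 1
      rw [Matrix.mul_assoc, ← Matrix.mul_assoc (T1 0), hAE, Matrix.one_mul, hQP]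
    · change Q * T1 1 * (E * P) = J4 F p
      rw [← hJ]
      simp only [Matrix.mul_assoc]
    · rfl
end

section
/- Let F be a field, let A, B be n×n matrices over F, let α, β ∈ F, and set D := diag(αI_n, A, B, βI_n) (a 4n×4n block-diagonal matrix). If a triple (I_{4p}, J_4(0_p), M') is a direct summand for equivalence of the triple (I_{4n}, J_4(0_n), D), then M', partitioned into sixteen p×p blocks M'_{ij} (1 ≤ i,j ≤ 4), is block upper triangular (M'_{ij} = 0 for i > j) with M'_{11} = αI_p and M'_{44} = βI_p. -/
open Matrix

variable {F : Type} [Field F]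

/-- Matrices intertwining `J₄(0)` are block upper triangular. -/
theorem block_upper_of_mul_J4_eq {p n : ℕ} {X : Matrix (Fin 4 × Fin p) (Fin 4 × Fin n) F}
    (h : X * J4 F n = J4 F p * X) {i j : Fin 4} (hij : j < i) (k : Fin p) (l : Fin n) :
    X (i, k) (j, l) = 0 := by
  have e : ∀ a b : Fin 4, (X * J4 F n) (a, k) (b, l) = (J4 F p * X) (a, k) (b, l) := fun a b => by
    rw [h]
  simp only [Matrix.mul_apply, J4, Fintype.sum_prod_type, ite_and, mul_ite, mul_one, mul_zero,
    ite_mul, one_mul, zero_mul, Finset.sum_ite_irrel, Finset.sum_ite_eq, Finset.sum_ite_eq',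
    Finset.mem_univ, if_true, Finset.sum_const_zero, Fin.sum_univ_four] at e
  have h10 := e 0 0
  have h20 := e 1 0
  have h30 := e 2 0
  have h21 := e 1 1
  have h31 := e 2 1
  have h32 := e 2 2
  simp at h10 h20 h30 h21 h31 h32
  fin_cases i <;> fin_cases j <;> simp_all

/-- If a tuple is equivalent to a direct sum in which one member of each tuple is the identity,
then the projection to and the inclusion of the first summand intertwine all the members. -/
theorem exists_intertwining_of_summand {t p' q' : ℕ} {I X : Type} [Fintype I] [DecidableEq I]
    [Fintype X] [DecidableEq X] {T : Fin t → Matrix I I F} {T1 : Fin t → Matrix X X F}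
    {T2 : Fin t → Matrix (Fin p') (Fin q') F}
    (h : TupEquiv T (fun k => Matrix.fromBlocks (T1 k) 0 0 (T2 k)))
    {k₀ : Fin t} (hT : T k₀ = 1) (hT1 : T1 k₀ = 1) :
    ∃ (P : Matrix X I F) (C : Matrix I X F), P * C = 1 ∧
      ∀ k, P * T k = T1 k * P ∧ T k * C = C * T1 k := by
  obtain ⟨R, R', S, S', -, hRR', hSS, -, h⟩ := h
  have row (k) : Matrix.fromCols (1 : Matrix X X F) (0 : Matrix X (Fin p') F) * (R * T k * S)
      = T1 k * Matrix.fromCols (1 : Matrix X X F) (0 : Matrix X (Fin q') F) := by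
    rw [h, Matrix.fromCols_mul_fromBlocks, Matrix.mul_fromCols]
    simp
  have col (k) : (R * T k * S) * Matrix.fromRows (1 : Matrix X X F) (0 : Matrix (Fin q') X F)
      = Matrix.fromRows (1 : Matrix X X F) (0 : Matrix (Fin p') X F) * T1 k := by
    rw [h, Matrix.fromBlocks_mul_fromRows, Matrix.fromRows_mul]
    simp
  have row₀ := row k₀
  have col₀ := col k₀
  rw [hT, hT1, Matrix.mul_one, Matrix.one_mul] at row₀
  rw [hT, hT1, Matrix.mul_one, Matrix.mul_one] at col₀
  set U := Matrix.fromCols (1 : Matrix X X F) (0 : Matrix X (Fin p') F)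
  set U' := Matrix.fromCols (1 : Matrix X X F) (0 : Matrix X (Fin q') F)
  set V := Matrix.fromRows (1 : Matrix X X F) (0 : Matrix (Fin q') X F)
  set V' := Matrix.fromRows (1 : Matrix X X F) (0 : Matrix (Fin p') X F)
  have hU : U * R = U' * S' := by
    rw [← row₀, Matrix.mul_assoc, Matrix.mul_assoc, hSS, Matrix.mul_one]
  have hV : S * V = R' * V' := by
    rw [← col₀, ← Matrix.mul_assoc, ← Matrix.mul_assoc, hRR', Matrix.one_mul]
  refine ⟨U * R, S * V, ?_, fun k => ⟨?_, ?_⟩⟩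
  · rw [← Matrix.mul_assoc, Matrix.mul_assoc U, row₀, Matrix.fromCols_mul_fromRows]
    simp
  · calc U * R * T k = U * (R * T k * S) * S' := by
          simp only [Matrix.mul_assoc, hSS, Matrix.mul_one]
      _ = T1 k * (U * R) := by rw [row, Matrix.mul_assoc, hU]
  · calc T k * (S * V) = R' * ((R * T k * S) * V) := by
          simp only [← Matrix.mul_assoc, hRR', Matrix.one_mul]
      _ = S * V * T1 k := by rw [col, ← Matrix.mul_assoc, hV]

theorem blkDiag4_mul_apply_s5 {n : ℕ} {X : Type} (M : Fin 4 → Matrix (Fin n) (Fin n) F)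
    (C : Matrix (Fin 4 × Fin n) X F) (a : Fin 4) (x : Fin n) (l : X) :
    (blkDiag4 M * C) (a, x) l = ∑ y, M a x y * C (a, y) l := by
  simp [Matrix.mul_apply, blkDiag4, Fintype.sum_prod_type, ite_mul, Finset.sum_ite_irrel]

theorem mul_blkDiag4_mul_lower {n p : ℕ} {M : Fin 4 → Matrix (Fin n) (Fin n) F}
    {P : Matrix (Fin 4 × Fin p) (Fin 4 × Fin n) F} {C : Matrix (Fin 4 × Fin n) (Fin 4 × Fin p) F}
    (hP : ∀ ⦃i j⦄, j < i → ∀ k l, P (i, k) (j, l) = 0)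
    (hC : ∀ ⦃i j⦄, j < i → ∀ k l, C (i, k) (j, l) = 0)
    {i j : Fin 4} (hij : j < i) (k l : Fin p) :
    (P * (blkDiag4 M * C)) (i, k) (j, l) = 0 := by
  rw [Matrix.mul_apply]
  refine Finset.sum_eq_zero fun ⟨a, x⟩ _ => ?_
  rcases lt_or_ge a i with ha | ha
  · rw [hP ha, zero_mul]
  · simp [blkDiag4_mul_apply_s5, hC (hij.trans_le ha)]

theorem mul_blkDiag4_mul_diag {n p : ℕ} {M : Fin 4 → Matrix (Fin n) (Fin n) F}
    {P : Matrix (Fin 4 × Fin p) (Fin 4 × Fin n) F} {C : Matrix (Fin 4 × Fin n) (Fin 4 × Fin p) F}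
    (hP : ∀ ⦃i j⦄, j < i → ∀ k l, P (i, k) (j, l) = 0)
    (hC : ∀ ⦃i j⦄, j < i → ∀ k l, C (i, k) (j, l) = 0)
    {i : Fin 4} {γ : F} (hM : M i = γ • 1) (k l : Fin p) :
    (P * (blkDiag4 M * C)) (i, k) (i, l) = γ * (P * C) (i, k) (i, l) := by
  rw [Matrix.mul_apply, Matrix.mul_apply, Finset.mul_sum]
  refine Finset.sum_congr rfl fun ⟨a, x⟩ _ => ?_
  rcases lt_trichotomy a i with ha | rfl | ha
  · rw [hP ha, zero_mul, zero_mul, mul_zero]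
  · simp [blkDiag4_mul_apply_s5, hM, Matrix.one_apply, mul_left_comm]
  · simp [blkDiag4_mul_apply_s5, hC ha]

/-- Lemma 3(b): if `(I_{4p}, J₄(0_p), M')` is a direct summand for equivalence of
`(I_{4n}, J₄(0ₙ), diag(αIₙ, A, B, βIₙ))`, then `M'` is block upper triangular with
`M'₁₁ = αI_p` and `M'₄₄ = βI_p`. -/
theorem stmt5 (n : ℕ) (A B : Matrix (Fin n) (Fin n) F) (α β : F)
    (p : ℕ) (M' : Matrix (Fin 4 × Fin p) (Fin 4 × Fin p) F)
    (hsize : 0 < p)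
    (hsummand : ∃ (p' q' : ℕ) (T2 : Fin 3 → Matrix (Fin p') (Fin q') F),
      TupEquiv (![1, J4 F n, blkDiag4 ![α • 1, A, B, β • 1]])
        (fun k => Matrix.fromBlocks ((![1, J4 F p, M']) k) 0 0 (T2 k))) :
    (∀ i j : Fin 4, j < i → ∀ k l : Fin p, M' (i, k) (j, l) = 0) ∧
    (∀ k l : Fin p, M' ((0 : Fin 4), k) ((0 : Fin 4), l)
        = (α • (1 : Matrix (Fin p) (Fin p) F)) k l) ∧
    (∀ k l : Fin p, M' ((3 : Fin 4), k) ((3 : Fin 4), l)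
        = (β • (1 : Matrix (Fin p) (Fin p) F)) k l) := by
  obtain ⟨p', q', T2, hT⟩ := hsummand
  obtain ⟨P, C, hPC, hk⟩ := exists_intertwining_of_summand hT (k₀ := 0) rfl rfl
  have hP : ∀ ⦃i j⦄, j < i → ∀ k l, P (i, k) (j, l) = 0 :=
    fun _ _ hij => block_upper_of_mul_J4_eq (hk 1).1 hij
  have hC : ∀ ⦃i j⦄, j < i → ∀ k l, C (i, k) (j, l) = 0 :=
    fun _ _ hij => block_upper_of_mul_J4_eq (hk 1).2.symm hij
  have hM : M' = P * (blkDiag4 ![α • 1, A, B, β • 1] * C) := by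
    have hD : blkDiag4 ![α • 1, A, B, β • 1] * C = C * M' := (hk 2).2
    rw [hD, ← Matrix.mul_assoc, hPC, Matrix.one_mul]
  refine ⟨fun i j hij k l => ?_, fun k l => ?_, fun k l => ?_⟩
  · rw [hM, mul_blkDiag4_mul_lower hP hC hij]
  · rw [hM, mul_blkDiag4_mul_diag hP hC (γ := α) rfl, hPC]
    simp [Matrix.one_apply]
  · rw [hM, mul_blkDiag4_mul_diag hP hC (γ := β) rfl, hPC]
    simp [Matrix.one_apply]
end

section
/- Let F be a field with an involution a↦ā, let ε₁, ε₂ be nonzero elements of F, ε₃ ∈ F, and let X, Y be n×n matrices over F. Then the triple (ε₁I_{4n}, ε₂J_4(0_n)ᵀ, ε₃D(X*,Y*)) is equivalent to the triple (I_{4n}, J_4(0_n), ν·D'(X*,Y*)), where ν := ε₃/ε₁ and D'(X*,Y*) := diag(0_n, Y*, X*, I_n). -/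
open Matrix

variable {F : Type} [Field F]

/-- Simultaneously relabelling rows and columns by `e` and rescaling them by nonzero scalars
produces an equivalent tuple. -/
theorem tupEquiv_of_reindex_of_scale {t : ℕ} {I J : Type} [Fintype I] [Fintype J]
    [DecidableEq I] [DecidableEq J] {T1 : Fin t → Matrix I I F} {T2 : Fin t → Matrix J J F}
    (e : J ≃ I) (u w : J → F) (hu : ∀ i, u i ≠ 0) (hw : ∀ i, w i ≠ 0)
    (h : ∀ k i j, u i * T1 k (e i) (e j) * w j = T2 k i j) : TupEquiv T1 T2 := by
  have cancel : ∀ v : J → F, (∀ i, v i ≠ 0) →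
      diagonal v * diagonal v⁻¹ = 1 ∧ diagonal v⁻¹ * diagonal v = 1 := fun v hv => by
    simp [diagonal_mul_diagonal, hv]
  refine ⟨(diagonal u).submatrix id e.symm, (diagonal u⁻¹).submatrix e.symm id,
    (diagonal w).submatrix e.symm id, (diagonal w⁻¹).submatrix id e.symm, ?_, ?_, ?_, ?_, ?_⟩
  · rw [submatrix_mul_equiv, (cancel u hu).1, submatrix_id_id]
  · rw [← submatrix_mul _ _ _ _ _ Function.bijective_id, (cancel u hu).2, submatrix_one_equiv]
  · rw [← submatrix_mul _ _ _ _ _ Function.bijective_id, (cancel w hw).1, submatrix_one_equiv]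
  · rw [submatrix_mul_equiv, (cancel w hw).2, submatrix_id_id]
  · intro k
    have hT : T1 k = ((T1 k).submatrix e e).submatrix e.symm e.symm := by simp
    rw [hT, submatrix_mul_equiv, submatrix_mul_equiv, submatrix_id_id]
    ext i j
    rw [mul_diagonal, diagonal_mul, submatrix_apply, h]

theorem J4_rev_transpose (n : ℕ) (p q : Fin 4 × Fin n) :
    J4 F n (p.1.rev, p.2) (q.1.rev, q.2) = J4 F n q p := by
  unfold J4
  refine if_congr ?_ rfl rfl
  simp only [Fin.val_rev, eq_comm (a := p.2)]
  refine and_congr_left fun _ => ?_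
  lia

theorem blkDiag4_rev {n : ℕ} (A B C D : Matrix (Fin n) (Fin n) F) (p q : Fin 4 × Fin n) :
    blkDiag4 ![A, B, C, D] (p.1.rev, p.2) (q.1.rev, q.2) = blkDiag4 ![D, C, B, A] p q := by
  obtain ⟨i, a⟩ := p
  simp only [blkDiag4, Fin.rev_inj]
  fin_cases i <;> rfl

/-- The triple `(ε₁ I_{4n}, ε₂ J₄(0ₙ)ᵀ, ε₃ D(X*,Y*))` is equivalent to
`(I_{4n}, J₄(0ₙ), ν·D'(X*,Y*))` with `ν = ε₃/ε₁` and `D'(X*,Y*) = diag(0ₙ, Y*, X*, Iₙ)`. -/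
theorem stmt6 (σ : F →+* F) (hσ : Function.Involutive σ)
    (ε₁ ε₂ ε₃ : F) (hε₁ : ε₁ ≠ 0) (hε₂ : ε₂ ≠ 0)
    (n : ℕ) (X Y : Matrix (Fin n) (Fin n) F) :
    TupEquiv
      (![ε₁ • (1 : Matrix (Fin 4 × Fin n) (Fin 4 × Fin n) F),
         ε₂ • (J4 F n)ᵀ,
         ε₃ • blkDiag4 ![1, starMat σ X, starMat σ Y, 0]])
      (![(1 : Matrix (Fin 4 × Fin n) (Fin 4 × Fin n) F),
         J4 F n,
         (ε₃ / ε₁) • blkDiag4 ![0, starMat σ Y, starMat σ X, 1]]) := by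
  have hr : ε₂ / ε₁ ≠ 0 := div_ne_zero hε₂ hε₁
  refine tupEquiv_of_reindex_of_scale (Fin.revPerm.prodCongr (Equiv.refl (Fin n)))
    (fun p => (ε₂ / ε₁) ^ (p.1 : ℕ)) (fun p => (ε₁ * (ε₂ / ε₁) ^ (p.1 : ℕ))⁻¹)
    (fun p => pow_ne_zero _ hr)
    (fun p => inv_ne_zero (mul_ne_zero hε₁ (pow_ne_zero _ hr))) ?_
  intro k p q
  have he : ∀ r : Fin 4 × Fin n,
      Fin.revPerm.prodCongr (Equiv.refl (Fin n)) r = (r.1.rev, r.2) := fun _ => rfl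
  fin_cases k
  · change _ * (ε₁ • (1 : Matrix (Fin 4 × Fin n) (Fin 4 × Fin n) F)) _ _ * _ =
      (1 : Matrix (Fin 4 × Fin n) (Fin 4 × Fin n) F) p q
    rw [Matrix.smul_apply, one_apply, one_apply]
    simp only [EmbeddingLike.apply_eq_iff_eq]
    split_ifs with h
    · subst h
      rw [smul_eq_mul]
      field_simp
    · simp
  · change _ * (ε₂ • (J4 F n)ᵀ) _ _ * _ = J4 F n p q
    rw [Matrix.smul_apply, transpose_apply, he, he, J4_rev_transpose, J4]
    split_ifs with h
    · rw [← h.1, pow_succ, smul_eq_mul]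
      field_simp
    · simp
  · change _ * (ε₃ • blkDiag4 ![1, starMat σ X, starMat σ Y, 0]) _ _ * _ =
      ((ε₃ / ε₁) • blkDiag4 ![0, starMat σ Y, starMat σ X, 1]) p q
    rw [Matrix.smul_apply, Matrix.smul_apply, he, he, blkDiag4_rev, blkDiag4]
    split_ifs with h
    · rw [← h, smul_eq_mul, smul_eq_mul]
      field_simp
    · simp
end

section
/- Let F be a field and let A, B, C, D be n×n matrices over F. If the triples G(A,B) = (I_{4n}, J_4(0_n), D(A,B)) and G(C,D) = (I_{4n}, J_4(0_n), D(C,D)) are equivalent, then the pair (A,B) is similar to the pair (C,D). -/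
open Matrix

variable {F : Type} [Field F]

namespace Matrix

theorem J4_mul_apply_castSucc {n : ℕ} {J : Type*} (S : Matrix (Fin 4 × Fin n) J F)
    (i : Fin 3) (a : Fin n) (q : J) :
    (J4 F n * S) (i.castSucc, a) q = S (i.succ, a) q := by
  rw [mul_apply, Finset.sum_eq_single (i.succ, a)]
  · simp [J4]
  · rintro ⟨k, c⟩ - hne
    have : ¬((i : ℕ) + 1 = k ∧ a = c) := fun ⟨h₁, h₂⟩ =>
      hne (Prod.ext (Fin.ext (by simp [← h₁])) h₂.symm)
    simp [J4, this]
  · simp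

theorem mul_J4_apply_zero {n : ℕ} {I : Type*} (S : Matrix I (Fin 4 × Fin n) F)
    (p : I) (b : Fin n) : (S * J4 F n) p (0, b) = 0 := by
  simp [mul_apply, J4]

theorem mul_J4_apply_succ {n : ℕ} {I : Type*} (S : Matrix I (Fin 4 × Fin n) F)
    (p : I) (j : Fin 3) (b : Fin n) :
    (S * J4 F n) p (j.succ, b) = S p (j.castSucc, b) := by
  rw [mul_apply, Finset.sum_eq_single (j.castSucc, b)]
  · simp [J4]
  · rintro ⟨k, c⟩ - hne
    have : ¬((k : ℕ) = j ∧ c = b) := fun ⟨h₁, h₂⟩ =>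
      hne (Prod.ext (Fin.ext (by simp [h₁])) h₂)
    simp [J4, this]
  · simp

/-- The `(i, j)` block of a `4n × 4n` matrix. -/
def block4 {n : ℕ} (S : Matrix (Fin 4 × Fin n) (Fin 4 × Fin n) F) (i j : Fin 4) :
    Matrix (Fin n) (Fin n) F :=
  of fun a b => S (i, a) (j, b)

theorem block4_mul {n : ℕ} (R S : Matrix (Fin 4 × Fin n) (Fin 4 × Fin n) F) (i j : Fin 4) :
    block4 (R * S) i j = ∑ k, block4 R i k * block4 S k j := by
  ext a b
  simp [block4, mul_apply, Fintype.sum_prod_type, Matrix.sum_apply]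

theorem block4_one {n : ℕ} (i : Fin 4) :
    block4 (1 : Matrix (Fin 4 × Fin n) (Fin 4 × Fin n) F) i i = 1 := by
  ext a b
  simp [block4, one_apply]

theorem block4_blkDiag4 {n : ℕ} (M : Fin 4 → Matrix (Fin n) (Fin n) F) (i j : Fin 4) :
    block4 (blkDiag4 M) i j = if i = j then M i else 0 := by
  ext a b
  by_cases h : i = j <;> simp [block4, blkDiag4, h]

section CommuteJ4

variable {n : ℕ} {S : Matrix (Fin 4 × Fin n) (Fin 4 × Fin n) F}

theorem block4_succ_zero_of_commute (h : J4 F n * S = S * J4 F n) (i : Fin 3) :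
    block4 S i.succ 0 = 0 := by
  ext a b
  have := congr_fun₂ h (i.castSucc, a) (0, b)
  rwa [J4_mul_apply_castSucc, mul_J4_apply_zero] at this

theorem block4_diag_of_commute (h : J4 F n * S = S * J4 F n) (i : Fin 4) :
    block4 S i i = block4 S 0 0 := by
  induction i using Fin.induction with
  | zero => rfl
  | succ i ih =>
    rw [← ih]
    ext a b
    have := congr_fun₂ h (i.castSucc, a) (i.succ, b)
    rwa [J4_mul_apply_castSucc, mul_J4_apply_succ] at this

/-- If `S` commutes with `J4` and intertwines two block-diagonal matrices, then its `(0, 0)` block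
intertwines each pair of corresponding diagonal blocks. -/
theorem mul_block4_of_commute (h : J4 F n * S = S * J4 F n)
    {M N : Fin 4 → Matrix (Fin n) (Fin n) F} (hD : blkDiag4 M * S = S * blkDiag4 N) (i : Fin 4) :
    M i * block4 S 0 0 = block4 S 0 0 * N i := by
  have := congr_arg (fun T => block4 T i i) hD
  simpa [block4_mul, block4_blkDiag4, block4_diag_of_commute h i] using this

theorem block4_zero_mul_of_commute (h : J4 F n * S = S * J4 F n)
    {R : Matrix (Fin 4 × Fin n) (Fin 4 × Fin n) F} (hRS : R * S = 1) :
    block4 R 0 0 * block4 S 0 0 = 1 := by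
  rw [← block4_one (F := F) 0, ← hRS, block4_mul, Fin.sum_univ_succ]
  simp [block4_succ_zero_of_commute h]

end CommuteJ4

end Matrix

/-- If the triples `G(A,B) = (I_{4n}, J₄(0ₙ), D(A,B))` and `G(C,D) = (I_{4n}, J₄(0ₙ), D(C,D))`
are equivalent, then the pair (A,B) is similar to the pair (C,D). -/
theorem stmt7 (n : ℕ) (A B C D : Matrix (Fin n) (Fin n) F)
    (h : TupEquiv (![1, J4 F n, Dmat A B]) (![1, J4 F n, Dmat C D])) :
    ∃ S : (Matrix (Fin n) (Fin n) F)ˣ,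
      (↑S⁻¹ : Matrix (Fin n) (Fin n) F) * A * (↑S : Matrix (Fin n) (Fin n) F) = C ∧
      (↑S⁻¹ : Matrix (Fin n) (Fin n) F) * B * (↑S : Matrix (Fin n) (Fin n) F) = D := by
  obtain ⟨R, -, S, -, -, -, -, -, h⟩ := h
  have hRS : R * S = 1 := by simpa using h 0
  have hSR : S * R = 1 := mul_eq_one_comm.mp hRS
  have intertwine {T T' : Matrix (Fin 4 × Fin n) (Fin 4 × Fin n) F} (hT : R * T * S = T') :
      T * S = S * T' := by
    rw [← hT, ← Matrix.mul_assoc, ← Matrix.mul_assoc, hSR, Matrix.one_mul]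
  have hJ : J4 F n * S = S * J4 F n := intertwine (h 1)
  have hD : Dmat A B * S = S * Dmat C D := intertwine (h 2)
  have hinv := block4_zero_mul_of_commute hJ hRS
  refine ⟨⟨block4 S 0 0, block4 R 0 0, mul_eq_one_comm.mp hinv, hinv⟩, ?_, ?_⟩
  · have hA : A * block4 S 0 0 = block4 S 0 0 * C := mul_block4_of_commute hJ hD 1
    simp [Matrix.mul_assoc, hA, ← Matrix.mul_assoc (block4 R 0 0) (block4 S 0 0), hinv]
  · have hB : B * block4 S 0 0 = block4 S 0 0 * D := mul_block4_of_commute hJ hD 2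
    simp [Matrix.mul_assoc, hB, ← Matrix.mul_assoc (block4 R 0 0) (block4 S 0 0), hinv]
end

section
/- Let F be a field, and for a tuple (A₁,…,A_t) of linearly independent (n−t)×(n−t) matrices over F let R(A₁,…,A_t) denote the semialgebra on F^n with multiplication u·v := (uᵀ[[0_t,0],[0,A₁]]v, …, uᵀ[[0_t,0],[0,A_t]]v, 0,…,0)ᵀ. Then R(A₁,…,A_t) and R(B₁,…,B_t) are isomorphic as semialgebras if and only if the tuple (B₁,…,B_t) can be obtained from (A₁,…,A_t) by a simultaneous congruence A_i ↦ SᵀA_iS (with a single nonsingular (n−t)×(n−t) matrix S) followed by a substitution A_i ↦ Σ_j γ_{ij}A_j with a nonsingular t×t matrix [γ_{ij}]. -/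
open Matrix

variable {F : Type} [Field F]

/-- The multiplication on `F^(t+m)` (coordinates indexed by `Fin t ⊕ Fin m`) given by a tuple
`A` of `t` matrices of size m×m:
`u·v = (uᵀ[[0,0],[0,A₁]]v, …, uᵀ[[0,0],[0,A_t]]v, 0, …, 0)ᵀ`. -/
def modelMul {t m : ℕ} (A : Fin t → Matrix (Fin m) (Fin m) F)
    (u v : (Fin t ⊕ Fin m) → F) : (Fin t ⊕ Fin m) → F :=
  Sum.elim (fun k => ∑ i, ∑ j, u (Sum.inr i) * A k i j * v (Sum.inr j)) (fun _ => 0)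

theorem modelMul_eq_elim_dotProduct {t m : ℕ} (A : Fin t → Matrix (Fin m) (Fin m) F)
    (u v : (Fin t ⊕ Fin m) → F) :
    modelMul A u v =
      Sum.elim (fun k => (u ∘ Sum.inr) ⬝ᵥ A k *ᵥ (v ∘ Sum.inr)) (fun _ => 0) := by
  simp [modelMul, dotProduct, mulVec, Finset.mul_sum, mul_assoc]

theorem modelMul_single_inr {t m : ℕ} (A : Fin t → Matrix (Fin m) (Fin m) F) (a b : Fin m) :
    modelMul A (Pi.single (Sum.inr a) 1) (Pi.single (Sum.inr b) 1) =
      Sum.elim (fun k => A k a b) (fun _ => 0) := by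
  simp [modelMul, Pi.single_apply]

/-- The matrix of a homomorphism maps the annihilator `F^t` into itself, as `F^t` is spanned
by products. -/
theorem toBlocks₂₁_eq_zero_of_map_modelMul {t m : ℕ} {A B : Fin t → Matrix (Fin m) (Fin m) F}
    (hA : LinearIndependent F A) {M : Matrix (Fin t ⊕ Fin m) (Fin t ⊕ Fin m) F}
    (hM : ∀ u v, M *ᵥ modelMul A u v = modelMul B (M *ᵥ u) (M *ᵥ v)) :
    M.toBlocks₂₁ = 0 := by
  ext i k
  refine Fintype.linearIndependent_iff.1 hA (fun k => M.toBlocks₂₁ i k) ?_ k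
  ext a b
  have h := congrFun (hM (Pi.single (Sum.inr a) 1) (Pi.single (Sum.inr b) 1)) (Sum.inr i)
  rw [modelMul_single_inr] at h
  simpa [modelMul, mulVec, dotProduct, Matrix.sum_apply, toBlocks₂₁] using h

theorem sum_toBlocks₁₁_smul_of_map_modelMul {t m : ℕ} {A B : Fin t → Matrix (Fin m) (Fin m) F}
    {M : Matrix (Fin t ⊕ Fin m) (Fin t ⊕ Fin m) F}
    (hM : ∀ u v, M *ᵥ modelMul A u v = modelMul B (M *ᵥ u) (M *ᵥ v)) (k : Fin t) :
    ∑ l, M.toBlocks₁₁ k l • A l = M.toBlocks₂₂ᵀ * B k * M.toBlocks₂₂ := by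
  ext a b
  have h := congrFun (hM (Pi.single (Sum.inr a) 1) (Pi.single (Sum.inr b) 1)) (Sum.inl k)
  rw [modelMul_single_inr, modelMul_eq_elim_dotProduct B, mulVec_single_one,
    mulVec_single_one] at h
  rw [Matrix.mul_assoc]
  simpa [mulVec, dotProduct, Matrix.mul_apply, Matrix.sum_apply, toBlocks₁₁, toBlocks₂₂] using h

theorem map_modelMul_fromBlocks {t m : ℕ} {A B : Fin t → Matrix (Fin m) (Fin m) F}
    {S : Matrix (Fin m) (Fin m) F} (hS : IsUnit S) {γ : Matrix (Fin t) (Fin t) F}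
    (h : ∀ i, B i = ∑ j, γ i j • (Sᵀ * A j * S)) (u v : (Fin t ⊕ Fin m) → F) :
    fromBlocks γ 0 0 S⁻¹ *ᵥ modelMul A u v =
      modelMul B (fromBlocks γ 0 0 S⁻¹ *ᵥ u) (fromBlocks γ 0 0 S⁻¹ *ᵥ v) := by
  have hS' : S * S⁻¹ = 1 := mul_nonsing_inv S ((isUnit_iff_isUnit_det S).1 hS)
  have key (x y : Fin m → F) (j : Fin t) :
      (S⁻¹ *ᵥ x) ⬝ᵥ (Sᵀ * A j * S) *ᵥ (S⁻¹ *ᵥ y) = x ⬝ᵥ A j *ᵥ y := by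
    rw [Matrix.mul_assoc, ← mulVec_mulVec, ← mulVec_mulVec, mulVec_mulVec y, hS', one_mulVec,
      dotProduct_mulVec, vecMul_transpose, mulVec_mulVec, hS', one_mulVec]
  simp only [modelMul_eq_elim_dotProduct, fromBlocks_mulVec, Sum.elim_comp_inr, Sum.elim_comp_inl,
    zero_mulVec, zero_add, add_zero, h, sum_mulVec, dotProduct_sum, smul_mulVec, dotProduct_smul,
    key]
  congr 1
  exact mulVec_zero _

/-- Lemma 6 (uniqueness part): the semialgebras `R(A₁,…,A_t)` and `R(B₁,…,B_t)` given by
tuples of linearly independent m×m matrices are isomorphic if and only if `(B₁,…,B_t)` is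
obtained from `(A₁,…,A_t)` by a simultaneous congruence `A_i ↦ SᵀA_iS` followed by a linear
substitution with a nonsingular matrix `[γ_{ij}]`. -/
theorem stmt11 (t m : ℕ) (A B : Fin t → Matrix (Fin m) (Fin m) F)
    (hA : LinearIndependent F A) (hB : LinearIndependent F B) :
    (∃ e : ((Fin t ⊕ Fin m) → F) ≃ₗ[F] ((Fin t ⊕ Fin m) → F),
        ∀ u v, e (modelMul A u v) = modelMul B (e u) (e v)) ↔
    (∃ S : Matrix (Fin m) (Fin m) F, IsUnit S ∧
      ∃ γ : Matrix (Fin t) (Fin t) F, IsUnit γ ∧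
        ∀ i, B i = ∑ j, γ i j • (Sᵀ * A j * S)) := by
  constructor
  · rintro ⟨e, he⟩
    set M := LinearMap.toMatrix' e.toLinearMap
    have hMe (u) : M *ᵥ u = e u := LinearMap.toMatrix'_mulVec e.toLinearMap u
    have hM (u v) : M *ᵥ modelMul A u v = modelMul B (M *ᵥ u) (M *ᵥ v) := by
      simp only [hMe, he]
    have hunit : IsUnit M := by
      refine mulVec_injective_iff_isUnit.1 fun u v huv => e.injective ?_
      simpa only [hMe] using huv
    rw [← fromBlocks_toBlocks M, toBlocks₂₁_eq_zero_of_map_modelMul hA hM,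
      isUnit_fromBlocks_zero₂₁] at hunit
    obtain ⟨hP, hS⟩ := hunit
    have hS' : M.toBlocks₂₂ * M.toBlocks₂₂⁻¹ = 1 :=
      mul_nonsing_inv _ ((isUnit_iff_isUnit_det _).1 hS)
    refine ⟨M.toBlocks₂₂⁻¹, (isUnit_nonsing_inv_iff).2 hS, M.toBlocks₁₁, hP, fun k => ?_⟩
    have hT : (M.toBlocks₂₂⁻¹)ᵀ * M.toBlocks₂₂ᵀ = 1 := by
      rw [← transpose_mul, hS', transpose_one]
    calc B k = (M.toBlocks₂₂⁻¹)ᵀ * (M.toBlocks₂₂ᵀ * B k * M.toBlocks₂₂) * M.toBlocks₂₂⁻¹ := by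
          rw [Matrix.mul_assoc, Matrix.mul_assoc _ _ M.toBlocks₂₂⁻¹, hS', Matrix.mul_one,
            ← Matrix.mul_assoc, hT, Matrix.one_mul]
      _ = _ := by
          simp only [← sum_toBlocks₁₁_smul_of_map_modelMul hM, Matrix.mul_sum, Matrix.sum_mul,
            Matrix.mul_smul, Matrix.smul_mul]
  · rintro ⟨S, hS, γ, hγ, h⟩
    have hunit : IsUnit (fromBlocks γ 0 0 S⁻¹) :=
      isUnit_fromBlocks_zero₂₁.2 ⟨hγ, isUnit_nonsing_inv_iff.2 hS⟩
    refine ⟨LinearEquiv.ofBijective (toLin' (fromBlocks γ 0 0 S⁻¹))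
      ⟨mulVec_injective_iff_isUnit.2 hunit, mulVec_surjective_iff_isUnit.2 hunit⟩, fun u v => ?_⟩
    exact map_modelMul_fromBlocks hS h u v
end
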